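/- arXiv:0911.0948 — 3 statements merged into one kernel-verified Lean document; each statement's English description precedes it below -/
import Mathlib

section
/- Let n ≥ 3 and let 0 < a < 1/(n-2). Then for every u ∈ C_c^∞(B_1), ∫_{B_1} |∇u|² dx ≥ ((n-2)/2)² ∫_{B_1} u²/|x|² dx + a^{2(n-1)/n} S_n · ( ∫_{B_1} X_1(a,|x|)^{2(n-1)/(n-2)} |u|^{2n/(n-2)} dx )^{(n-2)/n}. -/
open MeasureTheory Real

/-- The best Sobolev constant `S_n = π n (n-2) (Γ(n/2)/Γ(n))^(2/n)`. -/
noncomputable def sobolevConst (n : ℕ) : ℝ :=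
  Real.pi * n * ((n : ℝ) - 2) * (Real.Gamma ((n : ℝ) / 2) / Real.Gamma (n : ℝ)) ^ (2 / (n : ℝ))

/-- `X_1(a,s) = (a - ln s)⁻¹`. -/
noncomputable def X1 (a s : ℝ) : ℝ := (a - Real.log s)⁻¹

open Set Filter Topology

/-- Fubini with one coordinate singled out. -/
lemma integral_insertNth {m : ℕ} (k : Fin (m + 1)) (f : (Fin (m + 1) → ℝ) → ℝ) :
    ∫ x, f x = ∫ z : ℝ × (Fin m → ℝ), f (k.insertNth z.1 z.2) := by
  have h := (volume_preserving_piFinSuccAbove (fun _ : Fin (m + 1) => ℝ) k).symm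
  rw [← h.integral_comp (MeasurableEquiv.measurableEmbedding _)]
  rfl

lemma integrable_insertNth {m : ℕ} (k : Fin (m + 1)) (f : (Fin (m + 1) → ℝ) → ℝ) :
    Integrable f ↔ Integrable (fun z : ℝ × (Fin m → ℝ) => f (k.insertNth z.1 z.2)) := by
  have h := (volume_preserving_piFinSuccAbove (fun _ : Fin (m + 1) => ℝ) k).symm
  rw [← h.integrable_comp_emb (MeasurableEquiv.measurableEmbedding _)]
  rfl

lemma continuous_insertNth {m : ℕ} (k : Fin (m + 1)) :
    Continuous (fun z : ℝ × (Fin m → ℝ) => (k.insertNth z.1 z.2 : Fin (m + 1) → ℝ)) := by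
  fun_prop

lemma exists_bound_of_hasCompactSupport {m : ℕ} (F : (Fin m → ℝ) → ℝ) (hc : HasCompactSupport F) :
    ∃ A > 0, ∀ x, F x ≠ 0 → ∀ i, |x i| < A := by
  obtain ⟨A, hA⟩ := hc.isCompact.isBounded.exists_norm_le
  refine ⟨max A 1 + 1, by positivity, fun x hx i => ?_⟩
  have := hA x (subset_tsupport _ hx)
  have h2 : |x i| ≤ max A 1 := ((norm_le_pi_norm x i).trans this).trans (le_max_left _ _)
  linarith

lemma integral_eq_interval {g : ℝ → ℝ} {A : ℝ} (hA : ∀ t, g t ≠ 0 → |t| < A) :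
    ∫ t, g t = ∫ t in (-A)..A, g t := by
  refine (intervalIntegral.integral_eq_integral_of_support_subset fun t ht => ?_).symm
  have := abs_lt.1 (hA t ht)
  exact ⟨this.1, this.2.le⟩

lemma primitive_mem_Icc {g : ℝ → ℝ} {A : ℝ} (hg : Continuous g) (h0 : ∀ t, 0 ≤ g t)
    (hA : ∀ t, g t ≠ 0 → |t| < A) (s : ℝ) :
    ∫ t in (-A)..s, g t ∈ Icc 0 (∫ t in (-A)..A, g t) := by
  have hInt := fun a b => hg.intervalIntegrable (μ := volume) a b
  constructor
  · rcases le_total (-A) s with h | h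
    · exact intervalIntegral.integral_nonneg h fun t _ => h0 t
    · rw [intervalIntegral.integral_congr (g := fun _ => (0 : ℝ))]
      · simp
      · intro t ht
        rw [uIcc_of_ge h] at ht
        by_contra hne
        have := abs_lt.1 (hA t hne)
        linarith [ht.2]
  · rcases le_total s A with h | h
    · rw [← intervalIntegral.integral_add_adjacent_intervals (hInt (-A) s) (hInt s A)]
      have := intervalIntegral.integral_nonneg h (μ := volume) fun t _ => h0 t
      linarith
    · rw [← intervalIntegral.integral_add_adjacent_intervals (hInt (-A) A) (hInt A s)]
      rw [intervalIntegral.integral_congr (a := A) (b := s) (g := fun _ => (0 : ℝ))]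
      · simp
      · intro t ht
        rw [uIcc_of_le h] at ht
        by_contra hne
        have := abs_lt.1 (hA t hne)
        linarith [ht.1]

/-- Triangular transport of a continuous compactly supported probability density `F` to the uniform
density on the cube: `c k` is the conditional distribution function of the `k`-th coordinate given
the preceding ones, and `p k` the conditional density. -/
theorem exists_triangular_transport (m : ℕ) (F : (Fin m → ℝ) → ℝ) (hF : Continuous F)
    (hc : HasCompactSupport F) (h0 : ∀ x, 0 ≤ F x) (h1 : ∫ x, F x = 1) :
    ∃ c p : Fin m → (Fin m → ℝ) → ℝ,
      (∀ k, Measurable (c k)) ∧ (∀ k, Measurable (p k)) ∧ (∀ k x, c k x ∈ Icc (0 : ℝ) 1) ∧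
      (∀ k x, 0 ≤ p k x) ∧
      (∀ k x y, (∀ j ≤ k, x j = y j) → c k x = c k y) ∧
      (∀ k x, HasDerivAt (fun t => c k (Function.update x k t)) (p k x) (x k)) ∧
      (∀ k x, Continuous fun t => p k (Function.update x k t)) ∧
      (∀ x, ∏ k, p k x = F x) ∧
      (∀ H : Fin m → ℝ → ℝ, (∀ k, Continuous (H k)) →
        ∫ x, (∏ k, H k (c k x)) * F x = ∏ k, ∫ t in (0 : ℝ)..1, H k t) := by
  induction m with
  | zero =>
    refine ⟨fun k => k.elim0, fun k => k.elim0, fun k => k.elim0, fun k => k.elim0,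
      fun k => k.elim0, fun k => k.elim0, fun k => k.elim0, fun k => k.elim0, fun k => k.elim0, ?_,
      fun H _ => by simpa using h1⟩
    intro x
    rw [integral_unique, measureReal_def, volume_pi, Measure.pi_of_empty,
      Measure.dirac_apply_of_mem (mem_univ _), ENNReal.toReal_one, one_smul] at h1
    rw [(congrArg F (Subsingleton.elim x _)).trans h1]; simp
  | succ m ih =>
    obtain ⟨A, hA0, hA⟩ := exists_bound_of_hasCompactSupport F hc
    set f : (Fin m → ℝ) → ℝ → ℝ := fun x t => F (Fin.snoc (α := fun _ => ℝ) x t) with hf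
    have hfc : Continuous (Function.uncurry f) := by
      have h := hF.comp ((continuous_insertNth (Fin.last m)).comp continuous_swap)
      convert h using 1
      ext z
      simp [f, Function.uncurry]
    have hfx : ∀ x, Continuous (f x) := fun x => hfc.comp (Continuous.prodMk_right x)
    have hf0 : ∀ x t, 0 ≤ f x t := fun x t => h0 _
    have hfA : ∀ x t, f x t ≠ 0 → |t| < A := fun x t h => by
      simpa using hA _ h (Fin.last m)
    have hfA' : ∀ x t, f x t ≠ 0 → ∀ i, |x i| < A := fun x t h i => by
      simpa using hA _ h i.castSucc
    set M : (Fin m → ℝ) → ℝ := fun x => ∫ t in (-A)..A, f x t with hM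
    have hMc : Continuous M :=
      intervalIntegral.continuous_parametric_intervalIntegral_of_continuous hfc continuous_const
    have hMs : HasCompactSupport M := by
      refine HasCompactSupport.of_support_subset_isCompact
        (isCompact_univ_pi fun _ : Fin m => isCompact_Icc (a := -A) (b := A)) fun x hx => ?_
      rw [Function.mem_support] at hx
      by_contra hxA
      apply hx
      have : ∀ t, f x t = 0 := fun t => by
        by_contra hne
        exact hxA fun i _ => ⟨(abs_lt.1 (hfA' x t hne i)).1.le, (abs_lt.1 (hfA' x t hne i)).2.le⟩
      simp [M, this]
    have hM0 : ∀ x, 0 ≤ M x := fun x =>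
      intervalIntegral.integral_nonneg (by linarith) fun t _ => hf0 x t
    have hMint : ∀ x, ∫ t, f x t = M x := fun x => integral_eq_interval (hfA x)
    have hFint : Integrable F := hF.integrable_of_hasCompactSupport hc
    have hsnoc : ∀ z : ℝ × (Fin m → ℝ), (Fin.last m).insertNth z.1 z.2
        = Fin.snoc (α := fun _ => ℝ) z.2 z.1 := fun z => Fin.insertNth_last' _ _
    have hM1 : ∫ x, M x = 1 := by
      rw [← h1, integral_insertNth (Fin.last m)]
      rw [integrable_insertNth (Fin.last m)] at hFint
      rw [Measure.volume_eq_prod, integral_prod_symm _ hFint]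
      simp only [Fin.insertNth_last', ← hMint, hf]
    have hMzero : ∀ x, M x = 0 → ∀ t, f x t = 0 := fun x hx t => by
      by_contra hne
      have hcs : HasCompactSupport (f x) :=
        HasCompactSupport.of_support_subset_isCompact (isCompact_Icc (a := -A) (b := A))
          fun s hs => ⟨(abs_lt.1 (hfA x s hs)).1.le, (abs_lt.1 (hfA x s hs)).2.le⟩
      have := (hfx x).integral_pos_of_hasCompactSupport_nonneg_nonzero (μ := volume) hcs
        (hf0 x) hne
      rw [hMint, hx] at this
      exact lt_irrefl _ this
    obtain ⟨c, p, hcm, hpm, hc01, hp0, hcd, hcp, hpc, hpF, hH⟩ := ih M hMc hMs hM0 hM1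
    set N : (Fin m → ℝ) → ℝ → ℝ := fun x s => ∫ t in (-A)..s, f x t with hN
    have hNmem : ∀ x s, N x s ∈ Icc 0 (M x) := fun x s =>
      primitive_mem_Icc (hfx x) (hf0 x) (hfA x) s
    have hinit : Continuous (fun x : Fin (m + 1) → ℝ => (Fin.init x : Fin m → ℝ)) :=
      continuous_pi fun i => continuous_apply _
    have hNc : Continuous fun x : Fin (m + 1) → ℝ => N (Fin.init x) (x (Fin.last m)) := by
      refine intervalIntegral.continuous_parametric_intervalIntegral_of_continuous
        (f := fun (x : Fin (m + 1) → ℝ) t => f (Fin.init x) t) ?_ (continuous_apply _)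
      exact hfc.comp ((hinit.comp continuous_fst).prodMk continuous_snd)
    have hNd : ∀ x t, HasDerivAt (N x) (f x t) t := fun x t =>
      intervalIntegral.integral_hasDerivAt_right ((hfx x).intervalIntegrable _ _)
        (hfx x).stronglyMeasurable.stronglyMeasurableAtFilter (hfx x).continuousAt
    have hupd1 : ∀ (x : Fin (m + 1) → ℝ) (k : Fin m) t,
        (Fin.init (Function.update x k.castSucc t) : Fin m → ℝ)
          = Function.update (Fin.init x) k t := fun x k t => Fin.init_update_castSucc ..
    have hupd2 : ∀ (x : Fin (m + 1) → ℝ) t,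
        (Fin.init (Function.update x (Fin.last m) t) : Fin m → ℝ) = Fin.init x :=
      fun x t => Fin.init_update_last ..
    set c' : Fin (m + 1) → (Fin (m + 1) → ℝ) → ℝ :=
      Fin.snoc (α := fun _ => (Fin (m + 1) → ℝ) → ℝ) (fun k x => c k (Fin.init x))
        (fun x => N (Fin.init x) (x (Fin.last m)) / M (Fin.init x)) with hc'
    have hcm' : ∀ k, Measurable (c' k) := by
      refine Fin.lastCases ?_ fun k => ?_
      · simp only [c', Fin.snoc_last]
        exact hNc.measurable.div (hMc.comp hinit).measurable
      · simp only [c', Fin.snoc_castSucc]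
        exact (hcm k).comp hinit.measurable
    have hc01' : ∀ k x, c' k x ∈ Icc (0 : ℝ) 1 := by
      refine Fin.lastCases (fun x => ?_) fun k x => ?_
      · simp only [c', Fin.snoc_last]
        exact ⟨div_nonneg (hNmem _ _).1 (hM0 _), div_le_one_of_le₀ (hNmem _ _).2 (hM0 _)⟩
      · simp only [c', Fin.snoc_castSucc]
        exact hc01 k (Fin.init x)
    refine ⟨c', Fin.snoc (α := fun _ => (Fin (m + 1) → ℝ) → ℝ) (fun k x => p k (Fin.init x))
        (fun x => F x / M (Fin.init x)), hcm', ?_, hc01', ?_, ?_, ?_, ?_, ?_, ?_⟩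
    · refine Fin.lastCases ?_ fun k => ?_
      · simp only [Fin.snoc_last]
        exact hF.measurable.div (hMc.comp hinit).measurable
      · simp only [Fin.snoc_castSucc]
        exact (hpm k).comp hinit.measurable
    · refine Fin.lastCases (fun x => ?_) fun k x => ?_
      · simp only [Fin.snoc_last]
        exact div_nonneg (h0 _) (hM0 _)
      · simpa using hp0 k (Fin.init x)
    · refine Fin.lastCases (fun x y h => ?_) fun k x y h => ?_
      · rw [show x = y from funext fun j => h j (Fin.le_last j)]
      · simp only [c', Fin.snoc_castSucc]
        exact hcd k _ _ fun j hj => h j.castSucc (by simpa using hj)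
    · refine Fin.lastCases (fun x => ?_) fun k x => ?_
      · simp only [c', Fin.snoc_last, Function.update_self, hupd2]
        have := (hNd (Fin.init x) (x (Fin.last m))).div_const (M (Fin.init x))
        simpa [f, Fin.snoc_init_self] using this
      · simp only [c', Fin.snoc_castSucc, hupd1]
        exact hcp k (Fin.init x)
    · refine Fin.lastCases (fun x => ?_) fun k x => ?_
      · simp only [Fin.snoc_last, hupd2]
        exact (hF.comp (continuous_const.update _ continuous_id)).div_const _
      · simp only [Fin.snoc_castSucc, hupd1]
        exact hpc k (Fin.init x)
    · intro x
      rw [Fin.prod_univ_castSucc]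
      simp only [Fin.snoc_last, Fin.snoc_castSucc, hpF]
      by_cases h : M (Fin.init x) = 0
      · have := hMzero _ h (x (Fin.last m))
        simp only [f, Fin.snoc_init_self] at this
        simp [h, this]
      · field_simp
    · intro H hHc
      have hbdd : ∀ k, ∃ C, ∀ t ∈ Icc (0 : ℝ) 1, ‖H k t‖ ≤ C := fun k =>
        isCompact_Icc.exists_bound_of_continuousOn (hHc k).continuousOn
      choose C hC using hbdd
      rw [integral_insertNth (Fin.last m), Measure.volume_eq_prod, integral_prod_symm]
      · rw [Fin.prod_univ_castSucc, ← hH (fun k => H k.castSucc) fun k => hHc _,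
        ← integral_mul_const]
        congr 1
        ext x
        simp only [c', Fin.prod_univ_castSucc, Fin.insertNth_last', Fin.snoc_last,
          Fin.snoc_castSucc,
          Fin.init_snoc]
        simp_rw [mul_assoc]
        rw [integral_const_mul]
        congr 1
        by_cases h : M x = 0
        · have := hMzero x h
          simp only [f] at this
          simp [this, h]
        · have e1 : ∫ t, H (Fin.last m) (N x t / M x) * f x t
              = ∫ t in (-A)..A, H (Fin.last m) (N x t / M x) * f x t :=
            integral_eq_interval fun t ht => hfA x t (right_ne_zero_of_mul ht)
          change ∫ t, H (Fin.last m) (N x t / M x) * f x t = _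
          rw [e1]
          have e2 := intervalIntegral.integral_comp_mul_deriv (a := -A) (b := A)
            (f := fun t => N x t / M x) (f' := fun t => f x t / M x) (g := H (Fin.last m))
            (fun t _ => (hNd x t).div_const _) ((hfx x).div_const _).continuousOn (hHc _)
          have e3 : N x (-A) / M x = 0 := by simp [N]
          have e4 : N x A / M x = 1 := div_self h
          simp only [e3, e4] at e2
          rw [← e2, ← intervalIntegral.integral_const_mul]
          congr 1
          ext t
          simp only [Function.comp]
          field_simp
      · refine (integrable_insertNth (Fin.last m) fun x => (∏ k, H k (c' k x)) * F x).1 ?_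
        refine hFint.bdd_mul (c := ∏ k, C k) ?_ (.of_forall fun x => ?_)
        · exact (Finset.measurable_fun_prod _ fun k _ =>
            (hHc k).measurable.comp (hcm' k)).aestronglyMeasurable
        · rw [norm_prod]
          exact Finset.prod_le_prod (fun _ _ => norm_nonneg _) fun k _ => hC k _ (hc01' k x)

/-- Integration by parts in one coordinate against a bounded monotone field component. -/
lemma integral_mul_partial_eq_neg {m : ℕ} (k : Fin (m + 1)) {G DG T DT : (Fin (m + 1) → ℝ) → ℝ}
    {B : ℝ} (hG : Continuous G) (hGs : HasCompactSupport G) (hG0 : ∀ x, 0 ≤ G x)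
    (hDG : Continuous DG) (hDGs : HasCompactSupport DG)
    (hGd : ∀ x, HasDerivAt (fun t => G (Function.update x k t)) (DG x) (x k))
    (hT : Measurable T) (hTB : ∀ x, |T x| ≤ B) (hDT : Measurable DT) (hDT0 : ∀ x, 0 ≤ DT x)
    (hTd : ∀ x, HasDerivAt (fun t => T (Function.update x k t)) (DT x) (x k))
    (hDTc : ∀ x, Continuous fun t => DT (Function.update x k t)) :
    Integrable (fun x => G x * DT x) ∧ ∫ x, G x * DT x = - ∫ x, DG x * T x := by
  have hline : ∀ (y : Fin m → ℝ), Continuous fun t : ℝ => (k.insertNth t y : Fin (m + 1) → ℝ) :=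
    fun y => (continuous_insertNth k).comp (Continuous.prodMk_left y)
  have hsupp : ∀ {f : (Fin (m + 1) → ℝ) → ℝ}, HasCompactSupport f → ∀ y : Fin m → ℝ,
      HasCompactSupport fun t : ℝ => f (k.insertNth t y) := by
    intro f hf y
    obtain ⟨A, -, hA⟩ := exists_bound_of_hasCompactSupport f hf
    refine HasCompactSupport.of_support_subset_isCompact (isCompact_Icc (a := -A) (b := A))
      fun t ht => abs_le.1 ?_
    have := (hA _ ht k).le
    simpa using this
  have hd : ∀ {f f' : (Fin (m + 1) → ℝ) → ℝ},
      (∀ x, HasDerivAt (fun t => f (Function.update x k t)) (f' x) (x k)) →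
      ∀ (y : Fin m → ℝ) (t : ℝ), HasDerivAt (fun t => f (k.insertNth t y))
        (f' (k.insertNth t y)) t := by
    intro f f' h y t
    have := h (k.insertNth t y)
    simpa using this
  have hTl : ∀ y : Fin m → ℝ, Continuous fun t : ℝ => T (k.insertNth t y) := fun y =>
    continuous_iff_continuousAt.2 fun t => (hd hTd y t).continuousAt
  have hDTl : ∀ y : Fin m → ℝ, Continuous fun t : ℝ => DT (k.insertNth t y) := fun y => by
    simpa using hDTc (k.insertNth 0 y)
  have hGl : ∀ y : Fin m → ℝ, Continuous fun t : ℝ => G (k.insertNth t y) := fun y =>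
    hG.comp (hline y)
  have hDGl : ∀ y : Fin m → ℝ, Continuous fun t : ℝ => DG (k.insertNth t y) := fun y =>
    hDG.comp (hline y)
  have hi : ∀ y : Fin m → ℝ,
      Integrable fun t : ℝ => G (k.insertNth t y) * DT (k.insertNth t y) := fun y =>
    ((hGl y).mul (hDTl y)).integrable_of_hasCompactSupport (hsupp hGs y).mul_right
  have hparts : ∀ y : Fin m → ℝ, ∫ t : ℝ, G (k.insertNth t y) * DT (k.insertNth t y)
      = - ∫ t : ℝ, DG (k.insertNth t y) * T (k.insertNth t y) := fun y =>
    integral_mul_deriv_eq_deriv_mul_of_integrable (fun t _ => hd hGd y t) (fun t _ => hd hTd y t)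
      (hi y)
      (((hDGl y).mul (hTl y)).integrable_of_hasCompactSupport (hsupp hDGs y).mul_right)
      (((hGl y).mul (hTl y)).integrable_of_hasCompactSupport (hsupp hGs y).mul_right)
  have hDGT : Integrable fun x => DG x * T x :=
    (hDG.integrable_of_hasCompactSupport hDGs).mul_bdd hT.aestronglyMeasurable
      (.of_forall hTB)
  have hDGT' := (integrable_insertNth k fun x => DG x * T x).1 hDGT
  have hInt : Integrable fun x => G x * DT x := by
    rw [integrable_insertNth k, Measure.volume_eq_prod, integrable_prod_iff']
    · refine ⟨.of_forall hi, ?_⟩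
      have : Integrable fun y : Fin m → ℝ => ∫ t : ℝ, DG (k.insertNth t y) * T (k.insertNth t y) :=
        hDGT'.integral_prod_right
      refine this.neg.congr (.of_forall fun y => ?_)
      simp only [Pi.neg_apply]
      rw [← hparts]
      congr 1
      ext t
      rw [norm_of_nonneg (mul_nonneg (hG0 _) (hDT0 _))]
    · exact ((hG.measurable.mul hDT).comp
        (continuous_insertNth k).measurable).aestronglyMeasurable
  refine ⟨hInt, ?_⟩
  rw [integral_insertNth k, integral_insertNth k, Measure.volume_eq_prod, integral_prod_symm,
    integral_prod_symm, ← integral_neg]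
  · simp only [hparts]
  · exact hDGT'
  · exact (integrable_insertNth k fun x => G x * DT x).1 hInt
/-- Quantile function of the density proportional to `(1 + z ^ 2) ^ (-β)` on `[-R, R]`. -/
lemma exists_quantile (β R : ℝ) (hR : 0 < R) :
    ∃ h : ℝ → ℝ, Continuous h ∧
      (∀ t ∈ Icc (0 : ℝ) 1, |h t| ≤ R ∧
        HasDerivAt h ((∫ z in (-R)..R, (1 + z ^ 2) ^ (-β)) * (1 + h t ^ 2) ^ β) t) ∧
      ∫ t in (0 : ℝ)..1, (1 + h t ^ 2)
        = (∫ z in (-R)..R, (1 + z ^ 2) ^ (1 - β)) / ∫ z in (-R)..R, (1 + z ^ 2) ^ (-β) := by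
  have hpos : ∀ z : ℝ, 0 < 1 + z ^ 2 := fun z => by positivity
  set φ : ℝ → ℝ := fun z => (1 + (max (-R) (min z R)) ^ 2) ^ (-β) with hφ
  have hφc : Continuous φ := by
    refine Continuous.rpow_const (by fun_prop) fun z => Or.inl (hpos _).ne'
  have hφpos : ∀ z, 0 < φ z := fun z => rpow_pos_of_pos (hpos _) _
  have hφeq : ∀ z ∈ Icc (-R) R, φ z = (1 + z ^ 2) ^ (-β) := fun z hz => by
    simp only [φ]
    rw [min_eq_left hz.2, max_eq_right hz.1]
  set I := ∫ z in (-R)..R, (1 + z ^ 2) ^ (-β) with hI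
  have hIφ : ∫ z in (-R)..R, φ z = I := by
    refine intervalIntegral.integral_congr fun z hz => ?_
    rw [uIcc_of_le (by linarith)] at hz
    exact hφeq z hz
  have hIpos : 0 < I := by
    rw [← hIφ]
    exact intervalIntegral.intervalIntegral_pos_of_pos (hφc.intervalIntegrable _ _) hφpos
      (by linarith)
  set Φ : ℝ → ℝ := fun z => (∫ s in (-R)..z, φ s) / I with hΦ
  have hΦd : ∀ z, HasDerivAt Φ (φ z / I) z := fun z =>
    (intervalIntegral.integral_hasDerivAt_right (hφc.intervalIntegrable _ _)
      hφc.stronglyMeasurable.stronglyMeasurableAtFilter hφc.continuousAt).div_const _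
  have hΦc : Continuous Φ := continuous_iff_continuousAt.2 fun z => (hΦd z).continuousAt
  have hmono : StrictMono Φ := strictMono_of_hasDerivAt_pos hΦd fun z => div_pos (hφpos z) hIpos
  have hΦl : Φ (-R) = 0 := by simp [Φ]
  have hΦr : Φ R = 1 := by simp only [Φ]; rw [hIφ]; exact div_self hIpos.ne'
  obtain ⟨ε, hε, hφε⟩ : ∃ ε > 0, ∀ z, ε ≤ φ z := by
    obtain ⟨x, -, hx⟩ := (isCompact_Icc (a := -R) (b := R)).exists_isMinOn
      ⟨0, by constructor <;> linarith⟩ hφc.continuousOn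
    refine ⟨φ x, hφpos x, fun z => ?_⟩
    have h1 : max (-R) (min z R) ∈ Icc (-R) R :=
      ⟨le_max_left _ _, max_le (by linarith) (min_le_right _ _)⟩
    have := hx h1
    simp only [mem_ofPred_eq] at this
    rw [hφeq _ h1] at this
    exact this
  have hInt := fun a b => hφc.intervalIntegrable (μ := volume) a b
  have hgrow : ∀ a b, a ≤ b → ε / I * (b - a) ≤ Φ b - Φ a := by
    intro a b hab
    have h1 : Φ b - Φ a = (∫ s in a..b, φ s) / I := by
      simp only [Φ]
      rw [← sub_div, intervalIntegral.integral_interval_sub_left (hInt _ _) (hInt _ _)]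
    have h2 : ∫ s in a..b, ε ≤ ∫ s in a..b, φ s :=
      intervalIntegral.integral_mono_on hab (by simp) (hInt _ _) fun z _ => hφε z
    rw [intervalIntegral.integral_const, smul_eq_mul] at h2
    rw [h1, div_mul_eq_mul_div]
    gcongr
    linarith
  have htop : Tendsto Φ atTop atTop := by
    refine tendsto_atTop_mono' atTop (f₁ := fun z => ε / I * z) ?_
      (tendsto_id.const_mul_atTop (by positivity))
    filter_upwards [eventually_ge_atTop 0] with z hz
    have h1 := hgrow 0 z hz
    have h2 := hgrow (-R) 0 (by linarith)
    rw [hΦl] at h2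
    have : 0 ≤ ε / I * (0 - -R) := by
      have : 0 ≤ ε / I := by positivity
      nlinarith
    linarith
  have hbot : Tendsto Φ atBot atBot := by
    have h0 : Tendsto (fun z => ε / I * (z + R)) atBot atBot :=
      (tendsto_atBot_add_const_right _ _ tendsto_id).const_mul_atBot (by positivity)
    refine tendsto_atBot_mono' atBot ?_ h0
    filter_upwards [eventually_le_atBot (-R)] with z hz
    have h1 := hgrow z (-R) hz
    rw [hΦl] at h1
    linarith
  set e := hmono.orderIsoOfSurjective Φ (hΦc.surjective htop hbot) with he
  have hΦe : ∀ t, Φ (e.symm t) = t := fun t => e.apply_symm_apply t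
  have heΦ : ∀ z, e.symm (Φ z) = z := fun t => e.symm_apply_apply t
  have hec : Continuous e.symm := e.symm.continuous
  refine ⟨e.symm, hec, fun t ht => ?_, ?_⟩
  · have h1 : e.symm t ∈ Icc (-R) R := by
      constructor
      · rw [← hmono.le_iff_le, hΦl, hΦe]; exact ht.1
      · rw [← hmono.le_iff_le, hΦr, hΦe]; exact ht.2
    refine ⟨abs_le.2 h1, ?_⟩
    have h2 := HasDerivAt.of_local_left_inverse hec.continuousAt (hΦd (e.symm t))
      (div_pos (hφpos _) hIpos).ne' (.of_forall hΦe)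
    rw [hφeq _ h1, rpow_neg (hpos _).le, inv_div, div_inv_eq_mul] at h2
    exact h2
  · have h1 := intervalIntegral.integral_comp_mul_deriv (a := -R) (b := R)
      (g := fun t => 1 + e.symm t ^ 2) (fun z _ => hΦd z) (hφc.div_const _).continuousOn
      (by fun_prop)
    rw [hΦl, hΦr] at h1
    rw [← h1, ← intervalIntegral.integral_div]
    refine intervalIntegral.integral_congr fun z hz => ?_
    rw [uIcc_of_le (by linarith)] at hz
    simp only [Function.comp, heΦ, hφeq z hz]
    rw [sub_eq_add_neg, rpow_add (hpos _), rpow_one]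
    ring

/-- The integral of `(1 + z ^ 2) ^ (-β)` over the line. -/
noncomputable def lineIntegral (β : ℝ) : ℝ := ∫ z : ℝ, (1 + z ^ 2) ^ (-β)

lemma integrable_one_add_sq {β : ℝ} (hβ : 1 / 2 < β) :
    Integrable fun z : ℝ => (1 + z ^ 2) ^ (-β) := by
  have := integrable_rpow_neg_one_add_norm_sq (E := ℝ) (μ := volume) (r := 2 * β)
    (by simp; linarith)
  simpa [neg_div] using this

lemma lineIntegral_pos {β : ℝ} (hβ : 1 / 2 < β) : 0 < lineIntegral β := by
  refine (integral_pos_iff_support_of_nonneg (fun z => by positivity)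
    (integrable_one_add_sq hβ)).2 ?_
  have : Function.support (fun z : ℝ => (1 + z ^ 2) ^ (-β)) = univ :=
    eq_univ_of_forall fun z => (rpow_pos_of_pos (by positivity) _).ne'
  simp [this]

lemma lineIntegral_succ {β : ℝ} (hβ : 1 / 2 < β) :
    2 * β * lineIntegral (β + 1) = (2 * β - 1) * lineIntegral β := by
  have hpos : ∀ z : ℝ, 0 < 1 + z ^ 2 := fun z => by positivity
  have hi1 := integrable_one_add_sq hβ
  have hi2 := integrable_one_add_sq (β := β + 1) (by linarith)
  have hd : ∀ z : ℝ, HasDerivAt (fun z : ℝ => z * (1 + z ^ 2) ^ (-β))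
      ((1 - 2 * β) * (1 + z ^ 2) ^ (-β) + 2 * β * (1 + z ^ 2) ^ (-(β + 1))) z := by
    intro z
    have h1 : HasDerivAt (fun z : ℝ => 1 + z ^ 2) (2 * z) z := by
      simpa using (hasDerivAt_pow 2 z).const_add 1
    have h2 := (hasDerivAt_id' z).mul (h1.rpow_const (p := -β) (Or.inl (hpos z).ne'))
    refine h2.congr_deriv ?_
    have h3 : (1 + z ^ 2) ^ (-β) = (1 + z ^ 2) * (1 + z ^ 2) ^ (-(β + 1)) := by
      rw [← rpow_one_add' (hpos z).le (by linarith)]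
      ring_nf
    rw [show -β - 1 = -(β + 1) by ring, h3]
    ring
  have hbound : ∀ z : ℝ, |z * (1 + z ^ 2) ^ (-β)| ≤ |z| ^ (1 - 2 * β) := by
    intro z
    rcases eq_or_ne z 0 with rfl | hz
    · simp; positivity
    · rw [abs_mul, abs_of_pos (rpow_pos_of_pos (hpos z) _)]
      have h1 : (1 + z ^ 2) ^ (-β) ≤ (z ^ 2) ^ (-β) :=
        rpow_le_rpow_of_nonpos (by positivity) (by linarith) (by linarith)
      have h2 : (z ^ 2) ^ (-β) = |z| ^ (-(2 * β)) := by
        rw [← sq_abs, ← rpow_natCast, ← rpow_mul (abs_nonneg z)]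
        congr 1; push_cast; ring
      rw [sub_eq_add_neg, rpow_add (abs_pos.2 hz), rpow_one, ← h2]
      gcongr
  have htop : Tendsto (fun z : ℝ => z * (1 + z ^ 2) ^ (-β)) atTop (𝓝 0) := by
    refine squeeze_zero_norm hbound ?_
    have := (tendsto_rpow_neg_atTop (y := 2 * β - 1) (by linarith)).comp tendsto_abs_atTop_atTop
    simpa [Function.comp_def] using this
  have hbot : Tendsto (fun z : ℝ => z * (1 + z ^ 2) ^ (-β)) atBot (𝓝 0) := by
    refine squeeze_zero_norm hbound ?_
    have := (tendsto_rpow_neg_atTop (y := 2 * β - 1) (by linarith)).comp tendsto_abs_atBot_atTop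
    simpa [Function.comp_def] using this
  have := integral_of_hasDerivAt_of_tendsto hd
    ((hi1.const_mul _).add (hi2.const_mul _)) hbot htop
  rw [integral_add (hi1.const_mul _) (hi2.const_mul _), integral_const_mul, integral_const_mul]
    at this
  simp only [lineIntegral]
  linarith

lemma lineIntegral_one : lineIntegral 1 = π := by
  simp only [lineIntegral, rpow_neg_one]
  exact integral_univ_inv_one_add_sq

lemma lineIntegral_three_halves : lineIntegral (3 / 2) = 2 := by
  have hpos : ∀ z : ℝ, 0 < 1 + z ^ 2 := fun z => by positivity
  have hd : ∀ z : ℝ, HasDerivAt (fun z : ℝ => z * (1 + z ^ 2) ^ (-(1 / 2) : ℝ))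
      ((1 + z ^ 2) ^ (-(3 / 2) : ℝ)) z := by
    intro z
    have h1 : HasDerivAt (fun z : ℝ => 1 + z ^ 2) (2 * z) z := by
      simpa using (hasDerivAt_pow 2 z).const_add 1
    have h2 := (hasDerivAt_id' z).mul (h1.rpow_const (p := -(1 / 2)) (Or.inl (hpos z).ne'))
    refine h2.congr_deriv ?_
    have h3 : (1 + z ^ 2) ^ (-(1 / 2) : ℝ) = (1 + z ^ 2) * (1 + z ^ 2) ^ (-(3 / 2) : ℝ) := by
      rw [← rpow_one_add' (hpos z).le (by norm_num)]
      norm_num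
    rw [show (-(1 / 2) - 1 : ℝ) = -(3 / 2) by norm_num, h3]
    ring
  have htop : Tendsto (fun z : ℝ => z * (1 + z ^ 2) ^ (-(1 / 2) : ℝ)) atTop (𝓝 1) := by
    have h1 : Tendsto (fun z : ℝ => (1 + z⁻¹ ^ 2) ^ (-(1 / 2) : ℝ)) atTop
        (𝓝 ((1 + 0 ^ 2) ^ (-(1 / 2) : ℝ))) :=
      ((tendsto_inv_atTop_zero.pow 2).const_add 1).rpow_const (Or.inl (by norm_num))
    rw [zero_pow two_ne_zero, add_zero, one_rpow] at h1
    refine h1.congr' ?_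
    filter_upwards [eventually_gt_atTop 0] with z hz
    have h2 : 1 + z ^ 2 = z ^ 2 * (1 + z⁻¹ ^ 2) := by field_simp; ring
    have h3 : (z ^ 2) ^ (-(1 / 2) : ℝ) = z⁻¹ := by
      rw [← rpow_natCast, ← rpow_mul hz.le, ← rpow_neg_one]; norm_num
    rw [h2, mul_rpow (by positivity) (by positivity), h3, mul_inv_cancel_left₀ hz.ne']
  have hbot : Tendsto (fun z : ℝ => z * (1 + z ^ 2) ^ (-(1 / 2) : ℝ)) atBot (𝓝 (-1)) := by
    refine (htop.comp tendsto_neg_atBot_atTop).neg.congr fun z => ?_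
    simp
  have := integral_of_hasDerivAt_of_tendsto hd (integrable_one_add_sq (by norm_num)) hbot htop
  rw [lineIntegral, this]; norm_num

lemma lineIntegral_eq_Gamma (k : ℕ) :
    lineIntegral (((k : ℝ) + 2) / 2) = √π * Gamma (((k : ℝ) + 1) / 2) /
      Gamma (((k : ℝ) + 2) / 2) := by
  induction k using Nat.twoStepInduction with
  | zero =>
    have := Real.mul_self_sqrt Real.pi_pos.le
    norm_num [lineIntegral_one, Gamma_one_half_eq, this]
  | one =>
    have : Gamma (3 / 2) = √π / 2 := by
      have := Gamma_add_one (s := 1 / 2) (by norm_num)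
      rw [Gamma_one_half_eq] at this
      rw [show (3 / 2 : ℝ) = 1 / 2 + 1 by norm_num, this]; ring
    norm_num [lineIntegral_three_halves, this]
    have := Real.sqrt_pos.2 Real.pi_pos
    field_simp
  | more k ih _ =>
    have h1 := lineIntegral_succ (β := ((k : ℝ) + 2) / 2)
      (by linarith [(Nat.cast_nonneg k : (0 : ℝ) ≤ k)])
    have h2 := Gamma_add_one (s := ((k : ℝ) + 1) / 2) (by positivity)
    have h3 := Gamma_add_one (s := ((k : ℝ) + 2) / 2) (by positivity)
    push_cast
    rw [show ((k : ℝ) + 2 + 2) / 2 = (k + 2) / 2 + 1 by ring,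
      show ((k : ℝ) + 2 + 1) / 2 = (k + 1) / 2 + 1 by ring, h2, h3]
    rw [ih] at h1
    have h4 : 0 < Gamma (((k : ℝ) + 2) / 2) := Gamma_pos_of_pos (by positivity)
    field_simp at h1 ⊢
    linarith

lemma prod_one_add_sq_sub_one {n : ℕ} (z : Fin n → ℝ) :
    ∑ k, (z k * ∏ j ∈ Finset.univ.filter (· < k), √(1 + z j ^ 2)) ^ 2
      = ∏ k, (1 + z k ^ 2) - 1 := by
  have h := Finset.prod_add_ordered Finset.univ (fun _ : Fin n => (1 : ℝ)) (fun k => z k ^ 2)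
  simp only [Finset.prod_const_one, mul_one] at h
  rw [h, add_sub_cancel_left]
  refine Finset.sum_congr rfl fun k _ => ?_
  rw [mul_pow, ← Finset.prod_pow]
  congr 1
  refine Finset.prod_congr rfl fun j _ => ?_
  rw [sq_sqrt (by positivity)]

lemma prod_rpow_mul_prod_sqrt {n : ℕ} (w : Fin n → ℝ) (hw : ∀ k, 0 < w k) :
    ∏ k, (w k ^ (((n : ℝ) + k + 1) / 2) * ∏ j ∈ Finset.univ.filter (· < k), √(w j))
      = (∏ k, w k) ^ n := by
  rw [Finset.prod_mul_distrib]
  have h : ∏ k, ∏ j ∈ Finset.univ.filter (· < k), √(w j)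
      = ∏ j, ∏ k ∈ Finset.Ioi j, √(w j) := by
    refine Finset.prod_comm' fun k j => ?_
    simp
  rw [h, ← Finset.prod_mul_distrib, ← Finset.prod_pow]
  refine Finset.prod_congr rfl fun j _ => ?_
  rw [Finset.prod_const, Fin.card_Ioi, sqrt_eq_rpow, ← rpow_natCast, ← rpow_natCast,
    ← rpow_mul (hw j).le, ← rpow_add (hw j)]
  congr 1
  have : (j : ℕ) + 1 ≤ n := j.2
  rw [show n - 1 - (j : ℕ) = n - (j + 1) by omega, Nat.cast_sub this]
  push_cast
  ring

lemma fderiv_abs_rpow_apply {E : Type*} [NormedAddCommGroup E] [NormedSpace ℝ E] {u : E → ℝ}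
    {x : E} (hu : DifferentiableAt ℝ u x) {q : ℝ} (hq : 1 < q) (v : E) :
    |fderiv ℝ (fun y => |u y| ^ q) x v| = q * |u x| ^ (q - 1) * |fderiv ℝ u x v| := by
  have h := (hasDerivAt_abs_rpow (u x) hq).comp_hasFDerivAt x hu.hasFDerivAt
  have h' : fderiv ℝ (fun y => |u y| ^ q) x = (q * |u x| ^ (q - 2) * u x) • fderiv ℝ u x :=
    h.fderiv
  rw [h', smul_apply, smul_eq_mul, abs_mul, abs_mul, abs_mul,
    abs_of_pos (by linarith : 0 < q), abs_of_nonneg (rpow_nonneg (abs_nonneg _) _), mul_assoc q]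
  congr 2
  rcases eq_or_ne (u x) 0 with h0 | h0
  · simp [h0, zero_rpow (by linarith : q - 1 ≠ 0)]
  · rw [show q - 1 = q - 2 + 1 by ring, rpow_add (abs_pos.2 h0), rpow_one]

/-- Sobolev inequality obtained from transport onto the extremal density truncated at `R`. -/
lemma truncated_sobolev {m : ℕ} {p q : ℝ} (hq : 1 < q) (hpq : p = 2 * (q - 1))
    (hpn : p * (1 - 1 / ((m : ℝ) + 1)) = q)
    {u : (Fin (m + 1) → ℝ) → ℝ} (hu : ContDiff ℝ 1 u) (hc : HasCompactSupport u)
    (h1 : ∫ x, |u x| ^ p = 1) {R : ℝ} (hR : 0 < R) {l : ℝ} (hl : 0 < l) :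
    ((m : ℝ) + 1) * (∏ k : Fin (m + 1), ∫ z in (-R)..R,
        (1 + z ^ 2) ^ (-((((m + 1 : ℕ) : ℝ) + k + 1) / 2))) ^ (1 / ((m : ℝ) + 1)) *
      ∏ k : Fin (m + 1), ((∫ z in (-R)..R, (1 + z ^ 2) ^ (1 - (((m + 1 : ℕ) : ℝ) + k + 1) / 2)) /
        ∫ z in (-R)..R, (1 + z ^ 2) ^ (-((((m + 1 : ℕ) : ℝ) + k + 1) / 2)))
    ≤ q / 2 * (l * (∫ x, ∑ k, (fderiv ℝ u x (Pi.single k 1)) ^ 2) +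
        l⁻¹ * (∏ k : Fin (m + 1), ((∫ z in (-R)..R,
          (1 + z ^ 2) ^ (1 - (((m + 1 : ℕ) : ℝ) + k + 1) / 2)) /
        ∫ z in (-R)..R, (1 + z ^ 2) ^ (-((((m + 1 : ℕ) : ℝ) + k + 1) / 2))) - 1)) := by
  have hp : 0 < p := by linarith
  have hm : (0 : ℝ) < (m : ℝ) + 1 := by positivity
  set β : Fin (m + 1) → ℝ := fun k => (((m + 1 : ℕ) : ℝ) + k + 1) / 2 with hβ
  choose h hhc hh hhInt using fun k : Fin (m + 1) => exists_quantile (β k) R hR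
  set I : Fin (m + 1) → ℝ := fun k => ∫ z in (-R)..R, (1 + z ^ 2) ^ (-(β k)) with hI
  have hI0 : ∀ k, 0 ≤ I k := fun k =>
    intervalIntegral.integral_nonneg (by linarith) fun z _ => by positivity
  have hhE : ∏ k, ((∫ z in (-R)..R, (1 + z ^ 2) ^ (1 - β k)) / I k)
      = ∏ k, ∫ t in (0 : ℝ)..1, (1 + h k t ^ 2) :=
    Finset.prod_congr rfl fun k _ => (hhInt k).symm
  change ((m : ℝ) + 1) * (∏ k, I k) ^ (1 / ((m : ℝ) + 1)) *
      ∏ k, ((∫ z in (-R)..R, (1 + z ^ 2) ^ (1 - β k)) / I k) ≤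
    q / 2 * (l * (∫ x, ∑ k, (fderiv ℝ u x (Pi.single k 1)) ^ 2) +
      l⁻¹ * (∏ k, ((∫ z in (-R)..R, (1 + z ^ 2) ^ (1 - β k)) / I k) - 1))
  rw [hhE]
  set F : (Fin (m + 1) → ℝ) → ℝ := fun x => |u x| ^ p with hF
  have hFc : Continuous F := hu.continuous.abs.rpow_const fun x => Or.inr hp.le
  have hFs : HasCompactSupport F := hc.comp_left (g := fun t => |t| ^ p) (by simp [hp.ne'])
  have hF0 : ∀ x, 0 ≤ F x := fun x => rpow_nonneg (abs_nonneg _) _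
  have hFi : Integrable F := hFc.integrable_of_hasCompactSupport hFs
  obtain ⟨c, d, hcm, hdm, hc01, hd0, hcdep, hcd, hdc, hdF, hH⟩ :=
    exists_triangular_transport (m + 1) F hFc hFs hF0 h1
  set z : Fin (m + 1) → (Fin (m + 1) → ℝ) → ℝ := fun k x => h k (c k x) with hz
  have hzR : ∀ k x, |z k x| ≤ R := fun k x => (hh k _ (hc01 k x)).1
  have hzm : ∀ k, Measurable (z k) := fun k => (hhc k).measurable.comp (hcm k)
  set s : Fin (m + 1) → (Fin (m + 1) → ℝ) → ℝ :=
    fun k x => ∏ j ∈ Finset.univ.filter (· < k), √(1 + z j x ^ 2) with hs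
  have hsm : ∀ k, Measurable (s k) := fun k =>
    Finset.measurable_fun_prod _ fun j _ => (((hzm j).pow_const 2).const_add 1).sqrt
  have hs0 : ∀ k x, 0 ≤ s k x := fun k x => Finset.prod_nonneg fun _ _ => sqrt_nonneg _
  have hsu : ∀ k x t, s k (Function.update x k t) = s k x := fun k x t => by
    refine Finset.prod_congr rfl fun j hj => ?_
    have hjk : j < k := by simpa using hj
    have : c j (Function.update x k t) = c j x :=
      hcdep j _ _ fun i hi => Function.update_of_ne (hi.trans_lt hjk).ne _ _
    simp only [z, this]
  set T : Fin (m + 1) → (Fin (m + 1) → ℝ) → ℝ := fun k x => z k x * s k x with hT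
  set W : (Fin (m + 1) → ℝ) → ℝ := fun x => ∏ k, (1 + z k x ^ 2) with hW
  have hW1 : ∀ x, 0 ≤ W x := fun x => Finset.prod_nonneg fun _ _ => by positivity
  have hWm : Measurable W :=
    Finset.measurable_fun_prod _ fun j _ => ((hzm j).pow_const 2).const_add 1
  have hTW : ∀ x, ∑ k, T k x ^ 2 = W x - 1 := fun x => prod_one_add_sq_sub_one fun k => z k x
  have hWB : ∀ x, |W x| ≤ ∏ k : Fin (m + 1), (1 + R ^ 2) := fun x => by
    rw [abs_of_nonneg (hW1 x)]
    refine Finset.prod_le_prod (fun _ _ => by positivity) fun k _ => ?_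
    have := sq_le_sq' (abs_le.1 (hzR k x)).1 (abs_le.1 (hzR k x)).2
    linarith
  have hTB : ∀ k x, |T k x| ≤ √(∏ k : Fin (m + 1), (1 + R ^ 2)) := fun k x => by
    refine abs_le_sqrt ?_
    have h2 : T k x ^ 2 ≤ ∑ k, T k x ^ 2 :=
      Finset.single_le_sum (f := fun k => T k x ^ 2) (fun _ _ => sq_nonneg _) (Finset.mem_univ k)
    linarith [hTW x, le_of_abs_le (hWB x)]
  have hTm : ∀ k, Measurable (T k) := fun k => (hzm k).mul (hsm k)
  set DT : Fin (m + 1) → (Fin (m + 1) → ℝ) → ℝ :=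
    fun k x => I k * (1 + z k x ^ 2) ^ (β k) * d k x * s k x with hDT
  have hDTm : ∀ k, Measurable (DT k) := fun k =>
    ((((((hzm k).pow_const 2).const_add 1).pow_const _).const_mul _).mul (hdm k)).mul (hsm k)
  have hDT0 : ∀ k x, 0 ≤ DT k x := fun k x =>
    mul_nonneg (mul_nonneg (mul_nonneg (hI0 k) (by positivity)) (hd0 k x)) (hs0 k x)
  have hTd : ∀ k x, HasDerivAt (fun t => T k (Function.update x k t)) (DT k x) (x k) := by
    intro k x
    have h2 : HasDerivAt (h k) (I k * (1 + h k (c k x) ^ 2) ^ (β k))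
        (c k (Function.update x k (x k))) := by
      rw [Function.update_eq_self]
      exact (hh k _ (hc01 k x)).2
    have h3 := (h2.comp (x k) (hcd k x)).mul_const (s k x)
    simp only [T, hsu]
    exact h3
  have hDTc : ∀ k x, Continuous fun t => DT k (Function.update x k t) := by
    intro k x
    have hcc : Continuous fun t => c k (Function.update x k t) :=
      continuous_iff_continuousAt.2 fun t => by
        have := hcd k (Function.update x k t)
        simp only [Function.update_idem, Function.update_self] at this
        exact this.continuousAt
    simp only [DT, hsu, z]
    refine ((continuous_const.mul (Continuous.rpow_const ?_ ?_)).mul (hdc k x)).mul continuous_const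
    · exact continuous_const.add (((hhc k).comp hcc).pow 2)
    · exact fun t => Or.inl (by positivity)
  set G : (Fin (m + 1) → ℝ) → ℝ := fun x => |u x| ^ q with hG
  have hGC : ContDiff ℝ 1 G := hu.norm_rpow hq
  have hGs : HasCompactSupport G :=
    hc.comp_left (g := fun t => |t| ^ q) (by simp [(by linarith : q ≠ 0)])
  have hG0 : ∀ x, 0 ≤ G x := fun x => rpow_nonneg (abs_nonneg _) _
  have hGd : ∀ (k : Fin (m + 1)) x, HasDerivAt (fun t => G (Function.update x k t))
      (fderiv ℝ G x (Pi.single k 1)) (x k) := by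
    intro k x
    have h2 : HasFDerivAt G (fderiv ℝ G x) (Function.update x k (x k)) := by
      rw [Function.update_eq_self]
      exact (hGC.differentiable one_ne_zero x).hasFDerivAt
    exact h2.comp_hasDerivAt (x k) (hasDerivAt_update x k (x k))
  have hDGc : ∀ k : Fin (m + 1), Continuous fun x => fderiv ℝ G x (Pi.single k 1) := fun k =>
    (hGC.continuous_fderiv one_ne_zero).clm_apply continuous_const
  have hDGs : ∀ k : Fin (m + 1), HasCompactSupport fun x => fderiv ℝ G x (Pi.single k 1) :=
    fun k => hGs.fderiv_apply ℝ _
  have hparts := fun k => integral_mul_partial_eq_neg k hGC.continuous hGs hG0 (hDGc k) (hDGs k)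
    (hGd k) (hTm k) (hTB k) (hDTm k) (hDT0 k) (hTd k) (hDTc k)
  have hFW : Integrable fun x => F x * W x :=
    hFi.mul_bdd hWm.aestronglyMeasurable (.of_forall hWB)
  have hFWF : Integrable fun x => F x * W x - F x := hFW.sub hFi
  have hE : ∫ x, F x * W x = ∏ k, ∫ t in (0 : ℝ)..1, (1 + h k t ^ 2) := by
    rw [← hH (fun k t => 1 + h k t ^ 2) fun k => continuous_const.add ((hhc k).pow 2)]
    congr 1
    ext x
    simp only [W, z]
    ring
  set E := ∏ k, ∫ t in (0 : ℝ)..1, (1 + h k t ^ 2) with hEdef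
  -- pointwise arithmetic-geometric mean inequality
  have hAG : ∀ x, ((m : ℝ) + 1) * (∏ k, I k) ^ (1 / ((m : ℝ) + 1)) * (F x * W x)
      ≤ ∑ k, G x * DT k x := by
    intro x
    have h2 := Real.geom_mean_le_arith_mean_weighted Finset.univ
      (fun _ : Fin (m + 1) => 1 / ((m : ℝ) + 1)) (fun k => DT k x) (fun _ _ => by positivity)
      (by simp; field_simp) (fun k _ => hDT0 k x)
    rw [Real.finsetProd_rpow _ _ fun k _ => hDT0 k x, ← Finset.mul_sum] at h2
    have h3 : ∏ k, DT k x = (∏ k, I k) * F x * W x ^ (m + 1) := by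
      have h4 := prod_rpow_mul_prod_sqrt (fun k => 1 + z k x ^ 2) fun k => by positivity
      rw [← hdF x]
      simp only [W]
      rw [← h4, ← Finset.prod_mul_distrib, ← Finset.prod_mul_distrib]
      refine Finset.prod_congr rfl fun k _ => ?_
      simp only [DT, s, β]
      ring
    have hIp : 0 ≤ ∏ k, I k := Finset.prod_nonneg fun k _ => hI0 k
    rw [h3, mul_rpow (mul_nonneg hIp (hF0 x)) (pow_nonneg (hW1 x) _), mul_rpow hIp (hF0 x),
      ← rpow_natCast, ← rpow_mul (hW1 x)] at h2
    have h5 : ((m + 1 : ℕ) : ℝ) * (1 / ((m : ℝ) + 1)) = 1 := by push_cast; field_simp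
    rw [h5, rpow_one] at h2
    have h6 : G x * F x ^ (1 / ((m : ℝ) + 1)) = F x := by
      simp only [G, F]
      rw [← rpow_mul (abs_nonneg _)]
      rcases eq_or_ne (u x) 0 with h0 | h0
      · simp [h0, zero_rpow hp.ne', zero_rpow (by linarith : q ≠ 0)]
      · rw [← rpow_add (abs_pos.2 h0), ← hpn]
        congr 1
        ring
    have h7 := mul_le_mul_of_nonneg_left h2 (mul_nonneg hm.le (hG0 x))
    calc _ = ((m : ℝ) + 1) * (∏ k, I k) ^ (1 / ((m : ℝ) + 1)) *
          ((G x * F x ^ (1 / ((m : ℝ) + 1))) * W x) := by rw [h6]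
      _ = ((m : ℝ) + 1) * G x * ((∏ k, I k) ^ (1 / ((m : ℝ) + 1)) *
          F x ^ (1 / ((m : ℝ) + 1)) * W x) := by ring
      _ ≤ _ := h7
      _ = _ := by rw [← Finset.mul_sum]; field_simp
  -- pointwise Cauchy-Schwarz inequality
  have hCS : ∀ x, ∑ k, -(fderiv ℝ G x (Pi.single k 1) * T k x)
      ≤ q / 2 * (l * (∑ k, (fderiv ℝ u x (Pi.single k 1)) ^ 2) + l⁻¹ * (F x * W x - F x)) := by
    intro x
    have h2 : F x * W x - F x = ∑ k, F x * T k x ^ 2 := by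
      rw [← Finset.mul_sum, hTW]; ring
    rw [h2, Finset.mul_sum, Finset.mul_sum, ← Finset.sum_add_distrib, Finset.mul_sum]
    refine Finset.sum_le_sum fun k _ => ?_
    refine (neg_le_abs _).trans ?_
    rw [abs_mul, fderiv_abs_rpow_apply (hu.differentiable one_ne_zero x) hq]
    have h3 : F x = (|u x| ^ (q - 1)) ^ 2 := by
      simp only [F]
      rw [← rpow_natCast, ← rpow_mul (abs_nonneg _), hpq]
      congr 1; push_cast; ring
    rw [h3, ← sq_abs (fderiv ℝ u x _), ← sq_abs (T k x)]
    set A := |u x| ^ (q - 1)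
    set P := |fderiv ℝ u x (Pi.single k 1)|
    set Q := |T k x|
    have h4 : 0 ≤ q / 2 * (l⁻¹ * (l * P - A * Q) ^ 2) := by positivity
    have h5 : q / 2 * (l⁻¹ * (l * P - A * Q) ^ 2)
        = q / 2 * (l * P ^ 2 + l⁻¹ * (A ^ 2 * Q ^ 2)) - q * A * P * Q := by
      field_simp; ring
    linarith
  have hDu : Integrable fun x => ∑ k, (fderiv ℝ u x (Pi.single k 1)) ^ 2 := by
    refine integrable_finsetSum _ fun k _ => ?_
    refine Continuous.integrable_of_hasCompactSupport ?_ ?_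
    · exact ((hu.continuous_fderiv one_ne_zero).clm_apply continuous_const).pow 2
    · exact (hc.fderiv_apply ℝ (Pi.single k 1)).comp_left (g := fun t : ℝ => t ^ 2) (by simp)
  calc ((m : ℝ) + 1) * (∏ k, I k) ^ (1 / ((m : ℝ) + 1)) * E
      = ∫ x, ((m : ℝ) + 1) * (∏ k, I k) ^ (1 / ((m : ℝ) + 1)) * (F x * W x) := by
        rw [integral_const_mul, hE]
    _ ≤ ∫ x, ∑ k, G x * DT k x :=
        integral_mono (hFW.const_mul _) (integrable_finsetSum _ fun k _ => (hparts k).1) hAG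
    _ = ∑ k, - ∫ x, fderiv ℝ G x (Pi.single k 1) * T k x := by
        rw [integral_finsetSum _ fun k _ => (hparts k).1]
        exact Finset.sum_congr rfl fun k _ => (hparts k).2
    _ = ∫ x, ∑ k, -(fderiv ℝ G x (Pi.single k 1) * T k x) := by
        rw [integral_finsetSum]
        · simp only [integral_neg]
        · exact fun k _ => (((hDGc k).integrable_of_hasCompactSupport (hDGs k)).mul_bdd
            (hTm k).aestronglyMeasurable (.of_forall (hTB k))).neg
    _ ≤ ∫ x, q / 2 * (l * (∑ k, (fderiv ℝ u x (Pi.single k 1)) ^ 2) +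
          l⁻¹ * (F x * W x - F x)) := by
        refine integral_mono (integrable_finsetSum _ fun k _ => ?_) ?_ hCS
        · exact (((hDGc k).integrable_of_hasCompactSupport (hDGs k)).mul_bdd
            (hTm k).aestronglyMeasurable (.of_forall (hTB k))).neg
        · exact ((hDu.const_mul _).add (hFWF.const_mul _)).const_mul _
    _ = _ := by
        rw [integral_const_mul, integral_add (hDu.const_mul _) (hFWF.const_mul _),
          integral_const_mul, integral_const_mul, integral_sub hFW hFi, hE]
        rw [show (∫ x, F x) = 1 from h1]

lemma prod_div_succ {g : ℕ → ℝ} (hg : ∀ k, g k ≠ 0) (c : ℝ) (j : ℕ) :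
    ∏ k ∈ Finset.range j, (c * g k / g (k + 1)) = c ^ j * g 0 / g j := by
  induction j with
  | zero => simp [hg 0]
  | succ j ih =>
    rw [Finset.prod_range_succ, ih]
    have := hg j
    have := hg (j + 1)
    field_simp
    ring

lemma tendsto_lineIntegral {β : ℝ} (hβ : 1 / 2 < β) :
    Tendsto (fun R : ℝ => ∫ z in (-R)..R, (1 + z ^ 2) ^ (-β)) atTop (𝓝 (lineIntegral β)) :=
  intervalIntegral_tendsto_integral (integrable_one_add_sq hβ) tendsto_neg_atTop_atBot tendsto_id

lemma prod_lineIntegral (m : ℕ) :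
    ∏ k : Fin (m + 1), lineIntegral ((((m + 1 : ℕ) : ℝ) + k + 1) / 2)
      = √π ^ (m + 1) * (Gamma (((m + 1 : ℕ) : ℝ) / 2) / Gamma ((m + 1 : ℕ) : ℝ)) := by
  have hg : ∀ k : ℕ, Gamma (((m + k : ℕ) + 1 : ℝ) / 2) ≠ 0 := fun k =>
    (Gamma_pos_of_pos (by positivity)).ne'
  have h := prod_div_succ hg (√π) (m + 1)
  rw [← Fin.prod_univ_eq_prod_range
    (fun k => √π * Gamma (((m + k : ℕ) + 1 : ℝ) / 2) / Gamma (((m + (k + 1) : ℕ) + 1 : ℝ) / 2))]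
      at h
  convert h using 1
  · refine Finset.prod_congr rfl fun k _ => ?_
    have := lineIntegral_eq_Gamma (m + k)
    convert this using 2 <;> push_cast <;> ring_nf
  · rw [mul_div_assoc]
    congr 3 <;> push_cast <;> ring_nf

lemma prod_lineIntegral_div {m : ℕ} (hm : 2 ≤ m) :
    ∏ k : Fin (m + 1), (lineIntegral ((((m + 1 : ℕ) : ℝ) + k + 1) / 2 - 1) /
      lineIntegral ((((m + 1 : ℕ) : ℝ) + k + 1) / 2)) = 2 * m / ((m : ℝ) - 1) := by
  have hm' : (2 : ℝ) ≤ m := by exact_mod_cast hm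
  have hg : ∀ k : ℕ, ((m : ℝ) + k - 1)⁻¹ ≠ 0 := fun k => by
    have : (0 : ℝ) ≤ k := by positivity
    exact inv_ne_zero (by linarith)
  have h := prod_div_succ hg 1 (m + 1)
  rw [← Fin.prod_univ_eq_prod_range
    (fun k => 1 * ((m : ℝ) + k - 1)⁻¹ / ((m : ℝ) + (k + 1 : ℕ) - 1)⁻¹)] at h
  convert h using 1
  · refine Finset.prod_congr rfl fun k _ => ?_
    have hk : (0 : ℝ) ≤ (k : ℕ) := by positivity
    have h2 := lineIntegral_succ (β := ((m : ℝ) + k) / 2) (by linarith)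
    have h3 := lineIntegral_pos (β := ((m : ℝ) + k) / 2 + 1) (by linarith)
    have e1 : (((m + 1 : ℕ) : ℝ) + k + 1) / 2 = ((m : ℝ) + k) / 2 + 1 := by push_cast; ring
    rw [e1, add_sub_cancel_right]
    have h4 : (m : ℝ) + k - 1 ≠ 0 := by linarith
    have h5 : (m : ℝ) + k ≠ 0 := by linarith
    push_cast
    rw [div_inv_eq_mul, div_eq_iff h3.ne', one_mul]
    have h6 : ((m : ℝ) + k - 1) * lineIntegral ((m + k) / 2) =
        (m + k) * lineIntegral ((m + k) / 2 + 1) := by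
      rw [show (m : ℝ) + k - 1 = 2 * ((m + k) / 2) - 1 by ring, ← h2]; ring
    rw [show (m : ℝ) + (k + 1) - 1 = m + k by ring, inv_mul_eq_div, div_mul_eq_mul_div, ← h6,
      mul_div_cancel_left₀ _ h4]
  · push_cast
    rw [div_inv_eq_mul, add_zero, one_pow, one_mul, show (m : ℝ) + (m + 1) - 1 = 2 * m by ring,
      inv_mul_eq_div]

/-- The Sobolev inequality with sharp constant for functions normalized in the critical norm. -/
lemma sobolev_of_integral_eq_one {m : ℕ} (hm : 2 ≤ m) {u : (Fin (m + 1) → ℝ) → ℝ}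
    (hu : ContDiff ℝ 1 u) (hc : HasCompactSupport u)
    (h1 : ∫ x, |u x| ^ (2 * ((m : ℝ) + 1) / ((m : ℝ) - 1)) = 1) :
    sobolevConst (m + 1) ≤ ∫ x, ∑ k, (fderiv ℝ u x (Pi.single k 1)) ^ 2 := by
  have hm' : (2 : ℝ) ≤ m := by exact_mod_cast hm
  have hm1 : (m : ℝ) - 1 ≠ 0 := by linarith
  have hm2 : 0 < (m : ℝ) - 1 := by linarith
  set q : ℝ := 2 * m / ((m : ℝ) - 1) with hq
  set P : ℝ := √π ^ (m + 1) * (Gamma (((m + 1 : ℕ) : ℝ) / 2) / Gamma ((m + 1 : ℕ) : ℝ)) with hP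
  have hG : 0 < Gamma (((m + 1 : ℕ) : ℝ) / 2) / Gamma ((m + 1 : ℕ) : ℝ) :=
    div_pos (Gamma_pos_of_pos (by positivity)) (Gamma_pos_of_pos (by positivity))
  have hP0 : 0 < P := mul_pos (pow_pos (sqrt_pos.2 pi_pos) _) hG
  set D := ∫ x, ∑ k, (fderiv ℝ u x (Pi.single k 1)) ^ 2
  have hq1 : q - 1 = ((m : ℝ) + 1) / (m - 1) := by rw [hq]; field_simp; ring
  have hq1' : 0 < q - 1 := by rw [hq1]; positivity
  have key : ∀ l : ℝ, 0 < l → ((m : ℝ) + 1) * P ^ (1 / ((m : ℝ) + 1)) * q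
      ≤ q / 2 * (l * D + l⁻¹ * (q - 1)) := by
    intro l hl
    have hI : Tendsto (fun R : ℝ => ∏ k : Fin (m + 1), ∫ z in (-R)..R,
        (1 + z ^ 2) ^ (-((((m + 1 : ℕ) : ℝ) + k + 1) / 2))) atTop (𝓝 P) := by
      rw [hP, ← prod_lineIntegral]
      refine tendsto_finsetProd _ fun k _ => tendsto_lineIntegral ?_
      have hk : (0 : ℝ) ≤ (k : ℕ) := by positivity
      push_cast
      linarith
    have hE : Tendsto (fun R : ℝ => ∏ k : Fin (m + 1),
        ((∫ z in (-R)..R, (1 + z ^ 2) ^ (1 - (((m + 1 : ℕ) : ℝ) + k + 1) / 2)) /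
        ∫ z in (-R)..R, (1 + z ^ 2) ^ (-((((m + 1 : ℕ) : ℝ) + k + 1) / 2)))) atTop (𝓝 q) := by
      rw [hq, ← prod_lineIntegral_div hm]
      refine tendsto_finsetProd _ fun k _ => ?_
      have hk : (0 : ℝ) ≤ (k : ℕ) := by positivity
      have hb : 1 < (((m + 1 : ℕ) : ℝ) + k + 1) / 2 - 1 / 2 := by push_cast; linarith
      refine Tendsto.div ?_ (tendsto_lineIntegral (by linarith))
        (lineIntegral_pos (by linarith)).ne'
      have := tendsto_lineIntegral (β := (((m + 1 : ℕ) : ℝ) + k + 1) / 2 - 1) (by linarith)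
      simpa only [neg_sub] using this
    refine le_of_tendsto_of_tendsto ?_ ?_ (eventually_atTop.2 ⟨1, fun R hR =>
      truncated_sobolev (p := 2 * ((m : ℝ) + 1) / ((m : ℝ) - 1)) (q := q)
        (by linarith) ?_ ?_ hu hc h1
        (zero_lt_one.trans_le hR) hl⟩)
    · exact ((hI.rpow_const (Or.inl hP0.ne')).const_mul _).mul hE
    · exact (((hE.sub_const 1).const_mul _).const_add _).const_mul _
    · rw [hq1]; ring
    · rw [hq]; field_simp; ring
  set M := ((m : ℝ) + 1) * P ^ (1 / ((m : ℝ) + 1)) with hM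
  have hM0 : 0 < M := by positivity
  have h2 := key ((q - 1) / M) (by positivity)
  have h3 : ((q - 1) / M)⁻¹ * (q - 1) = M := by field_simp
  rw [h3] at h2
  have hq0 : 0 < q := by linarith
  have h4 : M * M ≤ (q - 1) * D := by
    have : M ≤ (q - 1) / M * D := by
      have : q * M ≤ q * ((q - 1) / M * D) := by linarith
      exact le_of_mul_le_mul_left this hq0
    calc M * M ≤ ((q - 1) / M * D) * M := by gcongr
      _ = _ := by field_simp
  have h5 : sobolevConst (m + 1) = M * M / (q - 1) := by
    rw [hq1, hM, hP, sobolevConst, mul_rpow (by positivity) hG.le, ← rpow_natCast,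
      ← rpow_mul (sqrt_nonneg _)]
    have e1 : ((m + 1 : ℕ) : ℝ) * (1 / ((m : ℝ) + 1)) = 1 := by push_cast; field_simp
    have e2 : (2 / ((m + 1 : ℕ) : ℝ)) = 1 / ((m : ℝ) + 1) + 1 / ((m : ℝ) + 1) := by
      push_cast; ring
    rw [e1, rpow_one, e2, rpow_add hG]
    set Z := (Gamma (((m + 1 : ℕ) : ℝ) / 2) / Gamma ((m + 1 : ℕ) : ℝ)) ^ (1 / ((m : ℝ) + 1))
    have e3 := Real.mul_self_sqrt pi_pos.le
    push_cast
    calc _ = (√π * √π) * (m + 1) * (m + 1 - 2) * (Z * Z) := by rw [e3]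
      _ = _ := by field_simp; ring
  rw [h5, div_le_iff₀ hq1']
  linarith

lemma norm_gradient_sq {n : ℕ} (u : EuclideanSpace ℝ (Fin n) → ℝ) (x : EuclideanSpace ℝ (Fin n)) :
    ‖gradient u x‖ ^ 2 = ∑ k, (fderiv ℝ u x (EuclideanSpace.single k 1)) ^ 2 := by
  rw [EuclideanSpace.norm_sq_eq]
  refine Finset.sum_congr rfl fun k _ => ?_
  have h : inner ℝ (gradient u x) (EuclideanSpace.single k (1 : ℝ))
      = fderiv ℝ u x (EuclideanSpace.single k 1) := by
    rw [gradient, InnerProductSpace.toDual_symm_apply]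
  rw [← h, EuclideanSpace.inner_single_right]
  simp

/-- The Sobolev inequality with sharp constant for compactly supported `C¹` functions. -/
theorem sobolev_inequality {n : ℕ} (hn : 3 ≤ n) {u : EuclideanSpace ℝ (Fin n) → ℝ}
    (hu : ContDiff ℝ 1 u) (hc : HasCompactSupport u) :
    sobolevConst n * (∫ x, |u x| ^ (2 * (n : ℝ) / ((n : ℝ) - 2))) ^ (((n : ℝ) - 2) / n)
      ≤ ∫ x, ‖gradient u x‖ ^ 2 := by
  obtain ⟨m, rfl⟩ : ∃ m, n = m + 1 := ⟨n - 1, by omega⟩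
  have hm : 2 ≤ m := by omega
  have hm' : (2 : ℝ) ≤ m := by exact_mod_cast hm
  set p : ℝ := 2 * ((m + 1 : ℕ) : ℝ) / (((m + 1 : ℕ) : ℝ) - 2) with hp
  have hp' : p = 2 * ((m : ℝ) + 1) / ((m : ℝ) - 1) := by
    rw [hp]; push_cast; congr 1; ring
  have hp0 : 0 < p := by rw [hp']; exact div_pos (by positivity) (by linarith)
  have h2p : (((m + 1 : ℕ) : ℝ) - 2) / ((m + 1 : ℕ) : ℝ) = 2 / p := by
    have : (m : ℝ) - 1 ≠ 0 := by linarith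
    rw [hp']; push_cast; field_simp; ring
  rw [h2p]
  have hmp := EuclideanSpace.volume_preserving_symm_measurableEquiv_toLp (Fin (m + 1))
  have hemb := (MeasurableEquiv.toLp 2 (Fin (m + 1) → ℝ)).symm.measurableEmbedding
  set L := (EuclideanSpace.equiv (Fin (m + 1)) ℝ).symm with hL
  set v : (Fin (m + 1) → ℝ) → ℝ := fun y => u (L y) with hv
  have hvC : ContDiff ℝ 1 v := hu.comp L.contDiff
  have hvc : HasCompactSupport v := hc.comp_homeomorph L.toHomeomorph
  have hN : ∫ x, |u x| ^ p = ∫ y, |v y| ^ p := by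
    rw [← hmp.integral_comp hemb]
    rfl
  have hder : ∀ y k, fderiv ℝ v y (Pi.single k 1)
      = fderiv ℝ u (L y) (EuclideanSpace.single k 1) := by
    intro y k
    have h := ((hu.differentiable one_ne_zero (L y)).hasFDerivAt.comp y L.hasFDerivAt).fderiv
    have h' : fderiv ℝ v y = (fderiv ℝ u (L y)).comp (L : (Fin (m + 1) → ℝ) →L[ℝ] _) := h
    rw [h']
    rfl
  have hD : ∫ x, ‖gradient u x‖ ^ 2 = ∫ y, ∑ k, (fderiv ℝ v y (Pi.single k 1)) ^ 2 := by
    rw [← hmp.integral_comp hemb]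
    refine integral_congr_ae (.of_forall fun y => ?_)
    simp only [hder, norm_gradient_sq]
    rfl
  rw [hN, hD]
  set N := ∫ y, |v y| ^ p
  have hN0 : 0 ≤ N := integral_nonneg fun _ => rpow_nonneg (abs_nonneg _) _
  rcases hN0.eq_or_lt with h0 | h0
  · rw [← h0, zero_rpow (by positivity), mul_zero]
    exact integral_nonneg fun _ => Finset.sum_nonneg fun _ _ => sq_nonneg _
  · have hw := sobolev_of_integral_eq_one hm (u := fun y => N ^ (-(1 / p)) * v y)
      (contDiff_const.mul hvC) hvc.mul_left ?_
    · have hd : ∀ y k, fderiv ℝ (fun y => N ^ (-(1 / p)) * v y) y (Pi.single k 1)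
          = N ^ (-(1 / p)) * fderiv ℝ v y (Pi.single k 1) := fun y k => by
        rw [fderiv_const_mul (hvC.differentiable one_ne_zero y)]
        rfl
      simp only [hd, mul_pow, ← Finset.mul_sum] at hw
      rw [integral_const_mul, ← rpow_natCast, ← rpow_mul hN0,
        show -(1 / p) * ((2 : ℕ) : ℝ) = -(2 / p) by push_cast; ring, rpow_neg hN0] at hw
      have h3 : 0 < N ^ (2 / p) := rpow_pos_of_pos h0 _
      rw [← div_eq_inv_mul, le_div_iff₀ h3] at hw
      exact hw
    · rw [← hp']
      simp only [abs_mul, mul_rpow (abs_nonneg _) (abs_nonneg _)]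
      rw [integral_const_mul, abs_of_pos (rpow_pos_of_pos h0 _), ← rpow_mul hN0,
        show -(1 / p) * p = -1 by field_simp, rpow_neg_one]
      exact inv_mul_cancel₀ h0.ne'

/-- The function `t ^ γ * exp (-c t ^ (-b))` on the positive half-line, extended by zero. -/
noncomputable def flat (γ c b t : ℝ) : ℝ := if t ≤ 0 then 0 else t ^ γ * exp (-c * t ^ (-b))

lemma flat_of_pos {γ c b t : ℝ} (ht : 0 < t) : flat γ c b t = t ^ γ * exp (-c * t ^ (-b)) :=
  if_neg ht.not_ge

lemma flat_of_nonpos {γ c b t : ℝ} (ht : t ≤ 0) : flat γ c b t = 0 := if_pos ht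

lemma tendsto_flat_zero (γ : ℝ) {c b : ℝ} (hc : 0 < c) (hb : 0 < b) :
    Tendsto (flat γ c b) (𝓝 0) (𝓝 0) := by
  have hsup : 𝓝 (0 : ℝ) = 𝓝[≤] 0 ⊔ 𝓝[>] 0 := (nhdsLE_sup_nhdsGT 0).symm
  refine Tendsto.mono_left (tendsto_sup.2 ?_) hsup.le
  constructor
  · refine tendsto_const_nhds.congr' ?_
    filter_upwards [self_mem_nhdsWithin] with t ht using (flat_of_nonpos ht).symm
  · have h := (tendsto_rpow_mul_exp_neg_mul_atTop_nhds_zero (-(γ / b)) c hc).comp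
      (tendsto_rpow_neg_nhdsGT_zero (neg_lt_zero.2 hb))
    refine h.congr' ?_
    filter_upwards [self_mem_nhdsWithin] with t ht
    have ht : 0 < t := ht
    rw [flat_of_pos ht, Function.comp_apply, ← rpow_mul ht.le]
    congr 2
    field_simp

lemma hasDerivAt_flat (γ : ℝ) {c b : ℝ} (hc : 0 < c) (hb : 0 < b) (t : ℝ) :
    HasDerivAt (flat γ c b) (γ * flat (γ - 1) c b t + c * b * flat (γ - 1 - b) c b t) t := by
  rcases lt_trichotomy t 0 with ht | rfl | ht
  · rw [flat_of_nonpos ht.le, flat_of_nonpos ht.le, mul_zero, mul_zero, add_zero]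
    refine (hasDerivAt_const t (0 : ℝ)).congr_of_eventuallyEq ?_
    filter_upwards [gt_mem_nhds ht] with s hs using flat_of_nonpos hs.le
  · rw [flat_of_nonpos le_rfl, flat_of_nonpos le_rfl, mul_zero, mul_zero, add_zero,
      hasDerivAt_iff_tendsto_slope]
    refine ((tendsto_flat_zero (γ - 1) hc hb).mono_left nhdsWithin_le_nhds).congr fun t => ?_
    rw [slope_def_field, flat_of_nonpos le_rfl, sub_zero, sub_zero]
    rcases le_or_gt t 0 with ht | ht
    · simp [flat_of_nonpos ht]
    · rw [flat_of_pos ht, flat_of_pos ht, rpow_sub_one ht.ne']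
      ring
  · have h1 := (hasDerivAt_rpow_const (p := γ) (Or.inl ht.ne')).mul
      ((hasDerivAt_rpow_const (x := t) (p := -b) (Or.inl ht.ne')).const_mul (-c)).exp
    refine (h1.congr_of_eventuallyEq ?_).congr_deriv ?_
    · filter_upwards [lt_mem_nhds ht] with s hs using flat_of_pos hs
    · rw [flat_of_pos ht, flat_of_pos ht, show γ - 1 - b = γ + (-b - 1) by ring, rpow_add ht γ]
      ring

lemma contDiff_flat (γ : ℝ) {c b : ℝ} (hc : 0 < c) (hb : 0 < b) : ContDiff ℝ 1 (flat γ c b) := by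
  have hcont : ∀ γ, Continuous (flat γ c b) := fun γ =>
    continuous_iff_continuousAt.2 fun t => (hasDerivAt_flat γ hc hb t).continuousAt
  rw [contDiff_one_iff_deriv]
  refine ⟨fun t => (hasDerivAt_flat γ hc hb t).differentiableAt, ?_⟩
  rw [show deriv (flat γ c b) = _ from funext fun t => (hasDerivAt_flat γ hc hb t).deriv]
  exact ((hcont _).const_mul _).add ((hcont _).const_mul _)

/-- Gradient of a weighted radial rescaling of a function. -/
lemma hasGradientAt_radial {E : Type*} [NormedAddCommGroup E] [InnerProductSpace ℝ E]
    [CompleteSpace E] {u : E → ℝ} (hu : Differentiable ℝ u) {ψ η : ℝ → ℝ} {ψ' η' : ℝ} (x : E)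
    (hψ : HasDerivAt ψ ψ' (‖x‖ ^ 2)) (hη : HasDerivAt η η' (‖x‖ ^ 2)) :
    HasGradientAt (fun y => ψ (‖y‖ ^ 2) * u (η (‖y‖ ^ 2) • y))
      ((2 * ψ' * u (η (‖x‖ ^ 2) • x) +
        2 * ψ (‖x‖ ^ 2) * η' * inner ℝ (gradient u (η (‖x‖ ^ 2) • x)) x) • x +
        (ψ (‖x‖ ^ 2) * η (‖x‖ ^ 2)) • gradient u (η (‖x‖ ^ 2) • x)) x := by
  have hn := (hasStrictFDerivAt_norm_sq x).hasFDerivAt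
  have h1 := hψ.comp_hasFDerivAt x hn
  have h2 : HasFDerivAt (fun y => η (‖y‖ ^ 2) • y) _ x :=
    (hη.comp_hasFDerivAt x hn).smul (hasFDerivAt_id x)
  have h3 := HasFDerivAt.comp (f := fun y => η (‖y‖ ^ 2) • y) x
    (hu (η (‖x‖ ^ 2) • x)).hasFDerivAt h2
  have h4 := h1.mul h3
  rw [hasGradientAt_iff_hasFDerivAt]
  refine h4.congr_fderiv ?_
  ext v
  simp
  ring

lemma lintegral_ball_eq_polar {E : Type*} [NormedAddCommGroup E] [NormedSpace ℝ E]
    [FiniteDimensional ℝ E] [MeasurableSpace E] [BorelSpace E] [Nontrivial E] (μ : Measure E)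
    [μ.IsAddHaarMeasure] {f : E → ENNReal} (hf : Measurable f) :
    ∫⁻ x in Metric.ball 0 1, f x ∂μ
      = ∫⁻ θ : Metric.sphere (0 : E) 1, (∫⁻ ρ in Ioo (0 : ℝ) 1,
          ENNReal.ofReal (ρ ^ (Module.finrank ℝ E - 1)) * f (ρ • (θ : E))) ∂μ.toSphere := by
  set g : E → ENNReal := (Metric.ball 0 1).indicator f with hg
  have hgm : Measurable g := hf.indicator measurableSet_ball
  have hsm : MeasurableSet ({0}ᶜ : Set E) := (measurableSet_singleton _).compl
  have hcoe : Continuous fun z : Metric.sphere (0 : E) 1 × Ioi (0 : ℝ) => z.2.1 • (z.1 : E) := by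
    fun_prop
  have h1 : ∫⁻ x, g x ∂μ = ∫⁻ x : ({0}ᶜ : Set E), g x ∂(μ.comap (↑)) := by
    rw [lintegral_subtype_comap hsm]
    exact (setLIntegral_univ g).symm.trans (setLIntegral_congr (by
      rw [ae_eq_univ, compl_compl]; exact measure_singleton 0)).symm
  have h2 : ∫⁻ x : ({0}ᶜ : Set E), g x ∂(μ.comap (↑))
      = ∫⁻ z, g (z.2.1 • (z.1 : E))
        ∂(μ.toSphere.prod (Measure.volumeIoiPow (Module.finrank ℝ E - 1))) := by
    refine Eq.trans ?_ ((μ.measurePreserving_homeomorphUnitSphereProd).lintegral_comp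
      (hgm.comp hcoe.measurable))
    refine lintegral_congr fun x => ?_
    have hx : ‖(x : E)‖ ≠ 0 := norm_ne_zero_iff.2 x.2
    simp [smul_smul, mul_inv_cancel₀ hx]
  rw [← lintegral_indicator measurableSet_ball, h1, h2]
  refine (lintegral_prod _ (hgm.comp hcoe.measurable).aemeasurable).trans ?_
  refine lintegral_congr fun θ => ?_
  have hθ : ‖(θ : E)‖ = 1 := by simp
  have hray : Measurable fun ρ : ℝ => g (ρ • (θ : E)) :=
    hgm.comp (measurable_id.smul_const _)
  have hpow : Measurable fun ρ : ℝ => ENNReal.ofReal (ρ ^ (Module.finrank ℝ E - 1)) :=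
    (measurable_id.pow_const _).ennreal_ofReal
  refine (lintegral_withDensity_eq_lintegral_mul _ (hpow.comp measurable_subtype_coe)
    (hray.comp measurable_subtype_coe)).trans ?_
  have h3 := lintegral_subtype_comap (μ := (volume : Measure ℝ)) (measurableSet_Ioi (a := (0 : ℝ)))
    fun ρ => ENNReal.ofReal (ρ ^ (Module.finrank ℝ E - 1)) * g (ρ • (θ : E))
  refine h3.trans ?_
  rw [← lintegral_indicator measurableSet_Ioi, ← lintegral_indicator measurableSet_Ioo]
  refine lintegral_congr fun ρ => ?_
  by_cases h0 : 0 < ρ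
  · by_cases h1 : ρ < 1
    · simp [h0, h1, hg, indicator, norm_smul, hθ, abs_of_pos h0]
    · simp [h0, h1, hg, indicator, norm_smul, hθ, abs_of_pos h0]
  · simp [h0]

lemma image_exp_sub_rpow {a b : ℝ} (ha : 0 < a) (hb : 0 < b) :
    (fun ρ : ℝ => exp (a - a * ρ ^ (-b))) '' Ioo 0 1 = Ioo 0 1 := by
  ext r
  constructor
  · rintro ⟨ρ, ⟨h0, h1⟩, rfl⟩
    refine ⟨exp_pos _, exp_lt_one_iff.2 ?_⟩
    have : 1 < ρ ^ (-b) := one_lt_rpow_of_pos_of_lt_one_of_neg h0 h1 (neg_lt_zero.2 hb)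
    nlinarith
  · rintro ⟨h0, h1⟩
    have hl := log_neg h0 h1
    have hx : 1 < (a - log r) / a := by rw [lt_div_iff₀ ha]; linarith
    refine ⟨((a - log r) / a) ^ (-b⁻¹), ⟨by positivity, ?_⟩, ?_⟩
    · exact rpow_lt_one_of_one_lt_of_neg hx (neg_lt_zero.2 (inv_pos.2 hb))
    · simp only
      rw [← rpow_mul (by positivity), show -b⁻¹ * -b = 1 by field_simp, rpow_one]
      rw [show a - a * ((a - log r) / a) = log r by field_simp; ring, exp_log h0]

lemma hasDerivAt_exp_sub_rpow {a b ρ : ℝ} (hab : a * b = 1) (hρ : 0 < ρ) :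
    HasDerivAt (fun ρ : ℝ => exp (a - a * ρ ^ (-b)))
      (exp (a - a * ρ ^ (-b)) * ρ ^ (-1 - b)) ρ := by
  have h := (((hasDerivAt_rpow_const (x := ρ) (p := -b)
    (Or.inl hρ.ne')).const_mul a).const_sub a).exp
  refine h.congr_deriv ?_
  rw [show -1 - b = -b - 1 by ring]
  linear_combination (exp (a - a * ρ ^ (-b)) * ρ ^ (-b - 1)) * hab

lemma lintegral_Ioo_comp_exp_sub_rpow {a b : ℝ} (ha : 0 < a) (hb : 0 < b) (hab : a * b = 1)
    (f : ℝ → ENNReal) :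
    ∫⁻ r in Ioo (0 : ℝ) 1, f r = ∫⁻ ρ in Ioo (0 : ℝ) 1,
      ENNReal.ofReal (exp (a - a * ρ ^ (-b)) * ρ ^ (-1 - b)) * f (exp (a - a * ρ ^ (-b))) := by
  have hinj : InjOn (fun ρ : ℝ => exp (a - a * ρ ^ (-b))) (Ioo 0 1) := by
    intro x hx y hy hxy
    have h1 : x ^ (-b) = y ^ (-b) := by
      have := exp_injective hxy
      exact mul_left_cancel₀ ha.ne' (by linarith)
    exact (rpow_left_inj hx.1.le hy.1.le (neg_ne_zero.2 hb.ne')).1 h1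
  have h := lintegral_image_eq_lintegral_abs_deriv_mul (measurableSet_Ioo (a := (0 : ℝ)) (b := 1))
    (fun ρ hρ => (hasDerivAt_exp_sub_rpow hab hρ.1).hasDerivWithinAt) hinj f
  rw [image_exp_sub_rpow ha hb] at h
  rw [h]
  refine setLIntegral_congr_fun measurableSet_Ioo fun ρ hρ => ?_
  have hρ0 := hρ.1
  rw [abs_of_nonneg (by positivity)]

lemma exp_mul_flat {a b ρ : ℝ} (γ κ : ℝ) (hρ : 0 < ρ) :
    exp (a * κ) * flat γ (a * κ) b ρ = ρ ^ γ * exp (a - a * ρ ^ (-b)) ^ κ := by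
  rw [flat_of_pos hρ, ← exp_mul, mul_left_comm, ← exp_add]
  congr 2
  ring

lemma flat_sq {γ c b ρ : ℝ} (hρ : 0 < ρ) : flat γ c (b / 2) (ρ ^ 2) = flat (2 * γ) c b ρ := by
  rw [flat_of_pos hρ, flat_of_pos (by positivity), ← rpow_natCast, ← rpow_mul hρ.le,
    ← rpow_mul hρ.le]
  congr 4
  push_cast
  ring

/-- The weighted radial rescaling which turns the Hardy–Sobolev quotient on the unit ball into
the Sobolev quotient. In polar coordinates it maps `u` to
`ρ ^ (b / 2 - κ) * r ^ κ * u (r θ)` with `r = exp (a - a * ρ ^ (-b))`. -/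
noncomputable def hardyTransform {E : Type*} [NormedAddCommGroup E] [NormedSpace ℝ E]
    (κ a b : ℝ) (u : E → ℝ) (x : E) : ℝ :=
  exp (a * κ) * flat ((b / 2 - κ) / 2) (a * κ) (b / 2) (‖x‖ ^ 2) *
    u ((exp (a * 1) * flat (-1 / 2) (a * 1) (b / 2) (‖x‖ ^ 2)) • x)

section

variable {E : Type*} [NormedAddCommGroup E] [InnerProductSpace ℝ E] {κ a b : ℝ} {u : E → ℝ}

lemma hardyTransform_smul {ρ : ℝ} (hρ : 0 < ρ) {θ : E} (hθ : ‖θ‖ = 1) :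
    hardyTransform κ a b u (ρ • θ)
      = ρ ^ (b / 2 - κ) * exp (a - a * ρ ^ (-b)) ^ κ * u (exp (a - a * ρ ^ (-b)) • θ) := by
  have hn : ‖ρ • θ‖ = ρ := by rw [norm_smul, hθ, mul_one, norm_of_nonneg hρ.le]
  rw [hardyTransform, hn, flat_sq hρ, flat_sq hρ, exp_mul_flat _ _ hρ, exp_mul_flat _ _ hρ,
    smul_smul, rpow_one, show 2 * (-1 / 2 : ℝ) = -1 by norm_num, rpow_neg_one,
    show 2 * ((b / 2 - κ) / 2) = b / 2 - κ by ring]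
  congr 3
  field_simp

lemma contDiff_hardyTransform (hκ : 0 < κ) (ha : 0 < a) (hb : 0 < b) (hu : ContDiff ℝ 1 u) :
    ContDiff ℝ 1 (hardyTransform κ a b u) := by
  have hn : ContDiff ℝ 1 fun x : E => ‖x‖ ^ 2 := contDiff_norm_sq ℝ
  have h1 := (contDiff_flat ((b / 2 - κ) / 2) (mul_pos ha hκ) (half_pos hb)).comp hn
  have h2 := (contDiff_flat (-1 / 2) (mul_pos ha one_pos) (half_pos hb)).comp hn
  exact (contDiff_const.mul h1).mul (hu.comp ((contDiff_const.mul h2).smul contDiff_id))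

lemma hardyTransform_eq_zero (ha : 0 < a) (hb : 0 < b) (hu : ∀ x, 1 ≤ ‖x‖ → u x = 0) {x : E}
    (hx : 1 ≤ ‖x‖) : hardyTransform κ a b u x = 0 := by
  have h0 : 0 < ‖x‖ := by linarith
  have hx' : x = ‖x‖ • (‖x‖⁻¹ • x) := by rw [smul_smul, mul_inv_cancel₀ h0.ne', one_smul]
  have hθ : ‖‖x‖⁻¹ • x‖ = 1 := by rw [norm_smul, norm_inv, norm_norm, inv_mul_cancel₀ h0.ne']
  rw [hx', hardyTransform_smul h0 hθ, hu, mul_zero]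
  rw [norm_smul, hθ, mul_one, norm_of_nonneg (exp_pos _).le]
  refine one_le_exp ?_
  have : ‖x‖ ^ (-b) ≤ 1 := rpow_le_one_of_one_le_of_nonpos hx (neg_nonpos.2 hb.le)
  nlinarith

lemma norm_gradient_hardyTransform_sq [CompleteSpace E] (hκ : 0 < κ) (ha : 0 < a) (hb : 0 < b)
    (hab : a * b = 1) (hu : Differentiable ℝ u) {ρ : ℝ} (hρ : 0 < ρ) {θ : E} (hθ : ‖θ‖ = 1)
    {r w g : ℝ} (hr : r = exp (a - a * ρ ^ (-b))) (hw : w = ρ ^ (-b))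
    (hg : g = inner ℝ (gradient u (r • θ)) θ) :
    ‖gradient (hardyTransform κ a b u) (ρ • θ)‖ ^ 2
      = (ρ ^ (b / 2 - κ) * r ^ κ / ρ) ^ 2 * (((b / 2 - κ + κ * w) * u (r • θ) + r * w * g) ^ 2
        + r ^ 2 * (‖gradient u (r • θ)‖ ^ 2 - g ^ 2)) := by
  have hn : ‖ρ • θ‖ = ρ := by rw [norm_smul, hθ, mul_one, norm_of_nonneg hρ.le]
  have hψ := (hasDerivAt_flat ((b / 2 - κ) / 2) (mul_pos ha hκ) (half_pos hb)
    (‖ρ • θ‖ ^ 2)).const_mul (exp (a * κ))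
  have hη := (hasDerivAt_flat (-1 / 2) (mul_pos ha one_pos) (half_pos hb)
    (‖ρ • θ‖ ^ 2)).const_mul (exp (a * 1))
  have hG := (hasGradientAt_radial hu (ρ • θ) hψ hη).gradient
  have hG' : gradient (hardyTransform κ a b u) (ρ • θ) = _ := hG
  have e1 : exp (a * κ) * flat ((b / 2 - κ) / 2) (a * κ) (b / 2) (ρ ^ 2)
      = ρ ^ (b / 2 - κ) * r ^ κ := by
    rw [flat_sq hρ, exp_mul_flat _ _ hρ, hr]
    congr 2; ring
  have e2 : exp (a * κ) * flat ((b / 2 - κ) / 2 - 1) (a * κ) (b / 2) (ρ ^ 2)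
      = ρ ^ (b / 2 - κ) * r ^ κ / ρ ^ 2 := by
    rw [flat_sq hρ, exp_mul_flat _ _ hρ, hr,
      show 2 * ((b / 2 - κ) / 2 - 1) = b / 2 - κ - (2 : ℕ) by push_cast; ring,
      rpow_sub_natCast hρ.ne']
    ring
  have e3 : exp (a * κ) * flat ((b / 2 - κ) / 2 - 1 - b / 2) (a * κ) (b / 2) (ρ ^ 2)
      = ρ ^ (b / 2 - κ) * r ^ κ / ρ ^ 2 * w := by
    rw [flat_sq hρ, exp_mul_flat _ _ hρ, hr, hw,
      show 2 * ((b / 2 - κ) / 2 - 1 - b / 2) = b / 2 - κ - (2 : ℕ) + -b by push_cast; ring,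
      rpow_add hρ, rpow_sub_natCast hρ.ne']
    ring
  have e4 : exp (a * 1) * flat (-1 / 2) (a * 1) (b / 2) (ρ ^ 2) = r / ρ := by
    rw [flat_sq hρ, exp_mul_flat _ _ hρ, hr, rpow_one,
      show 2 * (-1 / 2 : ℝ) = -1 by norm_num, rpow_neg_one]
    ring
  have e5 : exp (a * 1) * flat (-1 / 2 - 1) (a * 1) (b / 2) (ρ ^ 2) = r / ρ ^ 3 := by
    rw [flat_sq hρ, exp_mul_flat _ _ hρ, hr, rpow_one,
      show 2 * (-1 / 2 - 1 : ℝ) = -(3 : ℕ) by norm_num, rpow_neg hρ.le, rpow_natCast]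
    ring
  have e6 : exp (a * 1) * flat (-1 / 2 - 1 - b / 2) (a * 1) (b / 2) (ρ ^ 2) = r / ρ ^ 3 * w := by
    rw [flat_sq hρ, exp_mul_flat _ _ hρ, hr, hw, rpow_one,
      show 2 * (-1 / 2 - 1 - b / 2 : ℝ) = -(3 : ℕ) + -b by push_cast; ring, rpow_add hρ,
      rpow_neg hρ.le, rpow_natCast]
    ring
  have hnorm : ∀ (c d : ℝ) (x v : E),
      ‖c • x + d • v‖ ^ 2 = c ^ 2 * ‖x‖ ^ 2 + 2 * c * d * inner ℝ v x + d ^ 2 * ‖v‖ ^ 2 := by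
    intro c d x v
    rw [norm_add_sq_real, norm_smul, norm_smul, mul_pow, mul_pow, norm_eq_abs, norm_eq_abs, sq_abs,
      sq_abs, real_inner_smul_left, real_inner_smul_right, real_inner_comm]
    ring
  have e7 : (r / ρ) • ρ • θ = r • θ := by
    rw [smul_smul]; congr 1; field_simp
  rw [hG', hn, e1, e4, e7, mul_add, mul_add (exp (a * 1)), mul_left_comm _ ((b / 2 - κ) / 2),
    mul_left_comm _ (a * κ * (b / 2)), mul_left_comm _ (-1 / 2 : ℝ),
    mul_left_comm _ (a * 1 * (b / 2)), e2, e3, e5, e6, real_inner_smul_right, ← hg,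
    hnorm, hn, real_inner_smul_right, ← hg,
    show a * κ * (b / 2) = κ / 2 by linear_combination (κ / 2) * hab,
    show a * 1 * (b / 2) = 1 / 2 by linear_combination (1 / 2) * hab]
  field_simp
  ring

end

lemma setLIntegral_Ioo_ofReal {F : ℝ → ℝ} (hF : Continuous F) (h0 : ∀ ρ ∈ Ioo (0 : ℝ) 1, 0 ≤ F ρ) :
    ∫⁻ ρ in Ioo (0 : ℝ) 1, ENNReal.ofReal (F ρ) = ENNReal.ofReal (∫ ρ in (0 : ℝ)..1, F ρ) := by
  rw [intervalIntegral.integral_of_le zero_le_one, integral_Ioc_eq_integral_Ioo,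
    ofReal_integral_eq_lintegral_ofReal]
  · exact (hF.integrableOn_Icc (a := 0) (b := 1)).mono_set Ioo_subset_Icc_self
  · filter_upwards [ae_restrict_mem measurableSet_Ioo] with ρ hρ using h0 ρ hρ

/-- The normalized flat weight `exp (a * κ) * flat γ (a * κ) b`, equal to `ρ ^ γ * r ^ κ` for
`r = exp (a - a * ρ ^ (-b))`. -/
noncomputable def radialWeight (a b κ γ ρ : ℝ) : ℝ := exp (a * κ) * flat γ (a * κ) b ρ

lemma radialWeight_of_pos {a b κ γ ρ : ℝ} (hρ : 0 < ρ) :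
    radialWeight a b κ γ ρ = ρ ^ γ * exp (a - a * ρ ^ (-b)) ^ κ := exp_mul_flat γ κ hρ

lemma hasDerivAt_radialWeight {a b κ : ℝ} (ha : 0 < a) (hb : 0 < b) (hab : a * b = 1) (hκ : 0 < κ)
    (γ ρ : ℝ) : HasDerivAt (radialWeight a b κ γ)
      (γ * radialWeight a b κ (γ - 1) ρ + κ * radialWeight a b κ (γ - 1 - b) ρ) ρ := by
  refine ((hasDerivAt_flat γ (mul_pos ha hκ) hb ρ).const_mul (exp (a * κ))).congr_deriv ?_
  simp only [radialWeight]
  rw [show a * κ * b = κ by linear_combination κ * hab]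
  ring

lemma continuous_radialWeight {a b κ : ℝ} (ha : 0 < a) (hb : 0 < b) (hκ : 0 < κ) (γ : ℝ) :
    Continuous (radialWeight a b κ γ) :=
  continuous_const.mul (contDiff_flat γ (mul_pos ha hκ) hb).continuous

lemma continuous_gradient {E : Type*} [NormedAddCommGroup E] [InnerProductSpace ℝ E]
    [CompleteSpace E] {u : E → ℝ} (hu : ContDiff ℝ 1 u) : Continuous (gradient u) :=
  (InnerProductSpace.toDual ℝ E).symm.continuous.comp (hu.continuous_fderiv one_ne_zero)

/-- The Hardy inequality with remainder along a ray. -/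
lemma hardy_remainder_ray {E : Type*} [NormedAddCommGroup E] [InnerProductSpace ℝ E]
    [CompleteSpace E] {κ a b : ℝ} {u : E → ℝ} {n : ℕ} (hκn : (n : ℝ) = 2 * κ + 2) (hκ : 0 < κ)
    (ha : 0 < a) (hab : a * b = 1) (hb : 2 * κ ≤ b) (hu : ContDiff ℝ 1 u)
    (h0 : ∀ x, 1 ≤ ‖x‖ → u x = 0) {θ : E} (hθ : ‖θ‖ = 1) :
    (∫⁻ ρ in Ioo (0 : ℝ) 1, ENNReal.ofReal (ρ ^ (n - 1)) *
        ENNReal.ofReal (‖gradient (hardyTransform κ a b u) (ρ • θ)‖ ^ 2)) +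
      (∫⁻ r in Ioo (0 : ℝ) 1, ENNReal.ofReal (r ^ (n - 1)) *
        ENNReal.ofReal (κ ^ 2 * (u (r • θ) ^ 2 / ‖r • θ‖ ^ 2)))
      ≤ ∫⁻ r in Ioo (0 : ℝ) 1, ENNReal.ofReal (r ^ (n - 1)) *
        ENNReal.ofReal (‖gradient u (r • θ)‖ ^ 2) := by
  have hb0 : 0 < b := by linarith
  have h2κ : 0 < 2 * κ := by linarith
  have hn0 : 0 < 2 * κ + 2 := by linarith
  have hn1 : 1 ≤ n := by
    have : (0 : ℝ) < n := by linarith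
    exact_mod_cast this
  have hW := fun γ => continuous_radialWeight (a := a) (b := b) ha hb0 h2κ γ
  set R : ℝ → ℝ := radialWeight a b 1 0 with hR
  have hRc : Continuous R := continuous_radialWeight ha hb0 one_pos 0
  have hRd : ∀ ρ, HasDerivAt R (radialWeight a b 1 (-1 - b) ρ) ρ := fun ρ => by
    have := hasDerivAt_radialWeight ha hb0 hab one_pos 0 ρ
    simpa using this
  have hRv : ∀ {ρ}, 0 < ρ → R ρ = exp (a - a * ρ ^ (-b)) := fun hρ => by
    rw [hR, radialWeight_of_pos hρ, rpow_zero, one_mul, rpow_one]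
  set φ : ℝ → ℝ := fun ρ => u (R ρ • θ) with hφ
  set γ : ℝ → ℝ := fun ρ => inner ℝ (gradient u (R ρ • θ)) θ with hγ
  have hRθ : Continuous fun ρ => R ρ • θ := hRc.smul continuous_const
  have hφc : Continuous φ := hu.continuous.comp hRθ
  have hgc : Continuous fun ρ => gradient u (R ρ • θ) := (continuous_gradient hu).comp hRθ
  have hγc : Continuous γ := hgc.inner continuous_const
  have hφd : ∀ ρ, HasDerivAt φ (radialWeight a b 1 (-1 - b) ρ * γ ρ) ρ := by
    intro ρ
    have h1 := (hu.differentiable one_ne_zero (R ρ • θ)).hasFDerivAt.comp_hasDerivAt ρ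
      ((hRd ρ).smul_const θ)
    refine h1.congr_deriv ?_
    rw [map_smul, smul_eq_mul, hγ]
    simp only
    rw [gradient, InnerProductSpace.toDual_symm_apply]
  set F₁ : ℝ → ℝ := fun ρ => ρ ^ (n - 1) * ‖gradient (hardyTransform κ a b u) (ρ • θ)‖ ^ 2 with hF₁
  set F₂ : ℝ → ℝ := fun ρ => κ ^ 2 * (radialWeight a b (2 * κ) (-1 - b) ρ * φ ρ ^ 2) with hF₂
  set F₃ : ℝ → ℝ := fun ρ => radialWeight a b (2 * κ + 2) (-1 - b) ρ * ‖gradient u (R ρ • θ)‖ ^ 2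
    with hF₃
  set Q : ℝ → ℝ := fun ρ =>
    (b / 2 - κ) * radialWeight a b (2 * κ) b ρ + κ * radialWeight a b (2 * κ) 0 ρ with hQ
  set Q' : ℝ → ℝ := fun ρ => (b / 2 - κ) * (b * radialWeight a b (2 * κ) (b - 1) ρ +
      2 * κ * radialWeight a b (2 * κ) (b - 1 - b) ρ) +
    κ * (0 * radialWeight a b (2 * κ) (0 - 1) ρ + 2 * κ * radialWeight a b (2 * κ) (0 - 1 - b) ρ)
    with hQ'
  set B' : ℝ → ℝ := fun ρ =>
    Q' ρ * φ ρ ^ 2 + Q ρ * (2 * φ ρ * (radialWeight a b 1 (-1 - b) ρ * γ ρ)) with hB'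
  have hF₁c : Continuous F₁ := (continuous_pow _).mul
    (((continuous_gradient (contDiff_hardyTransform hκ ha hb0 hu)).comp
      (continuous_id.smul continuous_const)).norm.pow 2)
  have hF₂c : Continuous F₂ := continuous_const.mul ((hW _).mul (hφc.pow 2))
  have hF₃c : Continuous F₃ := (continuous_radialWeight ha hb0 hn0 _).mul (hgc.norm.pow 2)
  have hQc : Continuous Q := ((hW _).const_mul _).add ((hW _).const_mul _)
  have hQ'c : Continuous Q' := ((((hW _).const_mul _).add ((hW _).const_mul _)).const_mul _).add
    ((((hW _).const_mul _).add ((hW _).const_mul _)).const_mul _)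
  have hB'c : Continuous B' := (hQ'c.mul (hφc.pow 2)).add (hQc.mul ((hφc.const_mul 2).mul
    ((continuous_radialWeight ha hb0 one_pos _).mul hγc)))
  have hBd : ∀ ρ, HasDerivAt (fun ρ => Q ρ * φ ρ ^ 2) (B' ρ) ρ := by
    intro ρ
    have h1 : HasDerivAt Q (Q' ρ) ρ :=
      ((hasDerivAt_radialWeight ha hb0 hab h2κ b ρ).const_mul _).add
        ((hasDerivAt_radialWeight ha hb0 hab h2κ 0 ρ).const_mul _)
    refine (h1.mul ((hφd ρ).pow 2)).congr_deriv ?_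
    simp [hB']
  have hBi : ∫ ρ in (0 : ℝ)..1, B' ρ = 0 := by
    rw [intervalIntegral.integral_eq_sub_of_hasDerivAt (fun ρ _ => hBd ρ)
      (hB'c.intervalIntegrable _ _)]
    have h1 : φ 1 = 0 := by
      refine h0 _ ?_
      rw [norm_smul, hθ, mul_one, hRv one_pos]
      simp
    have h2 : Q 0 = 0 := by simp [hQ, radialWeight, flat_of_nonpos]
    rw [h1, h2]
    simp
  have hpt : ∀ ρ ∈ Ioo (0 : ℝ) 1, F₁ ρ + F₂ ρ ≤ F₃ ρ + B' ρ := by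
    rintro ρ ⟨hρ, hρ1⟩
    set r := exp (a - a * ρ ^ (-b)) with hr
    have hr0 : 0 < r := exp_pos _
    set w := ρ ^ (-b) with hw
    set V := ρ ^ b with hV
    have hV0 : 0 < V := rpow_pos_of_pos hρ _
    have hVw : w = V⁻¹ := rpow_neg hρ.le _
    have hV1 : V ≤ 1 := rpow_le_one hρ.le hρ1.le hb0.le
    have hw1 : V ≤ w := hV1.trans (hVw ▸ (one_le_inv₀ hV0).2 hV1)
    set K := r ^ (2 * κ) with hK
    have hK0 : 0 < K := rpow_pos_of_pos hr0 _
    have e1 : ρ ^ (-1 - b) = w / ρ := by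
      rw [show -1 - b = -b - 1 by ring, rpow_sub_one hρ.ne']
    have e2 : ρ ^ (b - 1) = V / ρ := rpow_sub_one hρ.ne' _
    have e3 : r ^ (2 * κ + 2) = K * r ^ 2 := by
      rw [rpow_add hr0, ← rpow_natCast r 2]; norm_num [hK]
    have hF₁v : F₁ ρ = K * V / ρ * (((b / 2 - κ + κ * w) * φ ρ + r * w * γ ρ) ^ 2
        + r ^ 2 * (‖gradient u (R ρ • θ)‖ ^ 2 - γ ρ ^ 2)) := by
      simp only [hF₁]
      rw [norm_gradient_hardyTransform_sq hκ ha hb0 hab (hu.differentiable one_ne_zero) hρ hθ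
        (hRv hρ) hw rfl, ← mul_assoc]
      rw [hRv hρ, ← hr]
      have hφv : u (r • θ) = φ ρ := by rw [hφ]; simp only; rw [hRv hρ]
      have hγv : inner ℝ (gradient u (r • θ)) θ = γ ρ := by rw [hγ]; simp only; rw [hRv hρ]
      rw [hφv, hγv]
      congr 1
      have e4 : (r ^ κ) ^ 2 = K := by
        rw [hK, ← rpow_natCast, ← rpow_mul hr0.le]; congr 1; push_cast; ring
      have e5 : ρ ^ (n - 1) * (ρ ^ (b / 2 - κ)) ^ 2 = V * ρ := by
        rw [← rpow_natCast, ← rpow_natCast, ← rpow_mul hρ.le, ← rpow_add hρ, hV,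
          ← rpow_add_one hρ.ne', Nat.cast_sub hn1, hκn]
        congr 1; push_cast; ring
      rw [div_pow, mul_pow, e4, ← mul_div_assoc, ← mul_assoc, e5]
      field_simp
    have hF₂v : F₂ ρ = κ ^ 2 * (w / ρ * K * φ ρ ^ 2) := by
      simp only [hF₂]
      rw [radialWeight_of_pos hρ, e1]
    have hF₃v : F₃ ρ = w / ρ * (K * r ^ 2) * ‖gradient u (R ρ • θ)‖ ^ 2 := by
      simp only [hF₃]
      rw [radialWeight_of_pos hρ, e1, e3]
    have hB'v : B' ρ = K / ρ * (((b / 2 - κ) * (b * V + 2 * κ) + 2 * κ ^ 2 * w) * φ ρ ^ 2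
        + 2 * ((b / 2 - κ) * V + κ) * φ ρ * (r * w * γ ρ)) := by
      simp only [hB', hQ', hQ]
      simp only [radialWeight_of_pos hρ]
      rw [show b - 1 - b = -1 by ring, show (0 : ℝ) - 1 - b = -1 - b by ring, e1, e2, rpow_neg_one,
        rpow_zero, rpow_one]
      ring
    have hCS : γ ρ ^ 2 ≤ ‖gradient u (R ρ • θ)‖ ^ 2 := by
      have := abs_real_inner_le_norm (gradient u (R ρ • θ)) θ
      rw [hθ, mul_one] at this
      exact sq_le_sq.2 (by rwa [abs_norm])
    have hnn : 0 ≤ K / ρ * (r ^ 2 * (w - V) * (‖gradient u (R ρ • θ)‖ ^ 2 - γ ρ ^ 2)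
        + V * (b / 2 - κ) * (b / 2 + κ) * φ ρ ^ 2) := by
      have h1 : 0 ≤ w - V := by linarith
      have h2 : 0 ≤ ‖gradient u (R ρ • θ)‖ ^ 2 - γ ρ ^ 2 := by linarith
      have h3 : 0 ≤ b / 2 - κ := by linarith
      positivity
    have hid : F₃ ρ + B' ρ - F₁ ρ - F₂ ρ = K / ρ * (r ^ 2 * (w - V) *
        (‖gradient u (R ρ • θ)‖ ^ 2 - γ ρ ^ 2) + V * (b / 2 - κ) * (b / 2 + κ) * φ ρ ^ 2) := by
      rw [hF₁v, hF₂v, hF₃v, hB'v, hVw]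
      field_simp
      ring
    linarith
  have hle : (∫ ρ in (0 : ℝ)..1, F₁ ρ) + ∫ ρ in (0 : ℝ)..1, F₂ ρ ≤ ∫ ρ in (0 : ℝ)..1, F₃ ρ := by
    have h1 := intervalIntegral.integral_mono_on_of_le_Ioo (μ := volume) zero_le_one
      ((hF₁c.add hF₂c).intervalIntegrable 0 1) ((hF₃c.add hB'c).intervalIntegrable 0 1) hpt
    simp only [Pi.add_apply] at h1
    rw [intervalIntegral.integral_add (hF₁c.intervalIntegrable _ _) (hF₂c.intervalIntegrable _ _),
      intervalIntegral.integral_add (hF₃c.intervalIntegrable _ _) (hB'c.intervalIntegrable _ _),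
      hBi, add_zero] at h1
    exact h1
  have hF₁0 : ∀ ρ ∈ Ioo (0 : ℝ) 1, 0 ≤ F₁ ρ := fun ρ hρ => by
    have := hρ.1
    positivity
  have hF₂0 : ∀ ρ ∈ Ioo (0 : ℝ) 1, 0 ≤ F₂ ρ := fun ρ hρ => by
    have := hρ.1
    simp only [hF₂]
    rw [radialWeight_of_pos this]
    positivity
  have hF₃0 : ∀ ρ ∈ Ioo (0 : ℝ) 1, 0 ≤ F₃ ρ := fun ρ hρ => by
    have := hρ.1
    simp only [hF₃]
    rw [radialWeight_of_pos this]
    positivity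
  have hr3 : ∀ r : ℝ, 0 < r → r * r ^ (n - 1) = r ^ (2 * κ + 2) := fun r hr => by
    rw [← hκn, rpow_natCast, ← pow_succ', Nat.sub_add_cancel hn1]
  rw [lintegral_Ioo_comp_exp_sub_rpow ha hb0 hab fun r => ENNReal.ofReal (r ^ (n - 1)) *
      ENNReal.ofReal (κ ^ 2 * (u (r • θ) ^ 2 / ‖r • θ‖ ^ 2)),
    lintegral_Ioo_comp_exp_sub_rpow ha hb0 hab fun r => ENNReal.ofReal (r ^ (n - 1)) *
      ENNReal.ofReal (‖gradient u (r • θ)‖ ^ 2)]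
  have hI₁ : ∫⁻ ρ in Ioo (0 : ℝ) 1, ENNReal.ofReal (ρ ^ (n - 1)) *
        ENNReal.ofReal (‖gradient (hardyTransform κ a b u) (ρ • θ)‖ ^ 2)
      = ENNReal.ofReal (∫ ρ in (0 : ℝ)..1, F₁ ρ) := by
    rw [← setLIntegral_Ioo_ofReal hF₁c hF₁0]
    refine setLIntegral_congr_fun measurableSet_Ioo fun ρ hρ => ?_
    rw [← ENNReal.ofReal_mul (pow_nonneg hρ.1.le _)]
  rw [hI₁]
  have hI₂ : ∫⁻ ρ in Ioo (0 : ℝ) 1, ENNReal.ofReal (exp (a - a * ρ ^ (-b)) * ρ ^ (-1 - b)) *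
        (ENNReal.ofReal (exp (a - a * ρ ^ (-b)) ^ (n - 1)) *
        ENNReal.ofReal (κ ^ 2 * (u (exp (a - a * ρ ^ (-b)) • θ) ^ 2 /
          ‖exp (a - a * ρ ^ (-b)) • θ‖ ^ 2)))
      = ENNReal.ofReal (∫ ρ in (0 : ℝ)..1, F₂ ρ) := by
    rw [← setLIntegral_Ioo_ofReal hF₂c hF₂0]
    refine setLIntegral_congr_fun measurableSet_Ioo fun ρ hρ => ?_
    have hρ0 := hρ.1
    simp only [hF₂, hφ]
    rw [← ENNReal.ofReal_mul (by positivity), ← ENNReal.ofReal_mul (by positivity),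
      radialWeight_of_pos hρ0, hRv hρ0]
    set r := exp (a - a * ρ ^ (-b))
    have hr0 : 0 < r := exp_pos _
    have h1 := hr3 r hr0
    rw [rpow_add hr0, rpow_ofNat] at h1
    rw [norm_smul, hθ, mul_one, norm_of_nonneg hr0.le]
    congr 1
    calc _ = (r * r ^ (n - 1)) * ρ ^ (-1 - b) * (κ ^ 2 * (u (r • θ) ^ 2 / r ^ 2)) := by ring
      _ = _ := by rw [h1]; field_simp
  have hI₃ : ∫⁻ ρ in Ioo (0 : ℝ) 1, ENNReal.ofReal (exp (a - a * ρ ^ (-b)) * ρ ^ (-1 - b)) *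
        (ENNReal.ofReal (exp (a - a * ρ ^ (-b)) ^ (n - 1)) *
        ENNReal.ofReal (‖gradient u (exp (a - a * ρ ^ (-b)) • θ)‖ ^ 2))
      = ENNReal.ofReal (∫ ρ in (0 : ℝ)..1, F₃ ρ) := by
    rw [← setLIntegral_Ioo_ofReal hF₃c hF₃0]
    refine setLIntegral_congr_fun measurableSet_Ioo fun ρ hρ => ?_
    have hρ0 := hρ.1
    simp only [hF₃]
    rw [← ENNReal.ofReal_mul (by positivity), ← ENNReal.ofReal_mul (by positivity),
      radialWeight_of_pos hρ0, hRv hρ0, ← hr3 _ (exp_pos _)]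
    congr 1
    ring
  rw [hI₂, hI₃, ← ENNReal.ofReal_add]
  · exact ENNReal.ofReal_le_ofReal hle
  · rw [intervalIntegral.integral_of_le zero_le_one, integral_Ioc_eq_integral_Ioo]
    exact setIntegral_nonneg measurableSet_Ioo hF₁0
  · rw [intervalIntegral.integral_of_le zero_le_one, integral_Ioc_eq_integral_Ioo]
    exact setIntegral_nonneg measurableSet_Ioo hF₂0

lemma integral_eq_setIntegral_ball {E : Type*} [NormedAddCommGroup E] [NormedSpace ℝ E]
    [FiniteDimensional ℝ E] [MeasurableSpace E] [BorelSpace E] (μ : Measure E)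
    [μ.IsAddHaarMeasure] {f : E → ℝ} (hf : ∀ x, 1 < ‖x‖ → f x = 0) :
    ∫ x, f x ∂μ = ∫ x in Metric.ball 0 1, f x ∂μ := by
  refine (setIntegral_eq_integral_of_ae_compl_eq_zero ?_).symm
  have h := measure_eq_zero_iff_ae_notMem.1
    (Measure.addHaar_sphere_of_ne_zero μ (0 : E) one_ne_zero)
  filter_upwards [h] with x hx hx'
  rw [mem_sphere_zero_iff_norm] at hx
  rw [mem_ball_zero_iff, not_lt] at hx'
  exact hf x (lt_of_le_of_ne hx' (Ne.symm hx))

lemma gradient_eq_zero_of_one_lt_norm {E : Type*} [NormedAddCommGroup E] [InnerProductSpace ℝ E]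
    [CompleteSpace E] {u : E → ℝ} (h0 : ∀ x, 1 ≤ ‖x‖ → u x = 0) {x : E} (hx : 1 < ‖x‖) :
    gradient u x = 0 := by
  have h : u =ᶠ[𝓝 x] fun _ => 0 := by
    filter_upwards [(continuous_norm.isOpen_preimage _ isOpen_Ioi).mem_nhds hx] with y hy
    exact h0 y (le_of_lt hy)
  rw [gradient, h.fderiv_eq, fderiv_const_apply, map_zero]

/-- The Hardy inequality on the unit ball, with the Dirichlet energy of the transformed function
as remainder. -/
lemma hardy_remainder_ball {n : ℕ} {κ a b : ℝ} {u : EuclideanSpace ℝ (Fin n) → ℝ}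
    (hκn : (n : ℝ) = 2 * κ + 2) (hκ : 0 < κ) (ha : 0 < a) (hab : a * b = 1) (hb : 2 * κ ≤ b)
    (hu : ContDiff ℝ 1 u) (h0 : ∀ x, 1 ≤ ‖x‖ → u x = 0) :
    (∫ x, ‖gradient (hardyTransform κ a b u) x‖ ^ 2) +
        κ ^ 2 * (∫ x in Metric.ball (0 : EuclideanSpace ℝ (Fin n)) 1, u x ^ 2 / ‖x‖ ^ 2)
      ≤ ∫ x in Metric.ball (0 : EuclideanSpace ℝ (Fin n)) 1, ‖gradient u x‖ ^ 2 := by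
  have hb0 : 0 < b := by linarith
  have hn0 : 0 < n := by
    have : (0 : ℝ) < n := by linarith
    exact_mod_cast this
  have : Nonempty (Fin n) := ⟨⟨0, hn0⟩⟩
  set v := hardyTransform κ a b u with hv
  have hvc : ContDiff ℝ 1 v := contDiff_hardyTransform hκ ha hb0 hu
  have hv0 : ∀ x, 1 ≤ ‖x‖ → v x = 0 := fun x hx => hardyTransform_eq_zero ha hb0 h0 hx
  have hm₁ : Continuous fun x => ‖gradient v x‖ ^ 2 := (continuous_gradient hvc).norm.pow 2
  have hm₂ : Measurable fun x => κ ^ 2 * (u x ^ 2 / ‖x‖ ^ 2) :=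
    ((hu.continuous.measurable.pow_const 2).div (measurable_norm.pow_const 2)).const_mul _
  have hm₃ : Continuous fun x => ‖gradient u x‖ ^ 2 := (continuous_gradient hu).norm.pow 2
  have hle : (∫⁻ x in Metric.ball (0 : EuclideanSpace ℝ (Fin n)) 1,
        ENNReal.ofReal (‖gradient v x‖ ^ 2)) +
      (∫⁻ x in Metric.ball (0 : EuclideanSpace ℝ (Fin n)) 1,
        ENNReal.ofReal (κ ^ 2 * (u x ^ 2 / ‖x‖ ^ 2)))
      ≤ ∫⁻ x in Metric.ball (0 : EuclideanSpace ℝ (Fin n)) 1,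
        ENNReal.ofReal (‖gradient u x‖ ^ 2) := by
    rw [← lintegral_add_left hm₁.measurable.ennreal_ofReal,
      lintegral_ball_eq_polar volume
        (f := fun x => ENNReal.ofReal (‖gradient v x‖ ^ 2) +
          ENNReal.ofReal (κ ^ 2 * (u x ^ 2 / ‖x‖ ^ 2)))
        (hm₁.measurable.ennreal_ofReal.add hm₂.ennreal_ofReal),
      lintegral_ball_eq_polar volume hm₃.measurable.ennreal_ofReal, finrank_euclideanSpace_fin]
    refine lintegral_mono fun θ => ?_
    refine le_trans (le_of_eq ?_)
      (hardy_remainder_ray hκn hκ ha hab hb hu h0 (mem_sphere_zero_iff_norm.1 θ.2))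
    rw [← lintegral_add_left]
    · simp only [mul_add, hv]
    · exact ((measurable_id.pow_const _).ennreal_ofReal).mul
        (hm₁.comp (continuous_id.smul continuous_const)).measurable.ennreal_ofReal
  have hfin : ∫⁻ x in Metric.ball (0 : EuclideanSpace ℝ (Fin n)) 1,
      ENNReal.ofReal (‖gradient u x‖ ^ 2) ≠ ⊤ := by
    have h1 : IntegrableOn (fun x => ‖gradient u x‖ ^ 2)
        (Metric.ball (0 : EuclideanSpace ℝ (Fin n)) 1) :=
      (hm₃.continuousOn.integrableOn_compact
        (isCompact_closedBall (0 : EuclideanSpace ℝ (Fin n)) 1)).mono_set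
          Metric.ball_subset_closedBall
    exact h1.lintegral_lt_top.ne
  rw [integral_eq_setIntegral_ball volume fun x hx => by
      rw [gradient_eq_zero_of_one_lt_norm hv0 hx]; simp, ← integral_const_mul,
    integral_eq_lintegral_of_nonneg_ae (ae_of_all _ fun _ => by positivity)
      hm₁.aestronglyMeasurable,
    integral_eq_lintegral_of_nonneg_ae (ae_of_all _ fun _ => by positivity)
      hm₂.aestronglyMeasurable,
    integral_eq_lintegral_of_nonneg_ae (ae_of_all _ fun _ => by positivity)
      hm₃.aestronglyMeasurable,
    ← ENNReal.toReal_add (ne_top_of_le_ne_top hfin (le_self_add.trans hle))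
      (ne_top_of_le_ne_top hfin (le_add_self.trans hle))]
  exact ENNReal.toReal_mono hfin hle

/-- The transformation is, up to a constant, an isometry from the weighted Lebesgue space with a
power of `X1` as weight to the unweighted one. -/
lemma integral_abs_hardyTransform_rpow {n : ℕ} {κ a b p q : ℝ}
    {u : EuclideanSpace ℝ (Fin n) → ℝ} (hκn : (n : ℝ) = 2 * κ + 2) (hκ : 0 < κ) (ha : 0 < a)
    (hb : 0 < b) (hab : a * b = 1) (hp : κ * p = n) (hq : 2 * (q - 1) = p)
    (hu : ContDiff ℝ 1 u) (h0 : ∀ x, 1 ≤ ‖x‖ → u x = 0) :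
    ∫ x, |hardyTransform κ a b u x| ^ p
      = a ^ q * ∫ x in Metric.ball (0 : EuclideanSpace ℝ (Fin n)) 1,
          X1 a ‖x‖ ^ q * |u x| ^ p := by
  have hn0 : 0 < n := by
    have : (0 : ℝ) < n := by linarith
    exact_mod_cast this
  have hp0 : 0 < p := by
    have : 0 < κ * p := by rw [hp]; exact_mod_cast hn0
    exact pos_of_mul_pos_right this hκ.le
  have : Nonempty (Fin n) := ⟨⟨0, hn0⟩⟩
  have hvc : ContDiff ℝ 1 (hardyTransform κ a b u) := contDiff_hardyTransform hκ ha hb hu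
  have hm₁ : Measurable fun x => |hardyTransform κ a b u x| ^ p :=
    hvc.continuous.abs.measurable.pow_const p
  have hX : Measurable fun x : EuclideanSpace ℝ (Fin n) => X1 a ‖x‖ := by
    unfold X1
    exact (measurable_norm.log.const_sub a).inv
  have hm₂ : Measurable fun x => a ^ q * (X1 a ‖x‖ ^ q * |u x| ^ p) :=
    ((hX.pow_const q).mul (hu.continuous.abs.measurable.pow_const p)).const_mul _
  have hX0 : ∀ x ∈ Metric.ball (0 : EuclideanSpace ℝ (Fin n)) 1, 0 ≤ X1 a ‖x‖ := fun x hx => by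
    rw [mem_ball_zero_iff] at hx
    have := log_nonpos (norm_nonneg x) hx.le
    exact inv_nonneg.2 (by linarith)
  rw [integral_eq_setIntegral_ball volume fun x hx => by
      rw [hardyTransform_eq_zero ha hb h0 hx.le, abs_zero, zero_rpow hp0.ne'],
    ← integral_const_mul,
    integral_eq_lintegral_of_nonneg_ae (ae_of_all _ fun _ => by positivity)
      hm₁.aestronglyMeasurable,
    integral_eq_lintegral_of_nonneg_ae _ hm₂.aestronglyMeasurable,
    lintegral_ball_eq_polar volume hm₁.ennreal_ofReal,
    lintegral_ball_eq_polar volume hm₂.ennreal_ofReal, finrank_euclideanSpace_fin]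
  · congr 1
    refine lintegral_congr fun θ => ?_
    have hθ := mem_sphere_zero_iff_norm.1 θ.2
    rw [lintegral_Ioo_comp_exp_sub_rpow ha hb hab fun r => ENNReal.ofReal (r ^ (n - 1)) *
      ENNReal.ofReal (a ^ q * (X1 a ‖r • (θ : EuclideanSpace ℝ (Fin n))‖ ^ q *
        |u (r • (θ : EuclideanSpace ℝ (Fin n)))| ^ p))]
    refine setLIntegral_congr_fun measurableSet_Ioo fun ρ hρ => ?_
    have hρ0 := hρ.1
    rw [hardyTransform_smul hρ0 hθ, norm_smul, hθ, mul_one, norm_of_nonneg (exp_pos _).le, X1,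
      log_exp, sub_sub_cancel, abs_mul, abs_of_pos (by positivity)]
    set r := exp (a - a * ρ ^ (-b))
    have hr0 : 0 < r := exp_pos _
    rw [← ENNReal.ofReal_mul (by positivity), ← ENNReal.ofReal_mul (by positivity),
      ← ENNReal.ofReal_mul (by positivity), mul_rpow (by positivity) (by positivity),
      mul_rpow (by positivity) (by positivity), ← rpow_mul hρ0.le, ← rpow_mul hr0.le, hp,
      rpow_natCast, mul_inv, ← rpow_neg hρ0.le, neg_neg, mul_rpow (by positivity) (by positivity),
      inv_rpow ha.le, ← rpow_mul hρ0.le]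
    have e1 : r ^ n = r * r ^ (n - 1) := by rw [← pow_succ', Nat.sub_add_cancel hn0]
    have e2 : ρ ^ (n - 1) * ρ ^ ((b / 2 - κ) * p) = ρ ^ (-1 - b) * ρ ^ (b * q) := by
      rw [← rpow_natCast, ← rpow_add hρ0, ← rpow_add hρ0, Nat.cast_sub hn0]
      congr 1
      push_cast
      linear_combination -hp + (-b / 2) * hq
    have e3 : a ^ q * (a ^ q)⁻¹ = 1 := mul_inv_cancel₀ (by positivity)
    congr 1
    calc _ = (ρ ^ (n - 1) * ρ ^ ((b / 2 - κ) * p)) * r ^ n *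
          |u (r • (θ : EuclideanSpace ℝ (Fin n)))| ^ p := by ring
      _ = (a ^ q * (a ^ q)⁻¹) * (ρ ^ (-1 - b) * ρ ^ (b * q)) * (r * r ^ (n - 1)) *
          |u (r • (θ : EuclideanSpace ℝ (Fin n)))| ^ p := by rw [e1, e2, e3, one_mul]
      _ = _ := by ring
  · filter_upwards [ae_restrict_mem Metric.isOpen_ball.measurableSet] with x hx
    have := hX0 x hx
    simp only [Pi.zero_apply]
    positivity

theorem stmt1 (n : ℕ) (hn : 3 ≤ n) (a : ℝ) (ha0 : 0 < a)
    (ha : a < 1 / ((n : ℝ) - 2))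
    (u : EuclideanSpace ℝ (Fin n) → ℝ) (hu : ContDiff ℝ (⊤ : ℕ∞) u)
    (hcs : HasCompactSupport u)
    (hsupp : tsupport u ⊆ Metric.ball (0 : EuclideanSpace ℝ (Fin n)) 1) :
    (∫ x in Metric.ball (0 : EuclideanSpace ℝ (Fin n)) 1, ‖gradient u x‖ ^ 2)
      ≥ (((n : ℝ) - 2) / 2) ^ 2 *
          (∫ x in Metric.ball (0 : EuclideanSpace ℝ (Fin n)) 1, u x ^ 2 / ‖x‖ ^ 2)
        + a ^ (2 * ((n : ℝ) - 1) / (n : ℝ)) * sobolevConst n *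
          (∫ x in Metric.ball (0 : EuclideanSpace ℝ (Fin n)) 1,
              (X1 a ‖x‖) ^ (2 * ((n : ℝ) - 1) / ((n : ℝ) - 2)) *
                |u x| ^ (2 * (n : ℝ) / ((n : ℝ) - 2)))
            ^ (((n : ℝ) - 2) / (n : ℝ)) := by
  have hn' : (3 : ℝ) ≤ n := by exact_mod_cast hn
  have hn2 : (0 : ℝ) < n - 2 := by linarith
  have hu1 : ContDiff ℝ 1 u := hu.of_le (by exact_mod_cast le_top)
  have h0 : ∀ x, 1 ≤ ‖x‖ → u x = 0 := fun x hx => by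
    by_contra h
    have := mem_ball_zero_iff.1 (hsupp (subset_tsupport u h))
    linarith
  have hab : a * a⁻¹ = 1 := mul_inv_cancel₀ ha0.ne'
  have hb0 : 0 < a⁻¹ := inv_pos.2 ha0
  have hb : 2 * (((n : ℝ) - 2) / 2) ≤ a⁻¹ := by
    rw [mul_div_cancel₀ _ two_ne_zero]
    rw [lt_one_div ha0 hn2, one_div] at ha
    exact ha.le
  have hκ : 0 < ((n : ℝ) - 2) / 2 := half_pos hn2
  have hκn : (n : ℝ) = 2 * (((n : ℝ) - 2) / 2) + 2 := by ring
  have h1 := hardy_remainder_ball hκn hκ ha0 hab hb hu1 h0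
  have h2 := sobolev_inequality hn (contDiff_hardyTransform hκ ha0 hb0 hu1)
    (HasCompactSupport.intro (isCompact_closedBall (0 : EuclideanSpace ℝ (Fin n)) 1) fun x hx =>
      hardyTransform_eq_zero ha0 hb0 h0 (by
        rw [mem_closedBall_zero_iff, not_le] at hx
        exact hx.le))
  rw [integral_abs_hardyTransform_rpow (q := 2 * ((n : ℝ) - 1) / ((n : ℝ) - 2)) hκn hκ ha0 hb0 hab
    (by field_simp) (by field_simp; ring) hu1 h0, mul_rpow (by positivity), ← rpow_mul ha0.le,
    show 2 * ((n : ℝ) - 1) / ((n : ℝ) - 2) * (((n : ℝ) - 2) / n) = 2 * ((n : ℝ) - 1) / n by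
      field_simp] at h2
  · linarith
  · refine setIntegral_nonneg Metric.isOpen_ball.measurableSet fun x hx => ?_
    rw [mem_ball_zero_iff] at hx
    have h3 := log_nonpos (norm_nonneg x) hx.le
    have h4 : 0 ≤ X1 a ‖x‖ := inv_nonneg.2 (by linarith)
    positivity
end

section
/- Let n ≥ 3 and let a ≥ 1/(n-2). The constant (n-2)^{-2(n-1)/n} S_n is sharp: for every C > (n-2)^{-2(n-1)/n} S_n there exists a nonzero u ∈ C_c^∞(B_1) such that ∫_{B_1} |∇u|² dx − ((n-2)/2)² ∫_{B_1} u²/|x|² dx < C · ( ∫_{B_1} X_1(a,|x|)^{2(n-1)/(n-2)} |u|^{2n/(n-2)} dx )^{(n-2)/n}. -/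
open MeasureTheory Real

open Set ProbabilityTheory in
theorem setIntegral_Ioo_rpow_mul_one_sub_rpow {p q : ℝ} (hp : 0 < p) (hq : 0 < q) :
    ∫ x in Ioo (0 : ℝ) 1, x ^ (p - 1) * (1 - x) ^ (q - 1) = beta p q := by
  rw [beta_eq_betaIntegralReal p q hp hq, Complex.betaIntegral,
    ← integral_Ioc_eq_integral_Ioo, ← intervalIntegral.integral_of_le zero_le_one]
  have h : ∫ x in (0 : ℝ)..1, (x : ℂ) ^ ((p : ℂ) - 1) * (1 - (x : ℂ)) ^ ((q : ℂ) - 1)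
      = ∫ x in (0 : ℝ)..1, ((x ^ (p - 1) * (1 - x) ^ (q - 1) : ℝ) : ℂ) := by
    refine intervalIntegral.integral_congr fun x hx => ?_
    rw [uIcc_of_le zero_le_one] at hx
    push_cast
    rw [Complex.ofReal_cpow hx.1, Complex.ofReal_cpow (by linarith [hx.2])]
    push_cast
    rfl
  rw [h, intervalIntegral.integral_ofReal, Complex.ofReal_re]

open Set ProbabilityTheory in
theorem setIntegral_Ioi_rpow_mul_one_add_rpow {p q : ℝ} (hp : 0 < p) (hq : 0 < q) :
    ∫ z in Ioi (0 : ℝ), z ^ (p - 1) * (1 + z) ^ (-(p + q)) = beta p q := by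
  rw [← setIntegral_Ioo_rpow_mul_one_sub_rpow hp hq]
  have himg : (fun x : ℝ => x / (1 - x)) '' Ioo 0 1 = Ioi 0 := by
    ext z
    constructor
    · rintro ⟨x, hx, rfl⟩
      exact div_pos hx.1 (by linarith [hx.2])
    · intro hz
      have hz' : (0 : ℝ) < z := hz
      refine ⟨z / (1 + z), ⟨by positivity, by rw [div_lt_one (by positivity)]; linarith⟩, ?_⟩
      have : (1 : ℝ) + z ≠ 0 := by positivity
      simp only
      field_simp
      ring
  have hinj : InjOn (fun x : ℝ => x / (1 - x)) (Ioo 0 1) := by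
    intro x hx y hy hxy
    have h1 : (1 : ℝ) - x ≠ 0 := by linarith [hx.2]
    have h2 : (1 : ℝ) - y ≠ 0 := by linarith [hy.2]
    simp only at hxy
    rw [div_eq_div_iff h1 h2] at hxy
    linarith
  have hder : ∀ x ∈ Ioo (0 : ℝ) 1,
      HasDerivWithinAt (fun x : ℝ => x / (1 - x)) (((1 - x) ^ 2)⁻¹) (Ioo 0 1) x := by
    intro x hx
    have h1 : (1 : ℝ) - x ≠ 0 := by linarith [hx.2]
    have := (hasDerivAt_id x).div ((hasDerivAt_id x).const_sub 1) h1
    refine (this.congr_deriv ?_).hasDerivWithinAt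
    simp only [id]
    field_simp
    ring
  rw [← himg, integral_image_eq_integral_abs_deriv_smul measurableSet_Ioo hder hinj]
  refine setIntegral_congr_fun measurableSet_Ioo fun x hx => ?_
  have h1 : (0 : ℝ) < 1 - x := by linarith [hx.2]
  have h2 : 1 + x / (1 - x) = (1 - x)⁻¹ := by field_simp; ring
  simp only [smul_eq_mul]
  rw [h2, abs_of_nonneg (by positivity), div_rpow hx.1.le h1.le, inv_rpow h1.le, ← rpow_neg h1.le,
    neg_neg, ← rpow_natCast, ← rpow_neg h1.le, div_eq_mul_inv, ← rpow_neg h1.le]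
  rw [show (1 - x) ^ (-((2 : ℕ) : ℝ)) * (x ^ (p - 1) * (1 - x) ^ (-(p - 1)) * (1 - x) ^ (p + q))
    = x ^ (p - 1) * ((1 - x) ^ (-((2 : ℕ) : ℝ)) * (1 - x) ^ (-(p - 1)) * (1 - x) ^ (p + q)) by ring,
    ← rpow_add h1, ← rpow_add h1]
  congr 2
  push_cast
  ring

open Set ProbabilityTheory in
theorem setIntegral_Ioi_rpow_mul_one_add_rpow_rpow {α s m : ℝ} (hα : 0 < α)
    (hs : 0 < (s + 1) / α) (hm : (s + 1) / α < m) :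
    ∫ t in Ioi (0 : ℝ), t ^ s * (1 + t ^ α) ^ (-m)
      = α⁻¹ * beta ((s + 1) / α) (m - (s + 1) / α) := by
  rw [← setIntegral_Ioi_rpow_mul_one_add_rpow hs (sub_pos.2 hm),
    ← integral_comp_rpow_Ioi_of_pos
      (g := fun z => z ^ ((s + 1) / α - 1) * (1 + z) ^ (-((s + 1) / α + (m - (s + 1) / α)))) hα,
    ← integral_const_mul]
  refine setIntegral_congr_fun measurableSet_Ioi fun t ht => ?_
  have ht' : (0 : ℝ) < t := ht
  simp only [smul_eq_mul]
  rw [add_sub_cancel, ← rpow_mul ht'.le,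
    show α⁻¹ * (α * t ^ (α - 1) * (t ^ (α * ((s + 1) / α - 1)) * (1 + t ^ α) ^ (-m)))
    = (α⁻¹ * α) * ((t ^ (α - 1) * t ^ (α * ((s + 1) / α - 1))) * (1 + t ^ α) ^ (-m)) by ring,
    ← rpow_add ht', inv_mul_cancel₀ hα.ne', one_mul]
  congr 2
  field_simp
  ring

open Set ProbabilityTheory in
theorem integrableOn_Ioi_rpow_mul_one_add_rpow_rpow {α s m : ℝ} (hα : 0 < α)
    (hs : 0 < (s + 1) / α) (hm : (s + 1) / α < m) :
    IntegrableOn (fun t : ℝ => t ^ s * (1 + t ^ α) ^ (-m)) (Ioi 0) := by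
  by_contra h
  have h1 := setIntegral_Ioi_rpow_mul_one_add_rpow_rpow hα hs hm
  rw [integral_undef h] at h1
  have := beta_pos hs (sub_pos.2 hm)
  have : 0 < α⁻¹ * beta ((s + 1) / α) (m - (s + 1) / α) := by positivity
  linarith

theorem integral_fun_norm_eq_integral_exp {n : ℕ} (hn : 0 < n) (a : ℝ) (h : ℝ → ℝ) :
    ∫ x : EuclideanSpace ℝ (Fin n), h ‖x‖ =
      (n * volume.real (Metric.ball (0 : EuclideanSpace ℝ (Fin n)) 1)) *
        ∫ t : ℝ, Real.exp (a - t) ^ n * h (Real.exp (a - t)) := by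
  have : Nonempty (Fin n) := ⟨⟨0, hn⟩⟩
  rw [integral_fun_norm_addHaar volume h, finrank_euclideanSpace_fin]
  have himg : (fun t : ℝ => Real.exp (a - t)) '' Set.univ = Set.Ioi 0 := by
    ext z
    constructor
    · rintro ⟨x, -, rfl⟩
      exact Real.exp_pos _
    · intro hz
      refine ⟨a - Real.log z, trivial, ?_⟩
      simp [Real.exp_log hz]
  have hinj : Set.InjOn (fun t : ℝ => Real.exp (a - t)) Set.univ := by
    intro x _ y _ hxy
    have := Real.exp_injective hxy
    linarith
  have hder : ∀ x ∈ (Set.univ : Set ℝ),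
      HasDerivWithinAt (fun t : ℝ => Real.exp (a - t)) (-Real.exp (a - x)) Set.univ x := by
    intro x _
    refine ((((hasDerivAt_id x).const_sub a).exp).congr_deriv ?_).hasDerivWithinAt
    simp
  rw [← himg, integral_image_eq_integral_abs_deriv_smul MeasurableSet.univ hder hinj,
    setIntegral_univ, nsmul_eq_mul, smul_eq_mul, ← mul_assoc]
  congr 1
  refine integral_congr_ae (.of_forall fun t => ?_)
  simp only [abs_neg, Real.abs_exp, smul_eq_mul]
  obtain ⟨m, rfl⟩ := Nat.exists_eq_succ_of_ne_zero hn.ne'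
  simp only [Nat.succ_eq_add_one, Nat.add_sub_cancel, pow_succ]
  ring

theorem card_mul_volume_ball {n : ℕ} (hn : 0 < n) :
    n * volume.real (Metric.ball (0 : EuclideanSpace ℝ (Fin n)) 1)
      = 2 * π ^ ((n : ℝ) / 2) / Real.Gamma ((n : ℝ) / 2) := by
  have : Nonempty (Fin n) := ⟨⟨0, hn⟩⟩
  have hn' : (0 : ℝ) < n := by exact_mod_cast hn
  have hG : 0 < Real.Gamma ((n : ℝ) / 2) := Real.Gamma_pos_of_pos (by positivity)
  have hG' : 0 < Real.Gamma ((n : ℝ) / 2 + 1) := Real.Gamma_pos_of_pos (by positivity)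
  rw [measureReal_def, EuclideanSpace.volume_ball, ENNReal.ofReal_one, one_pow, one_mul,
    Fintype.card_fin, ENNReal.toReal_ofReal (by positivity), Real.Gamma_add_one (by positivity),
    Real.sqrt_eq_rpow, ← Real.rpow_natCast, ← Real.rpow_mul pi_pos.le]
  rw [show (1 / 2 * (n : ℝ)) = n / 2 by ring]
  field_simp

/-- The extremal `t (1 + t ^ α) ^ (-1/α)` of the Bliss inequality, cut off by `χ` on a logarithmic
scale. -/
noncomputable def blissCutoff (α : ℝ) (χ : ℝ → ℝ) (κ t : ℝ) : ℝ :=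
  if 0 < t then t * (1 + t ^ α) ^ (-(1 / α)) * χ (κ * Real.log t) else 0

theorem exists_smooth_cutoff : ∃ (χ : ℝ → ℝ) (M : ℝ), ContDiff ℝ (⊤ : ℕ∞) χ ∧ χ 0 = 1 ∧
    (∀ x, 0 ≤ χ x) ∧ (∀ x, χ x ≤ 1) ∧ (∀ x, χ x ≠ 0 → |x| ≤ 2) ∧ ∀ x, |deriv χ x| ≤ M := by
  let f : ContDiffBump (0 : ℝ) := ⟨1, 2, one_pos, one_lt_two⟩
  have hf : ContDiff ℝ (⊤ : ℕ∞) f := f.contDiff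
  obtain ⟨M, hM⟩ := (hf.continuous_deriv (by simp)).bounded_above_of_compact_support
    f.hasCompactSupport.deriv
  refine ⟨f, M, hf, f.one_of_mem_closedBall (by simp [f]), fun x => f.nonneg, fun x => f.le_one,
    fun x hx => ?_, fun x => hM x⟩
  have : x ∈ Function.support f := hx
  rw [f.support_eq] at this
  exact (mem_ball_zero_iff.1 this).le

theorem hasDerivAt_bliss {α t : ℝ} (hα : 0 < α) (ht : 0 < t) :
    HasDerivAt (fun t : ℝ => t * (1 + t ^ α) ^ (-(1 / α))) ((1 + t ^ α) ^ (-(1 / α) - 1)) t := by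
  have h1 : (0 : ℝ) < 1 + t ^ α := by positivity
  have h2 := (hasDerivAt_id t).mul
    (((hasDerivAt_rpow_const (p := α) (Or.inl ht.ne')).const_add 1).rpow_const
      (p := -(1 / α)) (Or.inl h1.ne'))
  refine h2.congr_deriv ?_
  simp only [id]
  rw [show (1 + t ^ α) ^ (-(1 / α)) = (1 + t ^ α) ^ (-(1 / α) - 1) * (1 + t ^ α) by
    rw [← rpow_add_one h1.ne', sub_add_cancel], rpow_sub_one ht.ne']
  field_simp
  ring

section

variable {α κ : ℝ} {χ : ℝ → ℝ}

theorem blissCutoff_of_pos {t : ℝ} (ht : 0 < t) :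
    blissCutoff α χ κ t = t * (1 + t ^ α) ^ (-(1 / α)) * χ (κ * Real.log t) := if_pos ht

theorem mem_Icc_of_blissCutoff_ne_zero (hκ : 0 < κ) (hχ : ∀ x, χ x ≠ 0 → |x| ≤ 2) {t : ℝ}
    (ht : blissCutoff α χ κ t ≠ 0) : t ∈ Set.Icc (Real.exp (-(2 / κ))) (Real.exp (2 / κ)) := by
  unfold blissCutoff at ht
  split_ifs at ht with h
  · have h1 := abs_le.1 (hχ _ (right_ne_zero_of_mul ht))
    constructor
    · rw [← Real.le_log_iff_exp_le h, ← neg_div, div_le_iff₀ hκ]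
      linarith
    · rw [← Real.log_le_iff_le_exp h, le_div_iff₀ hκ]
      linarith
  · exact absurd rfl ht

theorem contDiff_blissCutoff (hκ : 0 < κ) (hχ : ∀ x, χ x ≠ 0 → |x| ≤ 2)
    (hs : ContDiff ℝ (⊤ : ℕ∞) χ) : ContDiff ℝ (⊤ : ℕ∞) (blissCutoff α χ κ) := by
  rw [contDiff_iff_contDiffAt]
  intro t
  rcases lt_or_ge 0 t with ht | ht
  · have h1 : ContDiffAt ℝ (⊤ : ℕ∞)
        (fun t : ℝ => t * (1 + t ^ α) ^ (-(1 / α)) * χ (κ * Real.log t)) t := by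
      refine (contDiffAt_id.mul (ContDiffAt.rpow_const_of_ne (contDiffAt_const.add
        (contDiffAt_id.rpow_const_of_ne ht.ne')) ?_)).mul
        (hs.contDiffAt.comp t (contDiffAt_const.mul (contDiffAt_id.log ht.ne')))
      have : 0 < t ^ α := by positivity
      simp only [id]
      positivity
    refine h1.congr_of_eventuallyEq ?_
    filter_upwards [lt_mem_nhds ht] with s hs using blissCutoff_of_pos hs
  · refine (contDiffAt_const (c := (0 : ℝ))).congr_of_eventuallyEq ?_
    filter_upwards [gt_mem_nhds (ht.trans_lt (Real.exp_pos (-(2 / κ))))] with s hs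
    by_contra h
    exact absurd (mem_Icc_of_blissCutoff_ne_zero hκ hχ h).1 (not_le.2 hs)

theorem deriv_blissCutoff {t : ℝ} (hα : 0 < α) (hs : Differentiable ℝ χ) (ht : 0 < t) :
    deriv (blissCutoff α χ κ) t = (1 + t ^ α) ^ (-(1 / α) - 1) * χ (κ * Real.log t) +
      (1 + t ^ α) ^ (-(1 / α)) * (κ * deriv χ (κ * Real.log t)) := by
  have h1 := (hasDerivAt_bliss hα ht).mul
    (((hs (κ * Real.log t)).hasDerivAt).comp t ((Real.hasDerivAt_log ht.ne').const_mul κ))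
  have h2 : blissCutoff α χ κ =ᶠ[nhds t]
      (fun t : ℝ => t * (1 + t ^ α) ^ (-(1 / α))) * (χ ∘ fun t => κ * Real.log t) := by
    filter_upwards [lt_mem_nhds ht] with s hs using blissCutoff_of_pos hs
  rw [h2.deriv_eq, h1.deriv]
  simp only [Function.comp]
  field_simp

open Filter Topology

theorem tendsto_integral_deriv_blissCutoff_sq {M : ℝ} (hα : 0 < α) (hs : ContDiff ℝ (⊤ : ℕ∞) χ)
    (hχ : ∀ x, χ x ≠ 0 → |x| ≤ 2) (h0 : χ 0 = 1) (hnn : ∀ x, 0 ≤ χ x) (hle : ∀ x, χ x ≤ 1)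
    (hM : ∀ x, |deriv χ x| ≤ M) :
    Tendsto (fun k : ℕ => ∫ t in Set.Ioi (0 : ℝ), deriv (blissCutoff α χ (1 / ((k : ℝ) + 1))) t ^ 2)
      atTop (𝓝 (∫ t in Set.Ioi (0 : ℝ), t ^ (0 : ℝ) * (1 + t ^ α) ^ (-(2 / α + 2)))) := by
  have hM0 : 0 ≤ M := (abs_nonneg _).trans (hM 0)
  have hdiff : Differentiable ℝ χ := hs.differentiable (by simp)
  have hlim : Tendsto (fun k : ℕ => 1 / ((k : ℝ) + 1)) atTop (𝓝 0) :=
    tendsto_one_div_add_atTop_nhds_zero_nat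
  refine tendsto_integral_of_dominated_convergence
    (fun t => (1 + M) ^ 2 * (t ^ (0 : ℝ) * (1 + t ^ α) ^ (-(2 / α)))) ?_ ?_ ?_ ?_
  · intro k
    have := (contDiff_blissCutoff (α := α) (κ := 1 / ((k : ℝ) + 1)) (by positivity) hχ
      hs).continuous_deriv (by simp)
    exact (this.pow 2).aestronglyMeasurable
  · refine (integrableOn_Ioi_rpow_mul_one_add_rpow_rpow hα (by positivity) ?_).const_mul _
    gcongr
    norm_num
  · intro k
    refine ae_restrict_of_forall_mem measurableSet_Ioi fun t ht => ?_
    have ht' : (0 : ℝ) < t := ht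
    set κ := 1 / ((k : ℝ) + 1) with hk
    have hκ0 : 0 < κ := by positivity
    have hκ1 : κ ≤ 1 := by
      rw [hk, div_le_one (by positivity)]
      linarith [(Nat.cast_nonneg k : (0 : ℝ) ≤ k)]
    have h1 : (1 : ℝ) ≤ 1 + t ^ α := by linarith [rpow_pos_of_pos ht' α]
    have h2 : (1 + t ^ α) ^ (-(1 / α) - 1) ≤ (1 + t ^ α) ^ (-(1 / α)) :=
      rpow_le_rpow_of_exponent_le h1 (by linarith)
    have h3 : 0 < (1 + t ^ α) ^ (-(1 / α)) := by positivity
    have h4 : 0 < (1 + t ^ α) ^ (-(1 / α) - 1) := by positivity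
    rw [deriv_blissCutoff hα hdiff ht', rpow_zero, one_mul,
      show -(2 / α) = -(1 / α) * (2 : ℕ) by push_cast; ring,
      rpow_mul (by positivity), rpow_natCast, ← mul_pow, norm_pow]
    refine pow_le_pow_left₀ (norm_nonneg _) ?_ 2
    refine (norm_add_le _ _).trans ?_
    rw [norm_mul, norm_mul, norm_mul, Real.norm_of_nonneg h3.le, Real.norm_of_nonneg h4.le,
      Real.norm_of_nonneg hκ0.le, Real.norm_of_nonneg (hnn _), Real.norm_eq_abs]
    rw [add_mul, one_mul, mul_comm M]
    gcongr
    · calc _ ≤ (1 + t ^ α) ^ (-(1 / α) - 1) * 1 := by gcongr; exact hle _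
        _ ≤ _ := by linarith
    · calc _ ≤ 1 * M := by gcongr; exact hM _
        _ = M := one_mul _
  · refine ae_restrict_of_forall_mem measurableSet_Ioi fun t ht => ?_
    have ht' : (0 : ℝ) < t := ht
    have h1 : (0 : ℝ) < 1 + t ^ α := by positivity
    simp_rw [deriv_blissCutoff hα hdiff ht']
    have hc : Tendsto (fun k : ℕ => χ (1 / ((k : ℝ) + 1) * Real.log t)) atTop (𝓝 1) := by
      have h : Tendsto (fun k : ℕ => 1 / ((k : ℝ) + 1) * Real.log t) atTop (𝓝 0) := by
        simpa using hlim.mul_const (Real.log t)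
      have h' := (hs.continuous.tendsto 0).comp h
      rwa [h0] at h'
    have hd : Tendsto (fun k : ℕ => 1 / ((k : ℝ) + 1) * deriv χ (1 / ((k : ℝ) + 1) * Real.log t))
        atTop (𝓝 0) :=
      hlim.zero_mul_isBoundedUnder_le ⟨M, eventually_map.2 (Eventually.of_forall fun _ => hM _)⟩
    have h2 := ((hc.const_mul ((1 + t ^ α) ^ (-(1 / α) - 1))).add
      (hd.const_mul ((1 + t ^ α) ^ (-(1 / α))))).pow 2
    refine h2.trans_eq ?_
    congr 1
    rw [mul_one, mul_zero, add_zero, rpow_zero, one_mul, ← rpow_natCast, ← rpow_mul h1.le]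
    congr 1
    push_cast
    ring

theorem tendsto_integral_blissCutoff_rpow (hα : 0 < α) (hs : ContDiff ℝ (⊤ : ℕ∞) χ)
    (hχ : ∀ x, χ x ≠ 0 → |x| ≤ 2) (h0 : χ 0 = 1) (hnn : ∀ x, 0 ≤ χ x) (hle : ∀ x, χ x ≤ 1) :
    Tendsto (fun k : ℕ => ∫ t in Set.Ioi (0 : ℝ), t ^ (-(2 + α)) *
        |blissCutoff α χ (1 / ((k : ℝ) + 1)) t| ^ (2 + 2 * α))
      atTop (𝓝 (∫ t in Set.Ioi (0 : ℝ), t ^ α * (1 + t ^ α) ^ (-(2 / α + 2)))) := by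
  have hlim : Tendsto (fun k : ℕ => 1 / ((k : ℝ) + 1)) atTop (𝓝 0) :=
    tendsto_one_div_add_atTop_nhds_zero_nat
  have key : ∀ (κ t : ℝ), 0 < t → t ^ (-(2 + α)) * |blissCutoff α χ κ t| ^ (2 + 2 * α)
      = t ^ α * (1 + t ^ α) ^ (-(2 / α + 2)) * χ (κ * Real.log t) ^ (2 + 2 * α) := by
    intro κ t ht
    have h1 : (0 : ℝ) < 1 + t ^ α := by positivity
    have h3 : 0 < (1 + t ^ α) ^ (-(1 / α)) := by positivity
    rw [blissCutoff_of_pos ht, abs_of_nonneg (mul_nonneg (by positivity) (hnn _)),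
      mul_rpow (by positivity) (hnn _), mul_rpow ht.le h3.le, ← mul_assoc, ← mul_assoc,
      ← rpow_add ht, ← rpow_mul h1.le]
    congr 3
    · ring
    · field_simp
  refine tendsto_integral_of_dominated_convergence
    (fun t => t ^ α * (1 + t ^ α) ^ (-(2 / α + 2))) ?_ ?_ ?_ ?_
  · intro k
    have := (contDiff_blissCutoff (α := α) (κ := 1 / ((k : ℝ) + 1)) (by positivity) hχ
      hs).continuous.measurable
    refine Measurable.aestronglyMeasurable ?_
    fun_prop
  · refine integrableOn_Ioi_rpow_mul_one_add_rpow_rpow hα (by positivity) ?_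
    rw [div_lt_iff₀ hα]
    field_simp
    linarith
  · intro k
    refine ae_restrict_of_forall_mem measurableSet_Ioi fun t ht => ?_
    have ht' : (0 : ℝ) < t := ht
    have h1 : (0 : ℝ) < 1 + t ^ α := by positivity
    rw [key _ t ht', Real.norm_of_nonneg (mul_nonneg (by positivity) (rpow_nonneg (hnn _) _))]
    exact mul_le_of_le_one_right (by positivity) (rpow_le_one (hnn _) (hle _) (by positivity))
  · refine ae_restrict_of_forall_mem measurableSet_Ioi fun t ht => ?_
    have ht' : (0 : ℝ) < t := ht
    simp_rw [key _ t ht']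
    have hc : Tendsto (fun k : ℕ => χ (1 / ((k : ℝ) + 1) * Real.log t)) atTop (𝓝 1) := by
      have h : Tendsto (fun k : ℕ => 1 / ((k : ℝ) + 1) * Real.log t) atTop (𝓝 0) := by
        simpa using hlim.mul_const (Real.log t)
      have h' := (hs.continuous.tendsto 0).comp h
      rwa [h0] at h'
    simpa using (hc.rpow_const (p := 2 + 2 * α) (Or.inl one_ne_zero)).const_mul
      (t ^ α * (1 + t ^ α) ^ (-(2 / α + 2)))

end

theorem integral_sq_add_deriv {V : ℝ → ℝ} (hV : ContDiff ℝ (⊤ : ℕ∞) V) (hc : HasCompactSupport V)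
    (β : ℝ) : ∫ t, (β * V t + deriv V t) ^ 2 = β ^ 2 * (∫ t, V t ^ 2) + ∫ t, deriv V t ^ 2 := by
  have hV' : Continuous (deriv V) := hV.continuous_deriv (by simp)
  have hVc := hV.continuous
  have i1 : Integrable fun t => V t ^ 2 :=
    (hVc.pow 2).integrable_of_hasCompactSupport
      (hc.mono fun t ht h => ht (by simp [h]))
  have i2 : Integrable fun t => deriv V t ^ 2 :=
    (hV'.pow 2).integrable_of_hasCompactSupport
      (hc.deriv.mono fun t ht h => ht (by simp [h]))
  have i3 : Integrable fun t => 2 * V t * deriv V t :=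
    ((continuous_const.mul hVc).mul hV').integrable_of_hasCompactSupport hc.deriv.mul_left
  have h3 : ∫ t, 2 * V t * deriv V t = 0 := by
    refine integral_eq_zero_of_hasDerivAt_of_integrable (f := fun t => V t ^ 2) (fun t => ?_) i3 i1
    have h := ((hV.differentiable (by simp) t).hasDerivAt).pow 2
    exact h.congr_deriv (by simp)
  have h4 : (fun t => (β * V t + deriv V t) ^ 2)
      = fun t => (β ^ 2 * V t ^ 2 + β * (2 * V t * deriv V t)) + deriv V t ^ 2 := by
    ext t; ring
  have i4 : Integrable fun t => β ^ 2 * V t ^ 2 + β * (2 * V t * deriv V t) :=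
    (i1.const_mul _).add (i3.const_mul _)
  rw [h4, integral_add i4 i2, integral_add (i1.const_mul _) (i3.const_mul _), integral_const_mul, integral_const_mul, h3]
  ring

/-- The radial function which the Emden–Fowler substitution `t = a - log |x|` attaches to `V`. -/
noncomputable def emdenFowler (n : ℕ) (a : ℝ) (V : ℝ → ℝ) (x : EuclideanSpace ℝ (Fin n)) : ℝ :=
  ‖x‖ ^ (-(((n : ℝ) - 2) / 2)) * V (a - Real.log ‖x‖)

section

variable {n : ℕ} {a c d : ℝ} {V : ℝ → ℝ}

theorem norm_mem_Icc_of_emdenFowler_ne_zero (hn : 3 ≤ n)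
    (hsupp : ∀ t, V t ≠ 0 → t ∈ Set.Icc c d) {x : EuclideanSpace ℝ (Fin n)}
    (hx : emdenFowler n a V x ≠ 0) :
    ‖x‖ ∈ Set.Icc (Real.exp (a - d)) (Real.exp (a - c)) := by
  have hn' : (3 : ℝ) ≤ n := by exact_mod_cast hn
  have h1 := hsupp _ (right_ne_zero_of_mul hx)
  have hx0 : 0 < ‖x‖ := by
    refine (norm_nonneg x).lt_of_ne' fun h0 => left_ne_zero_of_mul hx ?_
    rw [h0, zero_rpow]
    linarith
  constructor
  · rw [← Real.le_log_iff_exp_le hx0]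
    linarith [h1.2]
  · rw [← Real.log_le_iff_le_exp hx0]
    linarith [h1.1]

theorem tsupport_emdenFowler_subset (hn : 3 ≤ n) (hsupp : ∀ t, V t ≠ 0 → t ∈ Set.Icc c d) :
    tsupport (emdenFowler n a V) ⊆ Metric.closedBall 0 (Real.exp (a - c)) :=
  closure_minimal (fun _ hx => mem_closedBall_zero_iff.2
    (norm_mem_Icc_of_emdenFowler_ne_zero hn hsupp hx).2) Metric.isClosed_closedBall

theorem contDiff_emdenFowler (hn : 3 ≤ n) (hsupp : ∀ t, V t ≠ 0 → t ∈ Set.Icc c d)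
    (hV : ContDiff ℝ (⊤ : ℕ∞) V) : ContDiff ℝ (⊤ : ℕ∞) (emdenFowler n a V) := by
  rw [contDiff_iff_contDiffAt]
  intro x
  rcases eq_or_ne x 0 with rfl | hx
  · refine (contDiffAt_const (c := (0 : ℝ))).congr_of_eventuallyEq ?_
    filter_upwards [Metric.ball_mem_nhds _ (Real.exp_pos (a - d))] with y hy
    by_contra h
    exact absurd (norm_mem_Icc_of_emdenFowler_ne_zero hn hsupp h).1
      (not_le.2 (mem_ball_zero_iff.1 hy))
  · have h1 : ContDiffAt ℝ (⊤ : ℕ∞) (fun y : EuclideanSpace ℝ (Fin n) => ‖y‖) x :=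
      contDiffAt_norm ℝ hx
    have h2 : ‖x‖ ≠ 0 := norm_ne_zero_iff.2 hx
    exact (h1.rpow_const_of_ne h2).mul
      (hV.contDiffAt.comp x (contDiffAt_const.sub (h1.log h2)))

theorem norm_gradient_emdenFowler_sq (hn : 3 ≤ n) (hV : ContDiff ℝ (⊤ : ℕ∞) V)
    {x : EuclideanSpace ℝ (Fin n)} (hx : x ≠ 0) :
    ‖gradient (emdenFowler n a V) x‖ ^ 2 = (‖x‖ ^ (-((n : ℝ) / 2)) *
      (((n : ℝ) - 2) / 2 * V (a - Real.log ‖x‖) + deriv V (a - Real.log ‖x‖))) ^ 2 := by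
  have : Nonempty (Fin n) := ⟨⟨0, by omega⟩⟩
  have hr : 0 < ‖x‖ := norm_pos_iff.2 hx
  have hN : DifferentiableAt ℝ (fun y : EuclideanSpace ℝ (Fin n) => ‖y‖) x :=
    (contDiffAt_norm ℝ hx (n := 1)).differentiableAt (by simp)
  have hF : HasDerivAt (fun r : ℝ => r ^ (-(((n : ℝ) - 2) / 2)) * V (a - Real.log r))
      (-(‖x‖ ^ (-((n : ℝ) / 2)) *
      (((n : ℝ) - 2) / 2 * V (a - Real.log ‖x‖) + deriv V (a - Real.log ‖x‖)))) ‖x‖ := by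
    have h1 := (Real.hasDerivAt_rpow_const (p := -(((n : ℝ) - 2) / 2)) (Or.inl hr.ne')).mul
      (((hV.differentiable (by simp) (a - Real.log ‖x‖)).hasDerivAt).comp ‖x‖
        ((Real.hasDerivAt_log hr.ne').const_sub a))
    refine h1.congr_deriv ?_
    rw [show -(((n : ℝ) - 2) / 2) - 1 = -((n : ℝ) / 2) by ring,
      show -(((n : ℝ) - 2) / 2) = -((n : ℝ) / 2) + 1 by ring, rpow_add_one hr.ne']
    simp only [Function.comp]
    field_simp
    ring
  have h2 : fderiv ℝ (emdenFowler n a V) x = _ :=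
    (hF.comp_hasFDerivAt x hN.hasFDerivAt).fderiv
  rw [gradient, LinearIsometryEquiv.norm_map, h2, norm_smul, norm_fderiv_norm hN, mul_one,
    norm_neg, Real.norm_eq_abs, sq_abs]

theorem integral_emdenFowler (hn : 3 ≤ n) (hac : a < c)
    (hsupp : ∀ t, V t ≠ 0 → t ∈ Set.Icc c d) (hV : ContDiff ℝ (⊤ : ℕ∞) V) :
    (∫ x in Metric.ball (0 : EuclideanSpace ℝ (Fin n)) 1, ‖gradient (emdenFowler n a V) x‖ ^ 2) -
      (((n : ℝ) - 2) / 2) ^ 2 *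
        (∫ x in Metric.ball (0 : EuclideanSpace ℝ (Fin n)) 1, emdenFowler n a V x ^ 2 / ‖x‖ ^ 2)
      = (n * volume.real (Metric.ball (0 : EuclideanSpace ℝ (Fin n)) 1)) *
        ∫ t, deriv V t ^ 2 := by
  have : Nonempty (Fin n) := ⟨⟨0, by omega⟩⟩
  have hlt : Real.exp (a - c) < 1 := by rw [Real.exp_lt_one_iff]; linarith
  have hcV : HasCompactSupport V :=
    HasCompactSupport.intro isCompact_Icc fun t ht => by_contra fun h => ht (hsupp t h)
  have hout : ∀ x ∉ Metric.ball (0 : EuclideanSpace ℝ (Fin n)) 1,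
      x ∉ tsupport (emdenFowler n a V) := fun x hx h => hx
    (Metric.closedBall_subset_ball hlt (tsupport_emdenFowler_subset hn hsupp h))
  have e1 : ∀ t : ℝ, Real.exp (a - t) ^ n * (Real.exp (a - t) ^ (-((n : ℝ) / 2))) ^ 2 = 1 := by
    intro t
    rw [← rpow_natCast, ← rpow_natCast, ← rpow_mul (Real.exp_pos _).le,
      ← rpow_add (Real.exp_pos _)]
    push_cast
    rw [show (n : ℝ) + -((n : ℝ) / 2) * 2 = 0 by ring, rpow_zero]
  rw [setIntegral_eq_integral_of_forall_compl_eq_zero,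
    setIntegral_eq_integral_of_forall_compl_eq_zero]
  · have g1 : ∫ x, ‖gradient (emdenFowler n a V) x‖ ^ 2 = ∫ x : EuclideanSpace ℝ (Fin n),
        (fun r : ℝ => (r ^ (-((n : ℝ) / 2)) *
          (((n : ℝ) - 2) / 2 * V (a - Real.log r) + deriv V (a - Real.log r))) ^ 2) ‖x‖ := by
      refine integral_congr_ae ?_
      have : ∀ᵐ x : EuclideanSpace ℝ (Fin n), x ≠ 0 :=
        compl_mem_ae_iff.2 (measure_singleton 0)
      filter_upwards [this] with x hx using norm_gradient_emdenFowler_sq hn hV hx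
    have g2 : ∫ x, emdenFowler n a V x ^ 2 / ‖x‖ ^ 2 = ∫ x : EuclideanSpace ℝ (Fin n),
        (fun r : ℝ => (r ^ (-((n : ℝ) / 2)) * V (a - Real.log r)) ^ 2) ‖x‖ := by
      refine integral_congr_ae ?_
      have : ∀ᵐ x : EuclideanSpace ℝ (Fin n), x ≠ 0 :=
        compl_mem_ae_iff.2 (measure_singleton 0)
      filter_upwards [this] with x hx
      have hr : 0 < ‖x‖ := norm_pos_iff.2 hx
      simp only [emdenFowler]
      rw [show -(((n : ℝ) - 2) / 2) = -((n : ℝ) / 2) + 1 by ring, rpow_add_one hr.ne']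
      field_simp
    rw [g1, g2, integral_fun_norm_eq_integral_exp (n := n) (by omega) a fun r : ℝ =>
        (r ^ (-((n : ℝ) / 2)) *
          (((n : ℝ) - 2) / 2 * V (a - Real.log r) + deriv V (a - Real.log r))) ^ 2,
      integral_fun_norm_eq_integral_exp (n := n) (by omega) a fun r : ℝ =>
        (r ^ (-((n : ℝ) / 2)) * V (a - Real.log r)) ^ 2]
    simp only [Real.log_exp, sub_sub_cancel, mul_pow, ← mul_assoc, e1, one_mul]
    rw [integral_sq_add_deriv hV hcV]
    ring
  · intro x hx
    rw [image_eq_zero_of_notMem_tsupport (hout x hx)]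
    simp
  · intro x hx
    rw [gradient, fderiv_of_notMem_tsupport ℝ (hout x hx)]
    simp

theorem integral_X1_emdenFowler (hn : 3 ≤ n) (hac : a < c) (hc : 0 < c)
    (hsupp : ∀ t, V t ≠ 0 → t ∈ Set.Icc c d) (q : ℝ) :
    ∫ x in Metric.ball (0 : EuclideanSpace ℝ (Fin n)) 1,
        ((a - Real.log ‖x‖)⁻¹) ^ q * |emdenFowler n a V x| ^ (2 * (n : ℝ) / ((n : ℝ) - 2))
      = (n * volume.real (Metric.ball (0 : EuclideanSpace ℝ (Fin n)) 1)) *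
        ∫ t in Set.Ioi (0 : ℝ), t ^ (-q) * |V t| ^ (2 * (n : ℝ) / ((n : ℝ) - 2)) := by
  have hn' : (3 : ℝ) ≤ n := by exact_mod_cast hn
  have hp : 2 * (n : ℝ) / ((n : ℝ) - 2) ≠ 0 := by
    have : 0 < 2 * (n : ℝ) / ((n : ℝ) - 2) := div_pos (by linarith) (by linarith)
    exact this.ne'
  have hlt : Real.exp (a - c) < 1 := by rw [Real.exp_lt_one_iff]; linarith
  rw [setIntegral_eq_integral_of_forall_compl_eq_zero,
    setIntegral_eq_integral_of_forall_compl_eq_zero]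
  · have := integral_fun_norm_eq_integral_exp (n := n) (by omega) a (fun r =>
      ((a - Real.log r)⁻¹) ^ q * |r ^ (-(((n : ℝ) - 2) / 2)) * V (a - Real.log r)| ^
        (2 * (n : ℝ) / ((n : ℝ) - 2)))
    refine this.trans ?_
    congr 1
    refine integral_congr_ae (.of_forall fun t => ?_)
    simp only [Real.log_exp, sub_sub_cancel]
    by_cases ht : V t = 0
    · simp [ht, zero_rpow hp]
    have ht0 : 0 < t := hc.trans_le (hsupp t ht).1
    have he := Real.exp_pos (a - t)
    rw [abs_mul, abs_of_pos (rpow_pos_of_pos he _), mul_rpow (by positivity) (abs_nonneg _),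
      ← rpow_mul he.le, inv_rpow ht0.le, ← rpow_neg ht0.le,
      show -(((n : ℝ) - 2) / 2) * (2 * (n : ℝ) / ((n : ℝ) - 2)) = -(n : ℝ) by
        have : (n : ℝ) - 2 ≠ 0 := by linarith
        field_simp, rpow_neg he.le, rpow_natCast]
    field_simp
  · intro t ht
    have : V t = 0 := by
      by_contra h
      exact ht (hc.trans_le (hsupp t h).1)
    simp [this, zero_rpow hp]
  · intro x hx
    have : emdenFowler n a V x = 0 := by
      by_contra h
      refine hx (mem_ball_zero_iff.2 ?_)
      exact (norm_mem_Icc_of_emdenFowler_ne_zero hn hsupp h).2.trans_lt hlt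
    simp [this, zero_rpow hp]

end

open ProbabilityTheory in
theorem bliss_constant_eq {n : ℕ} (hn : 3 ≤ n) {α ω : ℝ} (hα : α = 2 / ((n : ℝ) - 2))
    (hω : ω = 2 * π ^ ((n : ℝ) / 2) / Real.Gamma ((n : ℝ) / 2)) :
    ω * (α⁻¹ * beta ((0 + 1) / α) (n - (0 + 1) / α)) =
      ((n : ℝ) - 2) ^ (-(2 * ((n : ℝ) - 1)) / (n : ℝ)) * sobolevConst n *
        (ω * (α⁻¹ * beta ((α + 1) / α) (n - (α + 1) / α))) ^ (((n : ℝ) - 2) / (n : ℝ)) := by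
  have hn' : (3 : ℝ) ≤ n := by exact_mod_cast hn
  have h2 : 0 < (n : ℝ) - 2 := by linarith
  have hn0 : (0 : ℝ) < n := by linarith
  have e1 : (0 + 1) / α = (n : ℝ) / 2 - 1 := by rw [hα]; field_simp; ring
  have e2 : (α + 1) / α = (n : ℝ) / 2 := by rw [hα]; field_simp; ring
  have e3 : α⁻¹ = (n : ℝ) / 2 - 1 := by rw [hα]; field_simp
  have hG : 0 < Real.Gamma ((n : ℝ) / 2) := Real.Gamma_pos_of_pos (by linarith)
  have hGn : 0 < Real.Gamma (n : ℝ) := Real.Gamma_pos_of_pos (by linarith)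
  have g1 : ((n : ℝ) / 2 - 1) * Real.Gamma ((n : ℝ) / 2 - 1) = Real.Gamma ((n : ℝ) / 2) := by
    rw [← Real.Gamma_add_one (by linarith), sub_add_cancel]
  have g2 : Real.Gamma ((n : ℝ) - ((n : ℝ) / 2 - 1)) = n / 2 * Real.Gamma ((n : ℝ) / 2) := by
    rw [← Real.Gamma_add_one (by linarith)]
    congr 1
    ring
  set R := Real.Gamma ((n : ℝ) / 2) / Real.Gamma (n : ℝ) with hR
  have hR0 : 0 < R := by positivity
  have hA : ω * (α⁻¹ * beta ((0 + 1) / α) (n - (0 + 1) / α)) = π ^ ((n : ℝ) / 2) * n * R := by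
    rw [hω, e1, e3, beta, g2, add_sub_cancel, hR]
    calc _ = 2 * π ^ ((n : ℝ) / 2) / Real.Gamma ((n : ℝ) / 2) *
          (((n : ℝ) / 2 - 1) * Real.Gamma ((n : ℝ) / 2 - 1)) *
            (n / 2 * Real.Gamma ((n : ℝ) / 2)) / Real.Gamma n := by ring
      _ = _ := by
        rw [g1]
        field_simp
  have hB : ω * (α⁻¹ * beta ((α + 1) / α) (n - (α + 1) / α))
      = π ^ ((n : ℝ) / 2) * ((n : ℝ) - 2) * R := by
    rw [hω, e2, e3, beta, add_sub_cancel, sub_half, hR]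
    field_simp
  rw [hA, hB, sobolevConst, ← hR, mul_rpow (by positivity) hR0.le,
    mul_rpow (by positivity) h2.le, ← rpow_mul pi_pos.le]
  have p1 : π ^ ((n : ℝ) / 2) = π * π ^ ((n : ℝ) / 2 * (((n : ℝ) - 2) / n)) := by
    nth_rw 2 [← rpow_one π]
    rw [← rpow_add pi_pos]
    congr 1
    field_simp
    ring
  have p2 : R = R ^ (2 / (n : ℝ)) * R ^ (((n : ℝ) - 2) / n) := by
    rw [← rpow_add hR0, show 2 / (n : ℝ) + ((n : ℝ) - 2) / n = 1 by field_simp; ring, rpow_one]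
  have p3 : ((n : ℝ) - 2) ^ (-(2 * ((n : ℝ) - 1)) / (n : ℝ)) * ((n : ℝ) - 2) *
      ((n : ℝ) - 2) ^ (((n : ℝ) - 2) / (n : ℝ)) = 1 := by
    rw [← rpow_add_one h2.ne', ← rpow_add h2,
      show -(2 * ((n : ℝ) - 1)) / (n : ℝ) + 1 + ((n : ℝ) - 2) / n = 0 by field_simp; ring, rpow_zero]
  calc π ^ ((n : ℝ) / 2) * n * R
      = (π * π ^ ((n : ℝ) / 2 * (((n : ℝ) - 2) / n))) * n *
          (R ^ (2 / (n : ℝ)) * R ^ (((n : ℝ) - 2) / n)) *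
          (((n : ℝ) - 2) ^ (-(2 * ((n : ℝ) - 1)) / (n : ℝ)) * ((n : ℝ) - 2) *
            ((n : ℝ) - 2) ^ (((n : ℝ) - 2) / (n : ℝ))) := by rw [← p1, ← p2, p3, mul_one]
    _ = _ := by ring

theorem setIntegral_Ioi_deriv_comp_mul_left_sq {V : ℝ → ℝ} {b : ℝ} (hb : 0 < b) :
    ∫ t in Set.Ioi (0 : ℝ), deriv (fun s => V (b * s)) t ^ 2
      = b * ∫ t in Set.Ioi (0 : ℝ), deriv V t ^ 2 := by
  have h := integral_comp_mul_left_Ioi (fun t => deriv V t ^ 2) 0 hb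
  simp only [mul_zero, smul_eq_mul] at h
  simp_rw [deriv_comp_mul_left, smul_eq_mul, mul_pow]
  rw [integral_const_mul, h]
  field_simp

theorem setIntegral_Ioi_rpow_neg_mul_comp_mul_left {V : ℝ → ℝ} {b p q : ℝ} (hb : 0 < b) :
    ∫ t in Set.Ioi (0 : ℝ), t ^ (-q) * |V (b * t)| ^ p
      = b ^ (q - 1) * ∫ t in Set.Ioi (0 : ℝ), t ^ (-q) * |V t| ^ p := by
  have h := integral_comp_mul_left_Ioi (fun t => t ^ (-q) * |V t| ^ p) 0 hb
  simp only [mul_zero, smul_eq_mul] at h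
  rw [rpow_sub_one hb.ne', div_eq_mul_inv, mul_assoc, ← h, ← integral_const_mul]
  refine setIntegral_congr_fun measurableSet_Ioi fun t ht => ?_
  have ht' : (0 : ℝ) < t := ht
  rw [mul_rpow hb.le ht'.le, rpow_neg hb.le]
  have := rpow_pos_of_pos hb q
  field_simp

open Filter Topology in
/-- Smooth compactly supported functions on a half-line `(a, ∞)` come arbitrarily close to the
best constant in the Bliss inequality. -/
theorem exists_bliss_quotient_lt {n : ℕ} (hn : 3 ≤ n) {ω : ℝ}
    (hω : ω = 2 * π ^ ((n : ℝ) / 2) / Real.Gamma ((n : ℝ) / 2)) {a C : ℝ} (ha : 0 < a)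
    (hC : ((n : ℝ) - 2) ^ (-(2 * ((n : ℝ) - 1)) / (n : ℝ)) * sobolevConst n < C) :
    ∃ (V : ℝ → ℝ) (c d : ℝ), a < c ∧ ContDiff ℝ (⊤ : ℕ∞) V ∧ (∀ t, V t ≠ 0 → t ∈ Set.Icc c d) ∧
      ω * (∫ t in Set.Ioi (0 : ℝ), deriv V t ^ 2) <
        C * (ω * ∫ t in Set.Ioi (0 : ℝ), t ^ (-(2 * ((n : ℝ) - 1) / ((n : ℝ) - 2))) *
          |V t| ^ (2 * (n : ℝ) / ((n : ℝ) - 2))) ^ (((n : ℝ) - 2) / (n : ℝ)) := by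
  have hn' : (3 : ℝ) ≤ n := by exact_mod_cast hn
  have h2 : 0 < (n : ℝ) - 2 := by linarith
  obtain ⟨α, hα⟩ : ∃ α, α = 2 / ((n : ℝ) - 2) := ⟨_, rfl⟩
  have hα0 : 0 < α := by rw [hα]; positivity
  have hω0 : 0 < ω := by
    have := Real.Gamma_pos_of_pos (show 0 < (n : ℝ) / 2 by linarith)
    rw [hω]
    positivity
  have hq : 2 * ((n : ℝ) - 1) / ((n : ℝ) - 2) = 2 + α := by rw [hα]; field_simp; ring
  have hp : 2 * (n : ℝ) / ((n : ℝ) - 2) = 2 + 2 * α := by rw [hα]; field_simp; ring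
  have hm : 2 / α + 2 = n := by rw [hα]; field_simp; ring
  have hα1 : 1 / α = (n : ℝ) / 2 - 1 := by rw [hα]; field_simp
  have hα2 : (α + 1) / α = (n : ℝ) / 2 := by rw [hα]; field_simp; ring
  obtain ⟨χ, M, hs, h0, hnn, hle, hχ, hM⟩ := exists_smooth_cutoff
  have l1 := tendsto_integral_deriv_blissCutoff_sq hα0 hs hχ h0 hnn hle hM
  have l2 := tendsto_integral_blissCutoff_rpow hα0 hs hχ h0 hnn hle
  rw [hm, setIntegral_Ioi_rpow_mul_one_add_rpow_rpow hα0 (by positivity)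
    (by rw [zero_add, hα1]; linarith)] at l1
  rw [hm, setIntegral_Ioi_rpow_mul_one_add_rpow_rpow hα0 (by positivity)
    (by rw [hα2]; linarith)] at l2
  have hB : 0 < ω * (α⁻¹ * ProbabilityTheory.beta ((α + 1) / α) (n - (α + 1) / α)) := by
    have := ProbabilityTheory.beta_pos (α := (α + 1) / α) (β := n - (α + 1) / α) (by positivity)
      (by rw [hα2]; linarith)
    positivity
  have hlt : ω * (α⁻¹ * ProbabilityTheory.beta ((0 + 1) / α) (n - (0 + 1) / α)) <
      C * (ω * (α⁻¹ * ProbabilityTheory.beta ((α + 1) / α) (n - (α + 1) / α))) ^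
        (((n : ℝ) - 2) / (n : ℝ)) := by
    rw [bliss_constant_eq hn hα hω]
    exact mul_lt_mul_of_pos_right hC (rpow_pos_of_pos hB _)
  obtain ⟨k, hk⟩ := ((l1.const_mul ω).eventually_lt
    (((l2.const_mul ω).rpow_const (Or.inl hB.ne')).const_mul C) hlt).exists
  set κ := 1 / ((k : ℝ) + 1)
  have hκ : 0 < κ := by positivity
  set b := Real.exp (-(2 / κ)) / (a + 1) with hb
  have hb0 : 0 < b := by positivity
  refine ⟨fun t => blissCutoff α χ κ (b * t), a + 1, Real.exp (2 / κ) / b, by linarith,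
    (contDiff_blissCutoff hκ hχ hs).comp (contDiff_const.mul contDiff_id), fun t ht => ?_, ?_⟩
  · have h := mem_Icc_of_blissCutoff_ne_zero hκ hχ ht
    refine ⟨?_, by rw [le_div_iff₀ hb0]; linarith [h.2]⟩
    have h1 := h.1
    rw [show Real.exp (-(2 / κ)) = b * (a + 1) by rw [hb]; field_simp] at h1
    exact le_of_mul_le_mul_left h1 hb0
  · have hnn : 0 ≤ ∫ t in Set.Ioi (0 : ℝ), t ^ (-(2 + α)) * |blissCutoff α χ κ t| ^ (2 + 2 * α) :=
      setIntegral_nonneg measurableSet_Ioi fun t ht =>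
        mul_nonneg (rpow_nonneg (le_of_lt ht) _) (by positivity)
    rw [hq, hp, setIntegral_Ioi_deriv_comp_mul_left_sq hb0,
      setIntegral_Ioi_rpow_neg_mul_comp_mul_left hb0, mul_left_comm ω, mul_left_comm ω,
      mul_rpow (by positivity) (mul_nonneg hω0.le hnn), ← rpow_mul hb0.le,
      show (2 + α - 1) * (((n : ℝ) - 2) / n) = 1 by rw [hα]; field_simp; ring, rpow_one,
      mul_left_comm C]
    exact mul_lt_mul_of_pos_left hk hb0

theorem stmt2 (n : ℕ) (hn : 3 ≤ n) (a : ℝ) (ha : 1 / ((n : ℝ) - 2) ≤ a)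
    (C : ℝ) (hC : C > ((n : ℝ) - 2) ^ (-(2 * ((n : ℝ) - 1)) / (n : ℝ)) * sobolevConst n) :
    ∃ u : EuclideanSpace ℝ (Fin n) → ℝ, u ≠ 0 ∧ ContDiff ℝ (⊤ : ℕ∞) u ∧ HasCompactSupport u ∧
      tsupport u ⊆ Metric.ball (0 : EuclideanSpace ℝ (Fin n)) 1 ∧
      (∫ x in Metric.ball (0 : EuclideanSpace ℝ (Fin n)) 1, ‖gradient u x‖ ^ 2) - (((n : ℝ) - 2) / 2) ^ 2 *
          (∫ x in Metric.ball (0 : EuclideanSpace ℝ (Fin n)) 1, u x ^ 2 / ‖x‖ ^ 2)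
        < C *
          (∫ x in Metric.ball (0 : EuclideanSpace ℝ (Fin n)) 1,
              (X1 a ‖x‖) ^ (2 * ((n : ℝ) - 1) / ((n : ℝ) - 2)) *
                |u x| ^ (2 * (n : ℝ) / ((n : ℝ) - 2)))
            ^ (((n : ℝ) - 2) / (n : ℝ)) := by
  have hn' : (3 : ℝ) ≤ n := by exact_mod_cast hn
  have h2 : 0 < (n : ℝ) - 2 := by linarith
  have ha0 : 0 < a := lt_of_lt_of_le (by positivity) ha
  obtain ⟨V, c, d, hac, hV, hsupp, hlt⟩ :=
    exists_bliss_quotient_lt hn (card_mul_volume_ball (by omega)) ha0 hC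
  have hc : 0 < c := ha0.trans hac
  have hexp : Real.exp (a - c) < 1 := by rw [Real.exp_lt_one_iff]; linarith
  have hts := tsupport_emdenFowler_subset (n := n) (a := a) hn hsupp
  have hderiv : ∫ t in Set.Ioi (0 : ℝ), deriv V t ^ 2 = ∫ t, deriv V t ^ 2 := by
    refine setIntegral_eq_integral_of_forall_compl_eq_zero fun t ht => ?_
    have hVt : tsupport V ⊆ Set.Icc c d := closure_minimal (fun s hs => hsupp s hs) isClosed_Icc
    have : t ∉ tsupport V := fun h => ht (hc.trans_le (hVt h).1)
    rw [← fderiv_apply_one_eq_deriv, fderiv_of_notMem_tsupport ℝ this]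
    simp
  have hmain := hlt
  rw [hderiv, ← integral_emdenFowler hn hac hsupp hV, ← integral_X1_emdenFowler hn hac hc hsupp] at hmain
  refine ⟨emdenFowler n a V, fun h0 => ?_, contDiff_emdenFowler hn hsupp hV,
    HasCompactSupport.of_support_subset_isCompact (isCompact_closedBall 0 (Real.exp (a - c)))
      ((subset_tsupport _).trans hts),
    hts.trans (Metric.closedBall_subset_ball hexp), hmain⟩
  rw [h0] at hmain
  have hp : 2 * (n : ℝ) / ((n : ℝ) - 2) ≠ 0 := (div_pos (by linarith) h2).ne'
  have hr : ((n : ℝ) - 2) / (n : ℝ) ≠ 0 := (div_pos h2 (by linarith)).ne'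
  have hg : ∀ x, gradient (0 : EuclideanSpace ℝ (Fin n) → ℝ) x = 0 := fun x => by
    simp [gradient]
  simp [hg, zero_rpow hp, zero_rpow hr] at hmain
end

section
/- Let n ≥ 3 and let a > 0. Then for every C > a^{2(n-1)/n} S_n there exists a nonzero u ∈ C_c^∞(B_1) such that ∫_{B_1} |∇u|² dx − ((n-2)/2)² ∫_{B_1} u²/|x|² dx < C · ( ∫_{B_1} X_1(a,|x|)^{2(n-1)/(n-2)} |u|^{2n/(n-2)} dx )^{(n-2)/n}. In particular, for 0 < a < 1/(n-2) the constant a^{2(n-1)/n} S_n in the Hardy–Sobolev inequality on B_1 is sharp. -/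
open MeasureTheory Real

open Filter Topology Module

section NormedAddCommGroup

variable {V : Type*} [NormedAddCommGroup V]

/-- The (unnormalised) Aubin–Talenti bubble `(1 + |x|²)^(-(d-2)/2)`. -/
noncomputable def bubble (V : Type*) [NormedAddCommGroup V] (d : ℝ) (x : V) : ℝ :=
  (1 + ‖x‖ ^ 2) ^ (-((d - 2) / 2))

lemma bubble_pos (d : ℝ) (x : V) : 0 < bubble V d x := by
  unfold bubble; positivity

lemma bubble_rpow {d : ℝ} (hd : 2 < d) (x : V) :
    bubble V d x ^ (2 * d / (d - 2)) = (1 + ‖x‖ ^ 2) ^ (-d) := by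
  have : d - 2 ≠ 0 := by linarith
  rw [bubble, ← rpow_mul (by positivity)]
  congr 1
  field_simp

lemma tendsto_bubble_cocompact [ProperSpace V] {d : ℝ} (hd : 2 < d) :
    Tendsto (bubble V d) (cocompact V) (𝓝 0) :=
  (tendsto_rpow_neg_atTop (by linarith : 0 < (d - 2) / 2)).comp
    (tendsto_atTop_add_const_left _ 1
      ((tendsto_pow_atTop two_ne_zero).comp (tendsto_norm_cocompact_atTop (E := V))))

end NormedAddCommGroup

section InnerProductSpace

variable {V : Type*} [NormedAddCommGroup V] [InnerProductSpace ℝ V]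

lemma integrable_one_add_norm_sq_rpow_neg [FiniteDimensional ℝ V] [MeasurableSpace V]
    [BorelSpace V] {s : ℝ} (hs : (finrank ℝ V : ℝ) / 2 < s) :
    Integrable (fun v : V ↦ (1 + ‖v‖ ^ 2) ^ (-s)) := by
  have h := integrable_rpow_neg_one_add_norm_sq (E := V) (μ := volume) (r := 2 * s) (by linarith)
  have hs' : -(2 * s) / 2 = -s := by ring
  rwa [hs'] at h

lemma integral_one_add_norm_sq_rpow_neg [FiniteDimensional ℝ V] [MeasurableSpace V]
    [BorelSpace V] {s : ℝ} (hs : (finrank ℝ V : ℝ) / 2 < s) :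
    ∫ v : V, (1 + ‖v‖ ^ 2) ^ (-s) =
      π ^ ((finrank ℝ V : ℝ) / 2) * Gamma (s - (finrank ℝ V : ℝ) / 2) / Gamma s := by
  have hs0 : 0 < s := lt_of_le_of_lt (by positivity) hs
  let f : V → ℝ → ℝ := fun v t ↦ t ^ (s - 1) * exp (-((1 + ‖v‖ ^ 2) * t))
  have hf (v : V) : ∫ t in Set.Ioi (0 : ℝ), f v t = (1 + ‖v‖ ^ 2) ^ (-s) * Gamma s := by
    rw [integral_rpow_mul_exp_neg_mul_Ioi hs0 (by positivity), one_div,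
      inv_rpow (by positivity), rpow_neg (by positivity)]
  have hint : Integrable (Function.uncurry f) (volume.prod (volume.restrict (Set.Ioi (0 : ℝ)))) := by
    have hmeas : Measurable (Function.uncurry f) := by
      unfold f Function.uncurry
      fun_prop
    rw [integrable_prod_iff hmeas.aestronglyMeasurable]
    refine ⟨ae_of_all _ fun v ↦ ?_, ?_⟩
    · by_contra h
      have h0 := hf v
      rw [integral_undef (show ¬ Integrable (f v) _ from h)] at h0
      have : 0 < (1 + ‖v‖ ^ 2) ^ (-s) * Gamma s :=
        mul_pos (by positivity) (Gamma_pos_of_pos hs0)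
      linarith
    · refine ((integrable_one_add_norm_sq_rpow_neg hs).mul_const (Gamma s)).congr
        (ae_of_all _ fun v ↦ ?_)
      simp only [← hf v]
      refine setIntegral_congr_fun measurableSet_Ioi fun t ht ↦ ?_
      have ht : 0 < t := ht
      simp only [Function.uncurry, f]
      rw [norm_of_nonneg (by positivity)]
  have hswap := integral_integral_swap hint
  simp only [hf, integral_mul_const] at hswap
  rw [eq_div_iff (Gamma_pos_of_pos hs0).ne', hswap]
  have key : ∀ t ∈ Set.Ioi (0 : ℝ), ∫ v : V, f v t =
      π ^ ((finrank ℝ V : ℝ) / 2) * (t ^ ((s - (finrank ℝ V : ℝ) / 2) - 1) * exp (-(1 * t))) := by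
    intro t ht
    have ht : 0 < t := ht
    have : ∀ v : V, f v t = (t ^ (s - 1) * exp (-t)) * exp (-t * ‖v‖ ^ 2) := fun v ↦ by
      simp only [f]
      rw [mul_assoc, ← exp_add]
      ring_nf
    simp_rw [this]
    rw [integral_const_mul, GaussianFourier.integral_rexp_neg_mul_sq_norm ht,
      div_rpow pi_pos.le ht.le, show s - (finrank ℝ V : ℝ) / 2 - 1 = (s - 1) - (finrank ℝ V : ℝ) / 2
      by ring, rpow_sub ht (s - 1), one_mul]
    ring
  rw [setIntegral_congr_fun measurableSet_Ioi key, integral_const_mul,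
    integral_rpow_mul_exp_neg_mul_Ioi (by linarith) one_pos]
  simp

lemma contDiff_bubble (d : ℝ) : ContDiff ℝ (⊤ : ℕ∞) (bubble V d) := by
  unfold bubble
  exact (contDiff_const.add (contDiff_norm_sq ℝ)).rpow_const_of_ne fun x ↦ by positivity

lemma norm_fderiv_bubble_sq (d : ℝ) (x : V) :
    ‖fderiv ℝ (bubble V d) x‖ ^ 2 =
      (d - 2) ^ 2 * ((1 + ‖x‖ ^ 2) ^ (-(d - 1)) - (1 + ‖x‖ ^ 2) ^ (-d)) := by
  have hpos : 0 < 1 + ‖x‖ ^ 2 := by positivity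
  have h : HasFDerivAt (bubble V d) _ x :=
    ((hasStrictFDerivAt_norm_sq x).hasFDerivAt.const_add 1).rpow_const
      (p := -((d - 2) / 2)) (Or.inl hpos.ne')
  rw [h.fderiv, norm_smul, ← Nat.cast_smul_eq_nsmul ℝ, norm_smul, innerSL_apply_norm, norm_eq_abs,
    mul_pow, sq_abs, mul_pow, mul_pow, ← rpow_natCast (_ ^ (_ : ℝ)) 2, ← rpow_mul hpos.le]
  rw [show (-((d - 2) / 2) - 1) * ((2 : ℕ) : ℝ) = -d by push_cast; ring,
    show -(d - 1) = -d + 1 by ring, rpow_add_one hpos.ne']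
  norm_num
  ring

end InnerProductSpace

/-- A smooth truncation of the identity on `ℝ`: it vanishes on `(-∞, 1]` and is the identity on
`[2, ∞)`. -/
noncomputable def smoothTrunc (s : ℝ) : ℝ := s * smoothTransition (s - 1)

lemma contDiff_smoothTrunc : ContDiff ℝ (⊤ : ℕ∞) smoothTrunc :=
  contDiff_id.mul (smoothTransition.contDiff.comp (contDiff_id.sub contDiff_const))

lemma smoothTrunc_of_le {s : ℝ} (hs : s ≤ 1) : smoothTrunc s = 0 := by
  simp [smoothTrunc, smoothTransition.zero_of_nonpos (sub_nonpos.2 hs)]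

lemma smoothTrunc_of_ge {s : ℝ} (hs : 2 ≤ s) : smoothTrunc s = s := by
  rw [smoothTrunc, smoothTransition.one_of_one_le (by linarith), mul_one]

lemma abs_smoothTrunc_le {s : ℝ} (hs : 0 ≤ s) : |smoothTrunc s| ≤ s := by
  rw [smoothTrunc, abs_of_nonneg (mul_nonneg hs (smoothTransition.nonneg _))]
  exact mul_le_of_le_one_right hs (smoothTransition.le_one _)

lemma deriv_smoothTrunc_of_lt {s : ℝ} (hs : s < 1) : deriv smoothTrunc s = 0 := by
  have : smoothTrunc =ᶠ[𝓝 s] fun _ ↦ 0 := by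
    filter_upwards [Iio_mem_nhds hs] with t ht using smoothTrunc_of_le (le_of_lt ht)
  rw [this.deriv_eq, deriv_const]

lemma deriv_smoothTrunc_of_gt {s : ℝ} (hs : 2 < s) : deriv smoothTrunc s = 1 := by
  have : smoothTrunc =ᶠ[𝓝 s] id := by
    filter_upwards [Ioi_mem_nhds hs] with t ht using smoothTrunc_of_ge (le_of_lt ht)
  rw [this.deriv_eq, deriv_id]

lemma exists_abs_deriv_smoothTrunc_le : ∃ M, ∀ s, |deriv smoothTrunc s| ≤ M := by
  have hc : Continuous (deriv smoothTrunc) :=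
    contDiff_smoothTrunc.continuous_deriv (by exact_mod_cast le_top)
  obtain ⟨M, hM⟩ := isCompact_Icc.exists_bound_of_continuousOn (hc.continuousOn (s := Set.Icc 1 2))
  refine ⟨max M 1, fun s ↦ ?_⟩
  rcases lt_or_ge s 1 with h1 | h1
  · simp [deriv_smoothTrunc_of_lt h1]
  rcases lt_or_ge 2 s with h2 | h2
  · simp [deriv_smoothTrunc_of_gt h2]
  · exact (hM s ⟨h1, h2⟩).trans (le_max_left _ _)

section EuclideanSpace

variable {n : ℕ}

lemma sobolevConst_pos (hn : 3 ≤ n) : 0 < sobolevConst n := by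
  have hn' : (3 : ℝ) ≤ n := by exact_mod_cast hn
  have h1 : 0 < Gamma ((n : ℝ) / 2) := Gamma_pos_of_pos (by linarith)
  have h2 : 0 < Gamma (n : ℝ) := Gamma_pos_of_pos (by linarith)
  have h3 : 0 < (n : ℝ) - 2 := by linarith
  unfold sobolevConst
  positivity

lemma integrable_norm_fderiv_bubble_sq (hn : 3 ≤ n) :
    Integrable (fun x ↦ ‖fderiv ℝ (bubble (EuclideanSpace ℝ (Fin n)) n) x‖ ^ 2) := by
  have hn' : (3 : ℝ) ≤ n := by exact_mod_cast hn
  simp_rw [norm_fderiv_bubble_sq]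
  refine Integrable.const_mul (Integrable.sub ?_ ?_) _ <;>
  · apply integrable_one_add_norm_sq_rpow_neg
    rw [finrank_euclideanSpace_fin]
    linarith

lemma integral_norm_fderiv_bubble_sq (hn : 3 ≤ n) :
    ∫ x, ‖fderiv ℝ (bubble (EuclideanSpace ℝ (Fin n)) n) x‖ ^ 2 =
      sobolevConst n * (∫ x, |bubble (EuclideanSpace ℝ (Fin n)) n x| ^ (2 * (n : ℝ) / (n - 2)))
        ^ (((n : ℝ) - 2) / n) := by
  have hn' : (3 : ℝ) ≤ n := by exact_mod_cast hn
  have h1 : (finrank ℝ (EuclideanSpace ℝ (Fin n)) : ℝ) / 2 < n - 1 := by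
    rw [finrank_euclideanSpace_fin]; linarith
  have h2 : (finrank ℝ (EuclideanSpace ℝ (Fin n)) : ℝ) / 2 < n := by
    rw [finrank_euclideanSpace_fin]; linarith
  simp_rw [norm_fderiv_bubble_sq, abs_of_pos (bubble_pos _ _),
    bubble_rpow (show (2 : ℝ) < n by linarith)]
  rw [integral_const_mul, integral_sub (integrable_one_add_norm_sq_rpow_neg h1)
    (integrable_one_add_norm_sq_rpow_neg h2), integral_one_add_norm_sq_rpow_neg h1,
    integral_one_add_norm_sq_rpow_neg h2, finrank_euclideanSpace_fin, sobolevConst]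
  have g1 : Gamma (n : ℝ) = (n - 1) * Gamma ((n : ℝ) - 1) := by
    rw [← Gamma_add_one (by linarith)]; ring_nf
  have g2 : Gamma ((n : ℝ) / 2) = (n / 2 - 1) * Gamma ((n : ℝ) - 1 - n / 2) := by
    rw [show (n : ℝ) - 1 - n / 2 = n / 2 - 1 by ring, ← Gamma_add_one (by linarith)]; ring_nf
  have hG : 0 < Gamma ((n : ℝ) / 2) := Gamma_pos_of_pos (by linarith)
  have hG' : 0 < Gamma (n : ℝ) := Gamma_pos_of_pos (by linarith)
  have g1' : Gamma ((n : ℝ) - 1) = Gamma n / (n - 1) := by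
    rw [g1]; field_simp [show (n : ℝ) - 1 ≠ 0 by linarith]
  have g2' : Gamma ((n : ℝ) - 1 - n / 2) = Gamma (n / 2) / (n / 2 - 1) := by
    rw [eq_div_iff (by linarith), g2, mul_comm]
  rw [g1', g2', show (n : ℝ) - n / 2 = n / 2 by ring, mul_div_assoc (π ^ _) (Gamma _) (Gamma _)]
  set P := π ^ ((n : ℝ) / 2) with hP
  set Q := Gamma ((n : ℝ) / 2) / Gamma (n : ℝ) with hQ
  have hQ0 : 0 < Q := by positivity
  have hP0 : 0 < P := by positivity
  have e1 : π = P ^ (2 / (n : ℝ)) := by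
    rw [hP, ← rpow_mul pi_pos.le]
    rw [show (n : ℝ) / 2 * (2 / n) = 1 by field_simp, rpow_one]
  have e2 : (P * Q) ^ (2 / (n : ℝ)) * (P * Q) ^ (((n : ℝ) - 2) / n) = P * Q := by
    rw [← rpow_add (by positivity), show 2 / (n : ℝ) + (n - 2) / n = 1 by field_simp; ring, rpow_one]
  have e3 : π * n * (n - 2) * Q ^ (2 / (n : ℝ)) * (P * Q) ^ (((n : ℝ) - 2) / n)
      = n * (n - 2) * (P * Q) := by
    rw [mul_rpow hP0.le hQ0.le (z := 2 / (n : ℝ)), ← e1] at e2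
    linear_combination (n : ℝ) * (n - 2) * e2
  rw [e3, hQ]
  have m1 : (n : ℝ) - 1 ≠ 0 := by linarith
  have m2 : (n : ℝ) - 2 ≠ 0 := by linarith
  have m3 : (n : ℝ) / 2 - 1 ≠ 0 := by linarith
  field_simp
  ring

/-- The Sobolev constant is optimal among smooth compactly supported functions. -/
lemma exists_contDiff_sobolev_quotient_lt (hn : 3 ≤ n) {K : ℝ} (hK : sobolevConst n < K) :
    ∃ φ : EuclideanSpace ℝ (Fin n) → ℝ, ContDiff ℝ (⊤ : ℕ∞) φ ∧ HasCompactSupport φ ∧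
      ∫ x, ‖fderiv ℝ φ x‖ ^ 2 <
        K * (∫ x, |φ x| ^ (2 * (n : ℝ) / (n - 2))) ^ (((n : ℝ) - 2) / n) := by
  have hn' : (3 : ℝ) ≤ n := by exact_mod_cast hn
  have hn2 : (0 : ℝ) < n - 2 := by linarith
  set U := bubble (EuclideanSpace ℝ (Fin n)) n with hU
  have hUc : ContDiff ℝ (⊤ : ℕ∞) U := contDiff_bubble _
  have hUpos : ∀ x, 0 < U x := bubble_pos _
  have hUint : Integrable (fun x ↦ U x ^ (2 * (n : ℝ) / (n - 2))) := by
    simp_rw [hU, bubble_rpow (show (2 : ℝ) < n by linarith)]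
    apply integrable_one_add_norm_sq_rpow_neg
    rw [finrank_euclideanSpace_fin]
    linarith
  obtain ⟨M, hM⟩ := exists_abs_deriv_smoothTrunc_le
  let φ : ℕ → EuclideanSpace ℝ (Fin n) → ℝ := fun k x ↦ (k : ℝ)⁻¹ * smoothTrunc (k * U x)
  have hφc (k) : ContDiff ℝ (⊤ : ℕ∞) (φ k) :=
    contDiff_const.mul (contDiff_smoothTrunc.comp (contDiff_const.mul hUc))
  have hφs (k) : HasCompactSupport (φ k) := by
    rw [hasCompactSupport_iff_eventuallyEq, coclosedCompact_eq_cocompact]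
    have h := (tendsto_bubble_cocompact (V := EuclideanSpace ℝ (Fin n))
      (show (2 : ℝ) < n by linarith)).const_mul (k : ℝ)
    rw [mul_zero] at h
    filter_upwards [h.eventually (Iio_mem_nhds one_pos)] with x hx
    simp only [φ]
    rw [smoothTrunc_of_le (le_of_lt hx)]
    simp
  have hφd (k : ℕ) (hk : 0 < k) (x) : ‖fderiv ℝ (φ k) x‖ ^ 2 =
      (deriv smoothTrunc (k * U x)) ^ 2 * ‖fderiv ℝ U x‖ ^ 2 := by
    have hk' : (k : ℝ) ≠ 0 := by positivity
    have h1 : HasFDerivAt (fun x ↦ (k : ℝ) * U x) ((k : ℝ) • fderiv ℝ U x) x :=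
      ((hUc.differentiable (by simp)) x).hasFDerivAt.const_mul _
    have h2 : HasDerivAt smoothTrunc (deriv smoothTrunc (k * U x)) (k * U x) :=
      ((contDiff_smoothTrunc.differentiable (by simp)) _).hasDerivAt
    have h3 := h2.comp_hasFDerivAt x h1
    have h4 : HasFDerivAt (φ k) _ x := h3.const_mul (k : ℝ)⁻¹
    rw [h4.fderiv, smul_comm, inv_smul_smul₀ hk', norm_smul, mul_pow, norm_eq_abs, sq_abs]
  have hlarge (x) : ∀ᶠ k : ℕ in atTop, 0 < k ∧ 2 < k * U x :=
    (eventually_gt_atTop 0).and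
      ((tendsto_natCast_atTop_atTop.atTop_mul_const (hUpos x)).eventually_gt_atTop 2)
  have hA : Tendsto (fun k ↦ ∫ x, ‖fderiv ℝ (φ k) x‖ ^ 2) atTop (𝓝 (∫ x, ‖fderiv ℝ U x‖ ^ 2)) := by
    refine tendsto_integral_filter_of_dominated_convergence
      (fun x ↦ M ^ 2 * ‖fderiv ℝ U x‖ ^ 2) (.of_forall fun k ↦ ?_) ?_
      ((integrable_norm_fderiv_bubble_sq hn).const_mul _) (ae_of_all _ fun x ↦ ?_)
    · exact (((hφc k).continuous_fderiv (by simp)).norm.pow 2).aestronglyMeasurable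
    · filter_upwards [eventually_gt_atTop 0] with k hk
      refine ae_of_all _ fun x ↦ ?_
      rw [norm_of_nonneg (by positivity), hφd k hk]
      gcongr ?_ * _
      exact sq_le_sq' (abs_le.1 (hM _)).1 (abs_le.1 (hM _)).2
    · refine tendsto_const_nhds.congr' ?_
      filter_upwards [hlarge x] with k hk
      rw [hφd k hk.1, deriv_smoothTrunc_of_gt hk.2]
      simp
  have hB : Tendsto (fun k ↦ ∫ x, |φ k x| ^ (2 * (n : ℝ) / (n - 2))) atTop
      (𝓝 (∫ x, |U x| ^ (2 * (n : ℝ) / (n - 2)))) := by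
    refine tendsto_integral_filter_of_dominated_convergence
      (fun x ↦ U x ^ (2 * (n : ℝ) / (n - 2))) (.of_forall fun k ↦ ?_) ?_
      hUint (ae_of_all _ fun x ↦ ?_)
    · exact ((hφc k).continuous.abs.rpow_const
        fun _ ↦ Or.inr (by positivity)).aestronglyMeasurable
    · filter_upwards [eventually_gt_atTop 0] with k hk
      refine ae_of_all _ fun x ↦ ?_
      rw [norm_of_nonneg (by positivity)]
      gcongr
      have hk' : (0 : ℝ) < k := by positivity
      rw [abs_mul, abs_of_pos (by positivity), inv_mul_le_iff₀ hk']
      exact abs_smoothTrunc_le (mul_nonneg hk'.le (hUpos x).le)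
    · refine tendsto_const_nhds.congr' ?_
      filter_upwards [hlarge x] with k hk
      have hk' : (k : ℝ) ≠ 0 := by exact_mod_cast hk.1.ne'
      simp only [φ]
      rw [smoothTrunc_of_ge hk.2.le, inv_mul_cancel_left₀ hk']
  have hB' := (hB.rpow_const (p := ((n : ℝ) - 2) / n) (Or.inr (by positivity))).const_mul K
  have hpos : 0 < ∫ x, |U x| ^ (2 * (n : ℝ) / (n - 2)) := by
    simp_rw [abs_of_pos (hUpos _)]
    refine (integral_pos_iff_support_of_nonneg (fun x ↦ by have := hUpos x; positivity) hUint).2 ?_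
    have : Function.support (fun x ↦ U x ^ (2 * (n : ℝ) / (n - 2))) = Set.univ := by
      ext x
      have := hUpos x
      simp only [Function.mem_support, Set.mem_univ, iff_true]
      positivity
    rw [this]
    exact isOpen_univ.measure_pos volume ⟨0, trivial⟩
  have hlt : ∫ x, ‖fderiv ℝ U x‖ ^ 2 <
      K * (∫ x, |U x| ^ (2 * (n : ℝ) / (n - 2))) ^ (((n : ℝ) - 2) / n) := by
    rw [integral_norm_fderiv_bubble_sq hn]
    gcongr
  obtain ⟨k, hk⟩ := (hA.eventually_lt hB' hlt).exists
  exact ⟨φ k, hφc k, hφs k, hk⟩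

/-- The Sobolev constant is still optimal among functions supported in a thin shell near the
boundary of the unit ball. -/
lemma exists_contDiff_sobolev_quotient_lt_of_shell (hn : 3 ≤ n) {K : ℝ} (hK : sobolevConst n < K)
    {ρ : ℝ} (hρ0 : 0 < ρ) (hρ1 : ρ < 1) :
    ∃ u : EuclideanSpace ℝ (Fin n) → ℝ, ContDiff ℝ (⊤ : ℕ∞) u ∧ HasCompactSupport u ∧
      tsupport u ⊆ Metric.ball 0 1 ∧ (∀ x, u x ≠ 0 → ρ ≤ ‖x‖) ∧
      ∫ x, ‖fderiv ℝ u x‖ ^ 2 <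
        K * (∫ x, |u x| ^ (2 * (n : ℝ) / (n - 2))) ^ (((n : ℝ) - 2) / n) := by
  obtain ⟨φ, hφ, hφs, hlt⟩ := exists_contDiff_sobolev_quotient_lt hn hK
  have hn' : (3 : ℝ) ≤ n := by exact_mod_cast hn
  have : Nonempty (Fin n) := ⟨⟨0, by omega⟩⟩
  obtain ⟨R, hR, hRs⟩ := hφs.isCompact.isBounded.subset_ball_lt 0 0
  obtain ⟨l, hl, hlR⟩ : ∃ l : ℝ, 0 < l ∧ 3 * (l * R) = 1 - ρ :=
    ⟨(1 - ρ) / (3 * R), div_pos (by linarith) (by linarith), by field_simp⟩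
  have hlR0 : 0 < l * R := by positivity
  obtain ⟨y, hy⟩ := exists_norm_eq (EuclideanSpace ℝ (Fin n))
    (show 0 ≤ 1 - 2 * (l * R) by linarith)
  let u : EuclideanSpace ℝ (Fin n) → ℝ := fun x ↦ φ (l⁻¹ • (x - y))
  have hsupp (x) (hx : u x ≠ 0) : ‖x - y‖ < l * R := by
    have h := hRs (subset_tsupport φ hx)
    rwa [mem_ball_zero_iff, norm_smul, norm_inv, norm_of_nonneg hl.le, inv_mul_lt_iff₀ hl] at h
  have hsub : Function.support u ⊆ Metric.closedBall y (l * R) := fun x hx ↦ by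
    rw [mem_closedBall_iff_norm]
    exact (hsupp x hx).le
  have hgrad (x) : ‖fderiv ℝ u x‖ ^ 2 = (l⁻¹) ^ 2 * ‖fderiv ℝ φ (l⁻¹ • (x - y))‖ ^ 2 := by
    have h : fderiv ℝ u x = l⁻¹ • fderiv ℝ φ (l⁻¹ • (x - y)) := by
      rw [← fderiv_comp_smul, ← fderiv_comp_sub]
    rw [h, norm_smul, mul_pow, norm_inv, norm_of_nonneg hl.le]
  have hint (F : EuclideanSpace ℝ (Fin n) → ℝ) :
      ∫ x, F (l⁻¹ • (x - y)) = l ^ n * ∫ x, F x := by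
    rw [integral_sub_right_eq_self (fun x ↦ F (l⁻¹ • x)) y,
      Measure.integral_comp_inv_smul_of_nonneg volume F hl.le, finrank_euclideanSpace_fin,
      smul_eq_mul]
  refine ⟨u, hφ.comp ((contDiff_id.sub contDiff_const).const_smul _),
    .of_support_subset_isCompact (isCompact_closedBall _ _) hsub,
    (closure_minimal hsub Metric.isClosed_closedBall).trans fun x hx ↦ ?_, fun x hx ↦ ?_, ?_⟩
  · rw [mem_closedBall_iff_norm] at hx
    rw [mem_ball_zero_iff]
    have := norm_le_norm_add_norm_sub' x y
    linarith
  · have h1 := hsupp x hx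
    have h2 := norm_le_norm_add_norm_sub x y
    linarith
  · simp_rw [hgrad]
    rw [integral_const_mul, hint fun x ↦ ‖fderiv ℝ φ x‖ ^ 2,
      hint fun x ↦ |φ x| ^ (2 * (n : ℝ) / (n - 2)),
      mul_rpow (by positivity) (integral_nonneg fun x ↦ by positivity)]
    have h : (l ^ n) ^ (((n : ℝ) - 2) / n) = (l⁻¹) ^ 2 * l ^ n := by
      rw [← rpow_natCast l n, ← rpow_mul hl.le, mul_div_cancel₀ _ (by linarith), rpow_sub hl]
      norm_num
      field_simp
    rw [h]
    have hc : 0 < (l⁻¹) ^ 2 * l ^ n := by positivity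
    calc _ = (l⁻¹) ^ 2 * l ^ n * ∫ x, ‖fderiv ℝ φ x‖ ^ 2 := by ring
      _ < _ := mul_lt_mul_of_pos_left hlt hc
      _ = _ := by ring

end EuclideanSpace

theorem stmt3 (n : ℕ) (hn : 3 ≤ n) (a : ℝ) (ha0 : 0 < a)
    (C : ℝ) (hC : C > a ^ (2 * ((n : ℝ) - 1) / (n : ℝ)) * sobolevConst n) :
    ∃ u : EuclideanSpace ℝ (Fin n) → ℝ, u ≠ 0 ∧ ContDiff ℝ (⊤ : ℕ∞) u ∧ HasCompactSupport u ∧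
      tsupport u ⊆ Metric.ball (0 : EuclideanSpace ℝ (Fin n)) 1 ∧
      (∫ x in Metric.ball (0 : EuclideanSpace ℝ (Fin n)) 1, ‖gradient u x‖ ^ 2) - (((n : ℝ) - 2) / 2) ^ 2 *
          (∫ x in Metric.ball (0 : EuclideanSpace ℝ (Fin n)) 1, u x ^ 2 / ‖x‖ ^ 2)
        < C *
          (∫ x in Metric.ball (0 : EuclideanSpace ℝ (Fin n)) 1,
              (X1 a ‖x‖) ^ (2 * ((n : ℝ) - 1) / ((n : ℝ) - 2)) *
                |u x| ^ (2 * (n : ℝ) / ((n : ℝ) - 2)))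
            ^ (((n : ℝ) - 2) / (n : ℝ)) := by
  have hn' : (3 : ℝ) ≤ n := by exact_mod_cast hn
  have hn2 : (0 : ℝ) < n - 2 := by linarith
  have hS := sobolevConst_pos hn
  have hC0 : 0 < C := lt_trans (by positivity) hC
  obtain ⟨δ, hδC, hδ⟩ : ∃ δ : ℝ,
      (a + δ) ^ (2 * ((n : ℝ) - 1) / n) * sobolevConst n < C ∧ 0 < δ := by
    have hc : ContinuousAt (fun δ : ℝ ↦ (a + δ) ^ (2 * ((n : ℝ) - 1) / n) * sobolevConst n) 0 :=
      ((continuousAt_const.add continuousAt_id).rpow_const (Or.inl (by simp [ha0.ne']))).mul_const _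
    have hlt : ∀ᶠ δ : ℝ in 𝓝[>] 0,
        (a + δ) ^ (2 * ((n : ℝ) - 1) / n) * sobolevConst n < C :=
      nhdsWithin_le_nhds (hc.eventually_lt_const (by simpa using hC))
    exact (hlt.and self_mem_nhdsWithin).exists
  have hb : 0 < a + δ := by linarith
  set p := 2 * ((n : ℝ) - 1) / ((n : ℝ) - 2) with hp
  set q := 2 * (n : ℝ) / ((n : ℝ) - 2) with hq
  have hp0 : 0 < p := div_pos (by linarith) hn2
  have hq0 : 0 < q := by positivity
  obtain ⟨u, hu, hus, hut, hur, hlt⟩ := exists_contDiff_sobolev_quotient_lt_of_shell hn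
    (K := C * ((a + δ) ^ (2 * ((n : ℝ) - 1) / n))⁻¹)
    (by rw [← div_eq_mul_inv, lt_div_iff₀ (by positivity), mul_comm]; exact hδC)
    (exp_pos (-δ)) (exp_lt_one_iff.2 (by linarith))
  have huq : Continuous fun x ↦ |u x| ^ q := hu.continuous.abs.rpow_const fun _ ↦ Or.inr hq0.le
  have huqi : Integrable fun x ↦ |u x| ^ q :=
    huq.integrable_of_hasCompactSupport (hus.comp_left (g := fun t ↦ |t| ^ q)
      (by simp [hq0.ne']))
  have hz (x) (hx : x ∉ Metric.ball (0 : EuclideanSpace ℝ (Fin n)) 1) : u x = 0 :=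
    image_eq_zero_of_notMem_tsupport fun h ↦ hx (hut h)
  have hX0 (x) (hx : x ∈ Metric.ball (0 : EuclideanSpace ℝ (Fin n)) 1) :
      0 ≤ X1 a ‖x‖ ∧ X1 a ‖x‖ ≤ a⁻¹ := by
    have : log ‖x‖ ≤ 0 := log_nonpos (norm_nonneg _) (mem_ball_zero_iff.1 hx).le
    exact ⟨inv_nonneg.2 (by linarith), inv_anti₀ ha0 (by linarith)⟩
  have hgrad : ∫ x in Metric.ball (0 : EuclideanSpace ℝ (Fin n)) 1, ‖gradient u x‖ ^ 2 ≤
      ∫ x, ‖fderiv ℝ u x‖ ^ 2 := by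
    have h (x) : ‖gradient u x‖ = ‖fderiv ℝ u x‖ := by simp [gradient]
    simp_rw [h]
    refine setIntegral_le_integral ?_ (ae_of_all _ fun x ↦ by positivity)
    have hc : Continuous fun x ↦ ‖fderiv ℝ u x‖ ^ 2 :=
      (hu.continuous_fderiv (by simp)).norm.pow 2
    refine hc.integrable_of_hasCompactSupport ?_
    exact (hus.fderiv (𝕜 := ℝ)).comp_left (g := fun t ↦ ‖t‖ ^ 2) (by simp)
  have hhardy : 0 ≤ ∫ x in Metric.ball (0 : EuclideanSpace ℝ (Fin n)) 1, u x ^ 2 / ‖x‖ ^ 2 :=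
    integral_nonneg fun x ↦ by positivity
  have hweight : (a + δ)⁻¹ ^ p * ∫ x, |u x| ^ q ≤
      ∫ x in Metric.ball (0 : EuclideanSpace ℝ (Fin n)) 1, X1 a ‖x‖ ^ p * |u x| ^ q := by
    rw [← setIntegral_eq_integral_of_forall_compl_eq_zero (s := Metric.ball 0 1)
      fun x hx ↦ by simp [hz x hx, hq0.ne'], ← integral_const_mul]
    refine setIntegral_mono_on (huqi.const_mul _).integrableOn ?_ measurableSet_ball fun x hx ↦ ?_
    · refine Integrable.mono' (huqi.const_mul (a⁻¹ ^ p)).integrableOn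
        (Measurable.aestronglyMeasurable ?_) ?_
      · have := huq.measurable
        unfold X1
        fun_prop
      · filter_upwards [ae_restrict_mem measurableSet_ball] with x hx
        have := hX0 x hx
        rw [norm_of_nonneg (mul_nonneg (rpow_nonneg this.1 _) (by positivity))]
        gcongr
        exacts [this.1, this.2]
    · by_cases hux : u x = 0
      · simp [hux, hq0.ne']
      gcongr
      have h1 : -δ ≤ log ‖x‖ := by
        rw [le_log_iff_exp_le ((exp_pos _).trans_le (hur x hux))]
        exact hur x hux
      have h2 : log ‖x‖ ≤ 0 := log_nonpos (norm_nonneg _) (mem_ball_zero_iff.1 hx).le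
      exact inv_anti₀ (by linarith) (by linarith)
  have hmain : (∫ x in Metric.ball (0 : EuclideanSpace ℝ (Fin n)) 1, ‖gradient u x‖ ^ 2) -
      (((n : ℝ) - 2) / 2) ^ 2 *
        (∫ x in Metric.ball (0 : EuclideanSpace ℝ (Fin n)) 1, u x ^ 2 / ‖x‖ ^ 2) <
      C * (∫ x in Metric.ball (0 : EuclideanSpace ℝ (Fin n)) 1,
        X1 a ‖x‖ ^ p * |u x| ^ q) ^ (((n : ℝ) - 2) / n) := by
    have hI : 0 ≤ ∫ x, |u x| ^ q := integral_nonneg fun x ↦ by positivity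
    calc _ ≤ ∫ x, ‖fderiv ℝ u x‖ ^ 2 := by
          have := mul_nonneg (sq_nonneg (((n : ℝ) - 2) / 2)) hhardy
          linarith
      _ < _ := hlt
      _ = C * ((a + δ)⁻¹ ^ p * ∫ x, |u x| ^ q) ^ (((n : ℝ) - 2) / n) := by
          rw [mul_rpow (by positivity) hI, ← rpow_mul (by positivity), inv_rpow hb.le, hp,
            div_mul_div_cancel₀ hn2.ne', mul_assoc]
      _ ≤ _ := by gcongr
  refine ⟨u, ?_, hu, hus, hut, hmain⟩
  rintro rfl
  have hexp : ((n : ℝ) - 2) / n ≠ 0 := by positivity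
  simp [gradient, hq0.ne', zero_rpow hexp] at hmain
end
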